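/- arXiv:math/9511225 — 9 statements merged into one kernel-verified Lean document; each statement's English description precedes it below -/
import Mathlib

section
/- For every body K in E^d and every integer n ≥ 1, there exists an n-reduced covering of E^d with replicas of K. -/
open Set

noncomputable section

/-- `d`-dimensional Euclidean space. -/
abbrev Euc (d : ℕ) := EuclideanSpace ℝ (Fin d)

/-- `L` is a replica of `K`: the image of `K` under an isometry of `Euc d`. -/
def IsReplica {d : ℕ} (K L : Set (Euc d)) : Prop :=
  ∃ f : Euc d ≃ᵢ Euc d, f '' K = L

/-- A body: a nonempty compact connected set equal to the closure of its interior. -/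
def IsBody {d : ℕ} (K : Set (Euc d)) : Prop :=
  K.Nonempty ∧ IsCompact K ∧ IsConnected K ∧ K = closure (interior K)

/-- A covering of `Euc d` with replicas of `K`. -/
def IsCovering {d : ℕ} (K : Set (Euc d)) (C : Set (Set (Euc d))) : Prop :=
  (∀ L ∈ C, IsReplica K L) ∧ ⋃₀ C = univ

/-- A covering `C` with replicas of `K` is `n`-reduced if one cannot delete `n` members
of `C` and replace them by `n - 1` replicas of `K` so that the result is still a
covering. -/
def IsNReduced {d : ℕ} (K : Set (Euc d)) (C : Set (Set (Euc d))) (n : ℕ) : Prop :=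
  ¬ ∃ (S : Set (Set (Euc d))) (L : Fin (n - 1) → Set (Euc d)),
      S ⊆ C ∧ S.Finite ∧ S.ncard = n ∧
      (∀ j, IsReplica K (L j)) ∧
      (⋃₀ (C \ S)) ∪ (⋃ j, L j) = univ

open Filter Topology

/-- The set of limits along the ultrafilter `U` of points chosen in a sequence of sets. -/
def ultralimit {E : Type*} [TopologicalSpace E] (U : Ultrafilter ℕ) (g : ℕ → Set E) : Set E :=
  {p | ∃ u : ℕ → E, (∀ᶠ i in (U : Filter ℕ), u i ∈ g i) ∧ Tendsto u U (𝓝 p)}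

/-- The nonempty ultralimits of sequences of members of the families `C i`. -/
def limitFamily {E : Type*} [TopologicalSpace E] (U : Ultrafilter ℕ)
    (C : ℕ → Finset (Set E)) : Set (Set E) :=
  {L | L.Nonempty ∧ ∃ g : ℕ → Set E, (∀ᶠ i in (U : Filter ℕ), g i ∈ C i) ∧ ultralimit U g = L}

/-- Every point of `A` is within `ε` of a point of some member of `C`. -/
def NearlyCovers {E : Type*} [PseudoMetricSpace E] (ε : ℝ) (C : Set (Set E)) (A : Set E) : Prop :=
  ∀ p ∈ A, ∃ L ∈ C, ∃ y ∈ L, dist p y ≤ ε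

theorem ultralimit_congr {E : Type*} [TopologicalSpace E] {U : Ultrafilter ℕ} {g h : ℕ → Set E}
    (H : ∀ᶠ i in (U : Filter ℕ), g i = h i) : ultralimit U g = ultralimit U h := by
  ext p
  constructor
  · rintro ⟨u, hu, hp⟩
    refine ⟨u, ?_, hp⟩
    filter_upwards [hu, H] with i h1 h2
    rwa [← h2]
  · rintro ⟨u, hu, hp⟩
    refine ⟨u, ?_, hp⟩
    filter_upwards [hu, H] with i h1 h2
    rwa [h2]

theorem exists_tendsto_of_dist_le {E : Type*} [PseudoMetricSpace E] [ProperSpace E]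
    (U : Ultrafilter ℕ) (u : ℕ → E) (p : E) (R : ℝ)
    (h : ∀ᶠ i in (U : Filter ℕ), dist (u i) p ≤ R) : ∃ q, Tendsto u U (𝓝 q) := by
  obtain ⟨q, -, hq⟩ := (isCompact_closedBall p R).ultrafilter_le_nhds (U.map u) (by
    rw [le_principal_iff]
    exact h)
  exact ⟨q, hq⟩

theorem Isometry.surjective_of_euc {d : ℕ} {f : Euc d → Euc d} (hf : Isometry f) :
    Function.Surjective f :=
  (hf.affineIsometryOfStrictConvexSpace.toAffineIsometryEquiv rfl).surjective

theorem IsReplica.ultralimit {d : ℕ} {K : Set (Euc d)} (hK : IsCompact K) {U : Ultrafilter ℕ}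
    {g : ℕ → Set (Euc d)} (hg : ∀ᶠ i in (U : Filter ℕ), IsReplica K (g i))
    (hne : (ultralimit U g).Nonempty) : IsReplica K (ultralimit U g) := by
  obtain ⟨p, u, hu, hp⟩ := hne
  obtain ⟨F, hF⟩ : ∃ F : ℕ → Euc d ≃ᵢ Euc d, ∀ᶠ i in (U : Filter ℕ), F i '' K = g i := by
    have : ∀ i, ∃ f : Euc d ≃ᵢ Euc d, IsReplica K (g i) → f '' K = g i := by
      intro i
      by_cases h : IsReplica K (g i)
      · obtain ⟨f, hf⟩ := h
        exact ⟨f, fun _ => hf⟩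
      · exact ⟨IsometryEquiv.refl _, fun h' => absurd h' h⟩
    choose F hF using this
    exact ⟨F, hg.mono fun i hi => hF i hi⟩
  have key : ∀ u : ℕ → Euc d, (∀ᶠ i in (U : Filter ℕ), u i ∈ g i) →
      ∃ b : ℕ → Euc d, ∃ a ∈ K, Tendsto b U (𝓝 a) ∧ ∀ᶠ i in (U : Filter ℕ), F i (b i) = u i := by
    intro u hu
    have hb : ∀ᶠ i in (U : Filter ℕ), (F i).symm (u i) ∈ K := by
      filter_upwards [hu, hF] with i h1 h2
      rw [← h2] at h1
      obtain ⟨a, ha, h⟩ := h1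
      rw [← h]
      simpa using ha
    obtain ⟨a, ha, hlim⟩ := hK.ultrafilter_le_nhds (U.map fun i => (F i).symm (u i)) (by
      rw [le_principal_iff]
      exact hb)
    exact ⟨fun i => (F i).symm (u i), a, ha, hlim, by simp⟩
  obtain ⟨b, a, -, hba, hFb⟩ := key u hu
  have hconv : ∀ x, ∃ y, Tendsto (fun i => F i x) U (𝓝 y) := by
    intro x
    refine exists_tendsto_of_dist_le U _ p (dist x a + 1 + 1) ?_
    filter_upwards [hFb, (Metric.tendsto_nhds.1 hba) 1 one_pos,
      (Metric.tendsto_nhds.1 hp) 1 one_pos] with i h1 h2 h3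
    have h4 := dist_triangle (F i x) (F i (b i)) p
    rw [(F i).dist_eq] at h4
    rw [h1] at h4
    have h5 := dist_triangle x a (b i)
    rw [dist_comm a] at h5
    linarith
  choose f hf using hconv
  have hiso : Isometry f := Isometry.of_dist_eq fun x y => by
    refine tendsto_nhds_unique ((hf x).dist (hf y)) ?_
    simp only [IsometryEquiv.dist_eq]
    exact tendsto_const_nhds
  have hmove : ∀ (b : ℕ → Euc d) (a : Euc d), Tendsto b U (𝓝 a) →
      Tendsto (fun i => F i (b i)) U (𝓝 (f a)) := by
    intro b a hba
    refine (hf a).congr_dist ?_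
    simp only [IsometryEquiv.dist_eq]
    have := (tendsto_const_nhds (x := a)).dist hba
    simpa using this
  refine ⟨⟨Equiv.ofBijective f ⟨hiso.injective, hiso.surjective_of_euc⟩, hiso⟩, ?_⟩
  ext q
  constructor
  · rintro ⟨x, hx, rfl⟩
    refine ⟨fun i => F i x, ?_, hf x⟩
    filter_upwards [hF] with i hi
    rw [← hi]
    exact mem_image_of_mem _ hx
  · rintro ⟨v, hv, hq⟩
    obtain ⟨b, a, ha, hba, hFb⟩ := key v hv
    refine ⟨a, ha, ?_⟩
    exact tendsto_nhds_unique ((hmove b a hba).congr' hFb) hq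

theorem exists_mem_limitFamily {E : Type*} [PseudoMetricSpace E] {U : Ultrafilter ℕ}
    {C : ℕ → Finset (Set E)} {ε : ℕ → ℝ} (hε : Tendsto ε U (𝓝 0)) {p : E}
    (h : ∀ᶠ i in (U : Filter ℕ), ∃ L ∈ C i, ∃ y ∈ L, dist p y ≤ ε i) :
    ∃ L ∈ limitFamily U C, p ∈ L := by
  have : ∀ i, ∃ L : Set E, ∃ y, (∃ L ∈ C i, ∃ y ∈ L, dist p y ≤ ε i) →
      L ∈ C i ∧ y ∈ L ∧ dist p y ≤ ε i := by
    intro i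
    by_cases h : ∃ L ∈ C i, ∃ y ∈ L, dist p y ≤ ε i
    · obtain ⟨L, hL, y, hy, h'⟩ := h
      exact ⟨L, y, fun _ => ⟨hL, hy, h'⟩⟩
    · exact ⟨∅, p, fun h' => absurd h' h⟩
  choose g u hgu using this
  have hp : p ∈ ultralimit U g := by
    refine ⟨u, h.mono fun i hi => (hgu i hi).2.1, ?_⟩
    rw [tendsto_iff_dist_tendsto_zero]
    refine squeeze_zero' (Eventually.of_forall fun _ => dist_nonneg) ?_ hε
    filter_upwards [h] with i hi
    rw [dist_comm]
    exact (hgu i hi).2.2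
  exact ⟨_, ⟨⟨p, hp⟩, g, h.mono fun i hi => (hgu i hi).1, rfl⟩, hp⟩

open scoped Classical in
theorem exists_lift_of_subset_limitFamily {E : Type*} [TopologicalSpace E] {U : Ultrafilter ℕ}
    {C : ℕ → Finset (Set E)} {S : Finset (Set E)} (hS : (S : Set (Set E)) ⊆ limitFamily U C) :
    ∃ g : Set E → ℕ → Set E, (∀ s ∈ S, ultralimit U (g s) = s) ∧
      ∀ᶠ i in (U : Filter ℕ), (∀ s ∈ S, g s i ∈ C i) ∧
        (S.image fun s => g s i).card = S.card := by
  have : ∀ s, ∃ g : ℕ → Set E, s ∈ S →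
      (∀ᶠ i in (U : Filter ℕ), g i ∈ C i) ∧ ultralimit U g = s := by
    intro s
    by_cases h : s ∈ S
    · obtain ⟨-, g, hg⟩ := hS h
      exact ⟨g, fun _ => hg⟩
    · exact ⟨fun _ => ∅, fun h' => absurd h' h⟩
  choose g hg using this
  refine ⟨g, fun s hs => (hg s hs).2, ?_⟩
  have h1 : ∀ᶠ i in (U : Filter ℕ), ∀ s ∈ S, g s i ∈ C i :=
    (eventually_all_finset S).2 fun s hs => (hg s hs).1
  have h2 : ∀ᶠ i in (U : Filter ℕ), ∀ s ∈ S, ∀ t ∈ S, g s i = g t i → s = t := by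
    refine (eventually_all_finset S).2 fun s hs => (eventually_all_finset S).2 fun t ht => ?_
    by_contra hcon
    rw [← Ultrafilter.eventually_not] at hcon
    have heq : ultralimit U (g s) = ultralimit U (g t) := by
      refine ultralimit_congr (hcon.mono fun i hi => ?_)
      by_contra h
      exact hi fun h' => absurd h' h
    rw [(hg s hs).2, (hg t ht).2] at heq
    obtain ⟨i, hi⟩ := hcon.exists
    exact hi fun _ => heq
  filter_upwards [h1, h2] with i hi1 hi2
  exact ⟨hi1, Finset.card_image_of_injOn fun s hs t ht h => hi2 s hs t ht h⟩

theorem limitFamily_isReplica {d : ℕ} {K : Set (Euc d)} (hK : IsCompact K) {U : Ultrafilter ℕ}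
    {C : ℕ → Finset (Set (Euc d))} (hC : ∀ i, ∀ L ∈ C i, IsReplica K L) :
    ∀ L ∈ limitFamily U C, IsReplica K L := by
  rintro L ⟨hne, g, hg, rfl⟩
  exact IsReplica.ultralimit hK (hg.mono fun i hi => hC i _ hi) hne

/-- If at most `n` replicas can cover `A` up to arbitrarily small errors, then at most `n` replicas
cover `A`. -/
theorem exists_cover_of_forall_nearlyCovers {d : ℕ} {K : Set (Euc d)} (hK : IsCompact K)
    (A : Set (Euc d)) (n : ℕ)
    (h : ∀ ε > 0, ∃ C : Finset (Set (Euc d)), (∀ L ∈ C, IsReplica K L) ∧ C.card ≤ n ∧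
      NearlyCovers ε (C : Set (Set (Euc d))) A) :
    ∃ C : Finset (Set (Euc d)), (∀ L ∈ C, IsReplica K L) ∧ C.card ≤ n ∧
      NearlyCovers 0 (C : Set (Set (Euc d))) A := by
  choose C hC hn hcov using fun i : ℕ => h (1 / ((i : ℝ) + 1)) (by positivity)
  let U : Ultrafilter ℕ := hyperfilter ℕ
  have hU : (U : Filter ℕ) ≤ atTop := by
    rw [← Nat.cofinite_eq_atTop]
    exact hyperfilter_le_cofinite
  have hcard : ∀ S : Finset (Set (Euc d)), (S : Set (Set (Euc d))) ⊆ limitFamily U C →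
      S.card ≤ n := by
    intro S hS
    obtain ⟨g, -, hg⟩ := exists_lift_of_subset_limitFamily hS
    obtain ⟨i, hi, hi'⟩ := hg.exists
    rw [← hi']
    refine (Finset.card_le_card ?_).trans (hn i)
    intro x hx
    obtain ⟨s, hs, rfl⟩ := Finset.mem_image.1 hx
    exact hi s hs
  have hfin : (limitFamily U C).Finite := by
    by_contra hinf
    obtain ⟨t, ht, ht'⟩ := Set.Infinite.exists_subset_card_eq hinf (n + 1)
    have := hcard t ht
    omega
  refine ⟨hfin.toFinset, ?_, ?_, ?_⟩
  · intro L hL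
    exact limitFamily_isReplica hK hC L (hfin.mem_toFinset.1 hL)
  · exact hcard _ (by simp)
  · intro p hp
    obtain ⟨L, hL, hpL⟩ := exists_mem_limitFamily (U := U) (C := C) (p := p)
      (tendsto_one_div_add_atTop_nhds_zero_nat.mono_left hU)
      (Eventually.of_forall fun i => hcov i p hp)
    exact ⟨L, by simpa using hL, p, hpL, by simp⟩

/-- The lattice cell of a point. -/
def cellMap {d : ℕ} (x : Euc d) : Fin d → ℤ := fun i => ⌊x i⌋

/-- The points of the lattice as points of Euclidean space. -/
def latticePoint {d : ℕ} (z : Fin d → ℤ) : Euc d := WithLp.toLp 2 fun i => (z i : ℝ)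

/-- The lattice points of the half-open cube with corner `y` and side `T`. -/
def latticeBox {d : ℕ} (y : Fin d → ℤ) (T : ℕ) : Finset (Fin d → ℤ) :=
  Fintype.piFinset fun i => Finset.Ico (y i) (y i + T)

/-- The half-open cube with corner `y` and side `T`. -/
def cube {d : ℕ} (y : Fin d → ℤ) (T : ℕ) : Set (Euc d) := cellMap ⁻¹' (latticeBox y T)

/-- The least number of replicas of `K` in a finite cover of `A`. -/
def coverNumber {d : ℕ} (K A : Set (Euc d)) : ℕ :=
  sInf {n | ∃ C : Finset (Set (Euc d)), (∀ L ∈ C, IsReplica K L) ∧ C.card = n ∧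
    NearlyCovers 0 (C : Set (Set (Euc d))) A}

theorem mem_latticeBox {d : ℕ} {y : Fin d → ℤ} {T : ℕ} {z : Fin d → ℤ} :
    z ∈ latticeBox y T ↔ ∀ i, y i ≤ z i ∧ z i < y i + T := by
  simp [latticeBox]

theorem mem_cube {d : ℕ} {y : Fin d → ℤ} {T : ℕ} {p : Euc d} :
    p ∈ cube y T ↔ ∀ i, y i ≤ ⌊p i⌋ ∧ ⌊p i⌋ < y i + T := by
  simp [cube, cellMap, mem_latticeBox]

theorem card_latticeBox {d : ℕ} (y : Fin d → ℤ) (T : ℕ) : (latticeBox y T).card = T ^ d := by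
  simp [latticeBox]

theorem floor_latticePoint {d : ℕ} (z : Fin d → ℤ) (i : Fin d) : ⌊latticePoint z i⌋ = z i := by
  simp [latticePoint]

theorem floor_le_floor_add {d : ℕ} {p q : Euc d} {n : ℕ} (h : dist p q ≤ n) (i : Fin d) :
    ⌊p i⌋ ≤ ⌊q i⌋ + n := by
  have h1 : |p i - q i| ≤ n := by
    have := PiLp.norm_apply_le (p - q) i
    rw [← dist_eq_norm] at this
    simpa using this.trans h
  have h2 : p i ≤ q i + n := by linarith [le_abs_self (p i - q i)]
  calc ⌊p i⌋ ≤ ⌊q i + n⌋ := Int.floor_le_floor h2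
    _ = ⌊q i⌋ + n := Int.floor_add_natCast _ _

theorem mem_cube_of_dist_le {d : ℕ} {p q : Euc d} {n r : ℕ} {y : Fin d → ℤ} {T : ℕ}
    (h : dist p q ≤ n) (hnr : n ≤ r) (hq : q ∈ cube y T) :
    p ∈ cube (fun i => y i - r) (T + 2 * r) := by
  rw [mem_cube] at hq ⊢
  intro i
  have h1 := floor_le_floor_add h i
  have h2 := floor_le_floor_add ((dist_comm q p).trans_le h) i
  have h3 := hq i
  push_cast
  constructor <;> omega

theorem IsReplica.image {d : ℕ} {K L : Set (Euc d)} (h : IsReplica K L) (f : Euc d ≃ᵢ Euc d) :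
    IsReplica K (f '' L) := by
  obtain ⟨e, rfl⟩ := h
  exact ⟨e.trans f, by rw [image_image]; rfl⟩

theorem coverNumber_le {d : ℕ} {K A : Set (Euc d)} {C : Finset (Set (Euc d))}
    (hC : ∀ L ∈ C, IsReplica K L) (hA : NearlyCovers 0 (C : Set (Set (Euc d))) A) :
    coverNumber K A ≤ C.card :=
  Nat.sInf_le ⟨C, hC, rfl, hA⟩

open scoped Classical in
theorem NearlyCovers.translate_cube {d : ℕ} {K : Set (Euc d)} {C : Finset (Set (Euc d))}
    (hC : ∀ L ∈ C, IsReplica K L) {ε : ℝ} {y : Fin d → ℤ} {T : ℕ}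
    (h : NearlyCovers ε (C : Set (Set (Euc d))) (cube y T)) (y' : Fin d → ℤ) :
    ∃ C' : Finset (Set (Euc d)), (∀ L ∈ C', IsReplica K L) ∧ C'.card ≤ C.card ∧
      NearlyCovers ε (C' : Set (Set (Euc d))) (cube y' T) := by
  let f : Euc d ≃ᵢ Euc d := IsometryEquiv.addRight (latticePoint (y' - y))
  refine ⟨C.image fun L => f '' L, ?_, Finset.card_image_le, ?_⟩
  · intro L hL
    obtain ⟨M, hM, rfl⟩ := Finset.mem_image.1 hL
    exact (hC M hM).image f
  · intro p hp
    have hp' : p - latticePoint (y' - y) ∈ cube y T := by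
      rw [mem_cube] at hp ⊢
      intro i
      have h1 := hp i
      have h2 : ⌊(p - latticePoint (y' - y)) i⌋ = ⌊p i⌋ - (y' i - y i) := by
        simp only [PiLp.sub_apply, latticePoint, Pi.sub_apply]
        exact Int.floor_sub_intCast _ _
      rw [h2]
      omega
    obtain ⟨L, hL, z, hz, hd⟩ := h _ hp'
    refine ⟨f '' L, by simpa using ⟨L, hL, rfl⟩, f z, mem_image_of_mem _ hz, ?_⟩
    have : p = f (p - latticePoint (y' - y)) := by simp [f]
    rw [this, f.dist_eq]
    exact hd

theorem unitCube_subset {d : ℕ} :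
    cube (0 : Fin d → ℤ) 1 ⊆ WithLp.toLp 2 '' Icc (0 : Fin d → ℝ) 1 := by
  intro p hp
  rw [mem_cube] at hp
  have h0 : ∀ i, ⌊p i⌋ = 0 := fun i => by
    have := hp i
    simp only [Pi.zero_apply] at this
    omega
  have h1 : ∀ i, 0 ≤ p i ∧ p i < 1 := fun i => Int.floor_eq_zero_iff.1 (h0 i)
  exact ⟨p.ofLp, ⟨fun i => (h1 i).1, fun i => (h1 i).2.le⟩, rfl⟩

open scoped Classical in
theorem exists_cell_covers {d : ℕ} {K : Set (Euc d)} (hK : (interior K).Nonempty) :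
    ∃ c : ℕ, ∀ z : Fin d → ℤ, ∃ C : Finset (Set (Euc d)), (∀ L ∈ C, IsReplica K L) ∧
      C.card ≤ c ∧ NearlyCovers 0 (C : Set (Set (Euc d))) (cellMap ⁻¹' {z}) := by
  obtain ⟨a, ha⟩ := hK
  obtain ⟨δ, hδ, hball⟩ := Metric.isOpen_iff.1 isOpen_interior a ha
  have hcompact : IsCompact (WithLp.toLp 2 '' Icc (0 : Fin d → ℝ) 1) :=
    isCompact_Icc.image (PiLp.continuous_toLp 2 _)
  obtain ⟨t, ht, hcov⟩ := Metric.totallyBounded_iff.1 hcompact.totallyBounded δ hδ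
  obtain ⟨C₀, hC₀, h0⟩ : ∃ C : Finset (Set (Euc d)), (∀ L ∈ C, IsReplica K L) ∧
      NearlyCovers 0 (C : Set (Set (Euc d))) (cube 0 1) := by
    refine ⟨ht.toFinset.image fun y => IsometryEquiv.addRight (y - a) '' K, fun L hL => ?_, ?_⟩
    · obtain ⟨y, -, rfl⟩ := Finset.mem_image.1 hL
      exact ⟨_, rfl⟩
    intro p hp
    obtain ⟨y, hy, hpy⟩ := mem_iUnion₂.1 (hcov (unitCube_subset hp))
    refine ⟨(IsometryEquiv.addRight (y - a)) '' K, by simpa using ⟨y, hy, rfl⟩, p, ?_, by simp⟩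
    refine ⟨p - (y - a), interior_subset (hball ?_), by simp⟩
    rw [Metric.mem_ball, dist_eq_norm] at hpy ⊢
    convert hpy using 2
    abel
  refine ⟨C₀.card, fun z => ?_⟩
  obtain ⟨C, hC, hcard, hCov⟩ := h0.translate_cube hC₀ z
  refine ⟨C, hC, hcard, fun p hp => hCov p ?_⟩
  rw [mem_cube]
  intro i
  have : ⌊p i⌋ = z i := congrFun hp i
  simp [this]

open scoped Classical in
theorem exists_cover_union {d : ℕ} {K : Set (Euc d)} (hK : (interior K).Nonempty) :
    ∃ c : ℕ, ∀ (A : Set (Euc d)) (G : Finset (Fin d → ℤ)) (C : Finset (Set (Euc d))),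
      (∀ L ∈ C, IsReplica K L) → NearlyCovers 0 (C : Set (Set (Euc d))) A →
      ∃ C' : Finset (Set (Euc d)), (∀ L ∈ C', IsReplica K L) ∧ C'.card ≤ C.card + G.card * c ∧
        NearlyCovers 0 (C' : Set (Set (Euc d))) (A ∪ cellMap ⁻¹' G) := by
  obtain ⟨c, hc⟩ := exists_cell_covers hK
  choose O hO hOc hOcov using hc
  refine ⟨c, fun A G C hC hA => ?_⟩
  refine ⟨C ∪ G.biUnion O, ?_, ?_, ?_⟩
  · intro L hL
    rcases Finset.mem_union.1 hL with hL | hL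
    · exact hC L hL
    · obtain ⟨z, -, hz⟩ := Finset.mem_biUnion.1 hL
      exact hO z L hz
  · refine (Finset.card_union_le _ _).trans ?_
    gcongr
    exact Finset.card_biUnion_le_card_mul _ _ _ fun z _ => hOc z
  · rintro p (hp | hp)
    · obtain ⟨L, hL, h⟩ := hA p hp
      exact ⟨L, Finset.mem_coe.2 (Finset.mem_union_left _ hL), h⟩
    · obtain ⟨L, hL, h⟩ := hOcov (cellMap p) p rfl
      exact ⟨L, Finset.mem_coe.2 (Finset.mem_union_right _ (Finset.mem_biUnion.2 ⟨_, hp, hL⟩)), h⟩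

theorem exists_card_eq_coverNumber {d : ℕ} {K : Set (Euc d)} (hK : (interior K).Nonempty)
    (y : Fin d → ℤ) (T : ℕ) :
    ∃ C : Finset (Set (Euc d)), (∀ L ∈ C, IsReplica K L) ∧ C.card = coverNumber K (cube y T) ∧
      NearlyCovers 0 (C : Set (Set (Euc d))) (cube y T) := by
  obtain ⟨c, hc⟩ := exists_cover_union hK
  obtain ⟨C, hC, -, hcov⟩ := hc ∅ (latticeBox y T) ∅ (by simp) (by simp [NearlyCovers])
  rw [empty_union] at hcov
  have hne : {n | ∃ C : Finset (Set (Euc d)), (∀ L ∈ C, IsReplica K L) ∧ C.card = n ∧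
      NearlyCovers 0 (C : Set (Set (Euc d))) (cube y T)}.Nonempty := ⟨C.card, C, hC, rfl, hcov⟩
  exact Nat.sInf_mem hne

theorem latticeBox_subset {d : ℕ} (y : Fin d → ℤ) (T r : ℕ) :
    latticeBox y T ⊆ latticeBox (fun i => y i - r) (T + 2 * r) := by
  intro z hz
  rw [mem_latticeBox] at hz ⊢
  intro i
  have := hz i
  push_cast
  constructor <;> omega

theorem exists_coverNumber_enlarge_le {d : ℕ} {K : Set (Euc d)} (hK : (interior K).Nonempty) :
    ∃ c : ℕ, ∀ (y : Fin d → ℤ) (T r : ℕ), coverNumber K (cube (fun i => y i - r) (T + 2 * r)) ≤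
      coverNumber K (cube y T) + ((T + 2 * r) ^ d - T ^ d) * c := by
  obtain ⟨c, hc⟩ := exists_cover_union hK
  refine ⟨c, fun y T r => ?_⟩
  obtain ⟨C, hC, hcard, hcov⟩ := exists_card_eq_coverNumber hK y T
  obtain ⟨C', hC', hcard', hcov'⟩ :=
    hc _ (latticeBox (fun i => y i - r) (T + 2 * r) \ latticeBox y T) C hC hcov
  rw [Finset.card_sdiff_of_subset (latticeBox_subset y T r), card_latticeBox, card_latticeBox,
    hcard] at hcard'
  refine (coverNumber_le hC' fun p hp => hcov' p ?_).trans hcard'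
  by_cases h : cellMap p ∈ latticeBox y T
  · exact Or.inl h
  · exact Or.inr (by simpa using ⟨hp, h⟩)

theorem exists_coverNumber_le_of_nearlyCovers {d : ℕ} {K : Set (Euc d)} (hK : IsCompact K)
    (hK' : (interior K).Nonempty) (T : ℕ) :
    ∃ ε : ℝ, 0 < ε ∧ ε ≤ 1 ∧ ∀ (y : Fin d → ℤ) (C : Finset (Set (Euc d))),
      (∀ L ∈ C, IsReplica K L) → NearlyCovers ε (C : Set (Set (Euc d))) (cube y T) →
      coverNumber K (cube y T) ≤ C.card := by
  by_contra! hcon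
  have hlt : ∀ ε > 0, ∃ C : Finset (Set (Euc d)), (∀ L ∈ C, IsReplica K L) ∧
      C.card < coverNumber K (cube (0 : Fin d → ℤ) T) ∧
      NearlyCovers ε (C : Set (Set (Euc d))) (cube 0 T) := by
    intro ε hε
    obtain ⟨y, C, hC, hcov, hlt⟩ := hcon (min ε 1) (by positivity) (min_le_right _ _)
    obtain ⟨C', hC', hcard', hcov'⟩ := hcov.translate_cube hC 0
    obtain ⟨O, hO, hOcard, hOcov⟩ := exists_card_eq_coverNumber hK' (0 : Fin d → ℤ) T
    obtain ⟨O', hO', hOcard', hOcov'⟩ := hOcov.translate_cube hO y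
    have := coverNumber_le hO' hOcov'
    refine ⟨C', hC', by omega, fun p hp => ?_⟩
    obtain ⟨L, hL, q, hq, hd⟩ := hcov' p hp
    exact ⟨L, hL, q, hq, hd.trans (min_le_left _ _)⟩
  obtain ⟨C, hC, hcard, hcov⟩ := exists_cover_of_forall_nearlyCovers hK (cube (0 : Fin d → ℤ) T)
    (coverNumber K (cube (0 : Fin d → ℤ) T) - 1) fun ε hε => by
      obtain ⟨C, hC, hcard, hcov⟩ := hlt ε hε
      exact ⟨C, hC, by omega, hcov⟩
  obtain ⟨_, _, hpos, _⟩ := hlt 1 one_pos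
  have := coverNumber_le hC hcov
  omega

open scoped Classical in
/-- Within distance `k` of `x`, some members of the cover `C` of `A` can be replaced by fewer
replicas of `K` so that the result covers `A` up to an error `ε`. -/
def Reducible {d : ℕ} (K : Set (Euc d)) (k : ℕ) (ε : ℝ) (x : Euc d) (C : Finset (Set (Euc d)))
    (A : Set (Euc d)) : Prop :=
  ∃ S L : Finset (Set (Euc d)), S ⊆ C ∧ (∀ l ∈ L, IsReplica K l) ∧ L.card < S.card ∧
    (∀ s ∈ S, s ⊆ Metric.closedBall x k) ∧ (∀ l ∈ L, l ⊆ Metric.closedBall x k) ∧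
    NearlyCovers ε ((C \ S ∪ L : Finset (Set (Euc d))) : Set (Set (Euc d))) A

open scoped Classical in
/-- Well separated reductions of a minimal cover inside a cube save replicas simultaneously. -/
theorem card_separated_reducible_le {d : ℕ} {K : Set (Euc d)} (hK : (interior K).Nonempty)
    {D : ℕ} (hD : ∀ L, IsReplica K L → ∀ p ∈ L, ∀ q ∈ L, dist p q ≤ D)
    {A : Set (Euc d)} {C : Finset (Set (Euc d))} (hC : ∀ L ∈ C, IsReplica K L)
    (hA : NearlyCovers 0 (C : Set (Set (Euc d))) A)
    (hmin : ∀ C' : Finset (Set (Euc d)), (∀ L ∈ C', IsReplica K L) →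
      NearlyCovers 0 (C' : Set (Set (Euc d))) A → C.card ≤ C'.card)
    {y : Fin d → ℤ} {T : ℕ} (hsub : cube y T ⊆ A) {ε : ℝ} (hε0 : 0 ≤ ε) (hε : ε ≤ 1)
    (hεT : ∀ C' : Finset (Set (Euc d)), (∀ L ∈ C', IsReplica K L) →
      NearlyCovers ε (C' : Set (Set (Euc d))) (cube y T) → coverNumber K (cube y T) ≤ C'.card)
    {k : ℕ} {X : Finset (Fin d → ℤ)} (hX : X ⊆ latticeBox y T)
    (hsep : ∀ a ∈ X, ∀ b ∈ X, a ≠ b → 2 * (k : ℝ) + 1 < dist (latticePoint a) (latticePoint b))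
    (hred : ∀ a ∈ X, Reducible K k ε (latticePoint a) C A) :
    X.card + coverNumber K (cube y T) ≤
      coverNumber K (cube (fun i => y i - (k + D + 1 : ℕ)) (T + 2 * (k + D + 1))) := by
  set r := k + D + 1 with hr
  set B' : Set (Euc d) := cube (fun i => y i - r) (T + 2 * r) with hB'
  set CB := C.filter fun L => L ⊆ B' with hCB
  have hKne : ∀ L, IsReplica K L → L.Nonempty := by
    rintro L ⟨f, rfl⟩
    exact (hK.mono interior_subset).image f
  have hCBle : CB.card ≤ coverNumber K B' := by
    obtain ⟨O, hO, hOcard, hOcov⟩ :=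
      exists_card_eq_coverNumber hK (fun i => y i - r) (T + 2 * r)
    rw [← hB'] at hOcard
    have h1 := hmin (C \ CB ∪ O) (by
      intro L hL
      rcases Finset.mem_union.1 hL with hL | hL
      · exact hC L (Finset.mem_sdiff.1 hL).1
      · exact hO L hL) (by
      intro p hp
      obtain ⟨L, hL, q, hq, hd⟩ := hA p hp
      by_cases hLB : L ∈ CB
      · have hpq : p = q := dist_le_zero.1 hd
        obtain ⟨L', hL', h⟩ := hOcov p (hpq ▸ (Finset.mem_filter.1 hLB).2 hq)
        exact ⟨L', Finset.mem_coe.2 (Finset.mem_union_right _ hL'), h⟩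
      · exact ⟨L, Finset.mem_coe.2 (Finset.mem_union_left _ (Finset.mem_sdiff.2 ⟨hL, hLB⟩)),
          q, hq, hd⟩)
    have h2 := Finset.card_union_le (C \ CB) O
    have h3 : (C \ CB).card = C.card - CB.card :=
      Finset.card_sdiff_of_subset (Finset.filter_subset _ _)
    have h4 : CB.card ≤ C.card := Finset.card_le_card (Finset.filter_subset _ _)
    omega
  choose! S L hSC hL hcard hSk hLk hcov using hred
  have hSB : ∀ a ∈ X, S a ⊆ CB := by
    intro a ha s hs
    refine Finset.mem_filter.2 ⟨hSC a ha hs, fun p hp => ?_⟩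
    refine mem_cube_of_dist_le (Metric.mem_closedBall.1 (hSk a ha s hs hp)) (by omega) ?_
    have h1 := mem_latticeBox.1 (hX ha)
    rw [mem_cube]
    intro i
    rw [floor_latticePoint]
    exact h1 i
  have hdisj : ∀ a ∈ X, ∀ b ∈ X, ∀ s ∈ S b, ∀ p, dist p (latticePoint a) ≤ k →
      ∀ q ∈ s, dist p q ≤ ε → a = b := by
    intro a ha b hb s hs p hp q hq hd
    by_contra hab
    have h1 := hsep a ha b hb hab
    have h2 := Metric.mem_closedBall.1 (hSk b hb s hs hq)
    have h3 := dist_triangle (latticePoint a) p (latticePoint b)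
    have h4 := dist_triangle p q (latticePoint b)
    rw [dist_comm _ p] at h3
    linarith
  have hpd : (X : Set (Fin d → ℤ)).PairwiseDisjoint S := by
    intro a ha b hb hab
    refine Finset.disjoint_left.2 fun s hs hs' => ?_
    obtain ⟨p, hp⟩ := hKne s (hC s (hSC a ha hs))
    have h1 := hsep a ha b hb hab
    have h2 := Metric.mem_closedBall.1 (hSk a ha s hs hp)
    have h3 := Metric.mem_closedBall.1 (hSk b hb s hs' hp)
    have h4 := dist_triangle_left (latticePoint a) (latticePoint b) p
    linarith
  set G := CB \ X.biUnion S ∪ X.biUnion L with hG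
  have hGrep : ∀ l ∈ G, IsReplica K l := by
    intro l hl
    rcases Finset.mem_union.1 hl with hl | hl
    · exact hC l (Finset.mem_filter.1 (Finset.mem_sdiff.1 hl).1).1
    · obtain ⟨a, ha, hl⟩ := Finset.mem_biUnion.1 hl
      exact hL a ha l hl
  have hGcov : NearlyCovers ε (G : Set (Set (Euc d))) (cube y T) := by
    intro p hp
    have hnear : ∀ l ∈ C, ∀ q ∈ l, dist p q ≤ 1 → l ∈ CB := by
      intro l hl q hq hd
      refine Finset.mem_filter.2 ⟨hl, fun q' hq' => ?_⟩
      refine mem_cube_of_dist_le (n := D + 1) ?_ (by omega) hp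
      have h1 := hD l (hC l hl) q' hq' q hq
      have h2 := dist_triangle_right q' p q
      push_cast
      linarith
    obtain ⟨l, hl, q, hq, hd⟩ := hA p (hsub hp)
    have hpq : p = q := dist_le_zero.1 hd
    by_cases hlS : l ∈ X.biUnion S
    · obtain ⟨a, ha, hla⟩ := Finset.mem_biUnion.1 hlS
      have hpa : dist p (latticePoint a) ≤ k :=
        Metric.mem_closedBall.1 (hSk a ha l hla (hpq ▸ hq))
      obtain ⟨l', hl', q', hq', hd'⟩ := hcov a ha p (hsub hp)
      refine ⟨l', ?_, q', hq', hd'⟩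
      rcases Finset.mem_union.1 (Finset.mem_coe.1 hl') with hl' | hl'
      · obtain ⟨hl'C, hl'S⟩ := Finset.mem_sdiff.1 hl'
        refine Finset.mem_coe.2 (Finset.mem_union_left _ (Finset.mem_sdiff.2
          ⟨hnear l' hl'C q' hq' (hd'.trans hε), fun hmem => ?_⟩))
        obtain ⟨b, hb, hlb⟩ := Finset.mem_biUnion.1 hmem
        obtain rfl := hdisj a ha b hb l' hlb p hpa q' hq' hd'
        exact hl'S hlb
      · exact Finset.mem_coe.2 (Finset.mem_union_right _ (Finset.mem_biUnion.2 ⟨a, ha, hl'⟩))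
    · refine ⟨l, Finset.mem_coe.2 (Finset.mem_union_left _ (Finset.mem_sdiff.2
        ⟨hnear l hl q hq (hd.trans zero_le_one), hlS⟩)), q, hq, hd.trans hε0⟩
  have h1 := hεT G hGrep hGcov
  have h2 : G.card ≤ (CB.card - (X.biUnion S).card) + (X.biUnion L).card := by
    rw [← Finset.card_sdiff_of_subset (Finset.biUnion_subset.2 hSB)]
    exact Finset.card_union_le _ _
  have h3 : (X.biUnion S).card ≤ CB.card := Finset.card_le_card (Finset.biUnion_subset.2 hSB)
  have h4 : (X.biUnion L).card + X.card ≤ (X.biUnion S).card := by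
    rw [Finset.card_biUnion hpd]
    calc (X.biUnion L).card + X.card ≤ ∑ a ∈ X, (L a).card + ∑ a ∈ X, 1 := by
          rw [Finset.sum_const, smul_eq_mul, mul_one]
          gcongr
          exact Finset.card_biUnion_le
      _ = ∑ a ∈ X, ((L a).card + 1) := Finset.sum_add_distrib.symm
      _ ≤ ∑ a ∈ X, (S a).card := Finset.sum_le_sum fun a ha => hcard a ha
  omega

open scoped Classical in
theorem card_reducible_le {d : ℕ} {K : Set (Euc d)} (hK : (interior K).Nonempty)
    {D : ℕ} (hD : ∀ L, IsReplica K L → ∀ p ∈ L, ∀ q ∈ L, dist p q ≤ D)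
    {A : Set (Euc d)} {C : Finset (Set (Euc d))} (hC : ∀ L ∈ C, IsReplica K L)
    (hA : NearlyCovers 0 (C : Set (Set (Euc d))) A)
    (hmin : ∀ C' : Finset (Set (Euc d)), (∀ L ∈ C', IsReplica K L) →
      NearlyCovers 0 (C' : Set (Set (Euc d))) A → C.card ≤ C'.card)
    {y : Fin d → ℤ} {T : ℕ} (hsub : cube y T ⊆ A) {ε : ℝ} (hε0 : 0 ≤ ε) (hε : ε ≤ 1)
    (hεT : ∀ C' : Finset (Set (Euc d)), (∀ L ∈ C', IsReplica K L) →
      NearlyCovers ε (C' : Set (Set (Euc d))) (cube y T) → coverNumber K (cube y T) ≤ C'.card)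
    {c : ℕ} (hc : ∀ r : ℕ, coverNumber K (cube (fun i => y i - r) (T + 2 * r)) ≤
      coverNumber K (cube y T) + ((T + 2 * r) ^ d - T ^ d) * c) (k : ℕ) :
    ((latticeBox y T).filter fun a => Reducible K k ε (latticePoint a) C A).card ≤
      ((T + 2 * (k + D + 1)) ^ d - T ^ d) * c * (2 * k + 2) ^ d := by
  set X := (latticeBox y T).filter fun a => Reducible K k ε (latticePoint a) C A with hX
  let q : ℕ := 2 * k + 2
  let f : (Fin d → ℤ) → (Fin d → ℤ) := fun a i => a i % q
  have himage : X.image f ⊆ latticeBox 0 q := by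
    intro b hb
    obtain ⟨a, -, rfl⟩ := Finset.mem_image.1 hb
    rw [mem_latticeBox]
    intro i
    have hq : (0 : ℤ) < q := by positivity
    simpa [f] using ⟨Int.emod_nonneg (a i) hq.ne', Int.emod_lt_of_pos (a i) hq⟩
  refine (Finset.card_le_mul_card_image (f := f) X
    (((T + 2 * (k + D + 1)) ^ d - T ^ d) * c) fun b _ => ?_).trans
    (Nat.mul_le_mul_left _ ((Finset.card_le_card himage).trans (card_latticeBox 0 q).le))
  have h1 := card_separated_reducible_le hK hD hC hA hmin hsub hε0 hε hεT (k := k)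
    (X := X.filter fun a => f a = b) (fun a ha =>
      (Finset.mem_filter.1 (Finset.mem_filter.1 ha).1).1) (by
    intro a ha a' ha' hne
    obtain ⟨i, hi⟩ := Function.ne_iff.1 hne
    have hmod : a i % q = a' i % q := by
      have := (Finset.mem_filter.1 ha).2.trans (Finset.mem_filter.1 ha').2.symm
      exact congrFun this i
    by_contra! hle
    have hlt : dist (latticePoint a) (latticePoint a') < (q : ℝ) := by
      simp only [q]
      push_cast
      linarith
    have hlt' : |(a i : ℝ) - a' i| < (q : ℝ) := by
      refine lt_of_le_of_lt ?_ hlt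
      rw [dist_eq_norm]
      simpa [latticePoint] using PiLp.norm_apply_le (latticePoint a - latticePoint a') i
    have hlt'' : |a' i - a i| < q := by
      rw [abs_sub_comm]
      exact_mod_cast hlt'
    have hdvd : (q : ℤ) ∣ a' i - a i := Int.ModEq.dvd hmod
    have := Int.eq_zero_of_abs_lt_dvd hdvd hlt''
    exact hi (by omega)) (fun a ha =>
      (Finset.mem_filter.1 (Finset.mem_filter.1 ha).1).2)
  have h2 := hc (k + D + 1)
  omega

theorem NearlyCovers.image {d : ℕ} {ε : ℝ} {C : Set (Set (Euc d))} {A : Set (Euc d)}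
    (h : NearlyCovers ε C A) (f : Euc d ≃ᵢ Euc d) :
    NearlyCovers ε ((fun L => f '' L) '' C) (f '' A) := by
  rintro _ ⟨p, hp, rfl⟩
  obtain ⟨L, hL, q, hq, hd⟩ := h p hp
  exact ⟨f '' L, mem_image_of_mem _ hL, f q, mem_image_of_mem _ hq, by rwa [f.dist_eq]⟩

open scoped Classical in
theorem Reducible.image {d : ℕ} {K : Set (Euc d)} {k : ℕ} {ε : ℝ} {x : Euc d}
    {C : Finset (Set (Euc d))} {A : Set (Euc d)} (h : Reducible K k ε x C A)
    (f : Euc d ≃ᵢ Euc d) :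
    Reducible K k ε (f x) (C.image fun L => f '' L) (f '' A) := by
  obtain ⟨S, L, hSC, hL, hcard, hSk, hLk, hcov⟩ := h
  have hinj : Function.Injective fun L : Set (Euc d) => f '' L := f.injective.image_injective
  have hball : ∀ s : Set (Euc d), s ⊆ Metric.closedBall x k →
      f '' s ⊆ Metric.closedBall (f x) k := by
    rintro s hs _ ⟨p, hp, rfl⟩
    simpa [f.dist_eq] using hs hp
  refine ⟨S.image fun L => f '' L, L.image fun L => f '' L, Finset.image_subset_image hSC, ?_, ?_,
    ?_, ?_, ?_⟩
  · intro l hl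
    obtain ⟨l', hl', rfl⟩ := Finset.mem_image.1 hl
    exact (hL l' hl').image f
  · rwa [Finset.card_image_of_injective _ hinj, Finset.card_image_of_injective _ hinj]
  · intro s hs
    obtain ⟨s', hs', rfl⟩ := Finset.mem_image.1 hs
    exact hball s' (hSk s' hs')
  · intro s hs
    obtain ⟨s', hs', rfl⟩ := Finset.mem_image.1 hs
    exact hball s' (hLk s' hs')
  · rw [← Finset.image_sdiff _ _ hinj, ← Finset.image_union, Finset.coe_image]
    exact hcov.image f

theorem exists_mul_shell_le (a r d : ℕ) :
    ∃ T : ℕ, 0 < T ∧ a * ((T + 2 * r) ^ d - T ^ d) ≤ T ^ d := by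
  have hlim : Tendsto (fun T : ℕ => (a : ℝ) * ((1 + (2 * r : ℝ) / T) ^ d - 1)) atTop
      (𝓝 (a * ((1 + 0) ^ d - 1))) :=
    (((tendsto_const_div_atTop_nhds_zero_nat (2 * r : ℝ)).const_add 1).pow d |>.sub_const 1
      ).const_mul _
  have hlt : (a : ℝ) * ((1 + 0) ^ d - 1) < 1 := by simp
  obtain ⟨T, hT, hpos⟩ := ((hlim.eventually_lt_const hlt).and (eventually_gt_atTop 0)).exists
  refine ⟨T, hpos, ?_⟩
  have hT0 : (0 : ℝ) < T := by exact_mod_cast hpos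
  have hle : T ^ d ≤ (T + 2 * r) ^ d := Nat.pow_le_pow_left (by omega) d
  rw [← Nat.cast_le (α := ℝ)]
  push_cast [Nat.cast_sub hle]
  have h1 : ((T : ℝ) + 2 * r) = T * (1 + 2 * r / T) := by field_simp
  rw [h1, mul_pow]
  have h2 : (0 : ℝ) < (T : ℝ) ^ d := by positivity
  nlinarith

theorem exists_notMem_of_card_le {α : Type*} (X : Finset α) (hX : X.Nonempty) (m : ℕ)
    (P : ℕ → α → Prop) [∀ k, DecidablePred (P k)]
    (h : ∀ k < m, 2 ^ (k + 1) * (X.filter (P k)).card ≤ X.card) :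
    ∃ x ∈ X, ∀ k < m, ¬ P k x := by
  classical
  by_contra! hcon
  have h1 : X.card ≤ ∑ k ∈ Finset.range m, (X.filter (P k)).card := by
    refine (Finset.card_le_card ?_).trans Finset.card_biUnion_le
    intro x hx
    obtain ⟨k, hk, hP⟩ := hcon x hx
    exact Finset.mem_biUnion.2 ⟨k, Finset.mem_range.2 hk, Finset.mem_filter.2 ⟨hx, hP⟩⟩
  have h2 : (X.card : ℝ) ≤ ∑ k ∈ Finset.range m, X.card * (1 / 2 : ℝ) ^ (k + 1) := by
    refine (Nat.cast_le.2 h1).trans ?_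
    push_cast
    refine Finset.sum_le_sum fun k hk => ?_
    have h3 : (2 : ℝ) ^ (k + 1) * (X.filter (P k)).card ≤ X.card := by
      exact_mod_cast h k (Finset.mem_range.1 hk)
    rw [one_div, inv_pow, ← div_eq_mul_inv, le_div_iff₀ (by positivity)]
    linarith
  have h4 : ∑ k ∈ Finset.range m, (1 / 2 : ℝ) ^ (k + 1) < 1 := by
    have : ∀ m : ℕ, ∑ k ∈ Finset.range m, (1 / 2 : ℝ) ^ (k + 1) = 1 - (1 / 2) ^ m := by
      intro m
      induction m with
      | zero => simp
      | succ m ih =>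
        rw [Finset.sum_range_succ, ih]
        ring
    rw [this]
    have : (0 : ℝ) < (1 / 2) ^ m := by positivity
    linarith
  rw [← Finset.mul_sum] at h2
  have h5 : (0 : ℝ) < X.card := by exact_mod_cast hX.card_pos
  nlinarith

/-- If few points of each translate of a cube of side `T` lying in a larger cube satisfy `P`, then
few points of the larger cube do. -/
theorem card_filter_latticeBox_mul_le {d T M b : ℕ} (hT : 0 < T) (P : (Fin d → ℤ) → Prop)
    [DecidablePred P]
    (h : ∀ y, latticeBox y T ⊆ latticeBox 0 (T * M) → ((latticeBox y T).filter P).card ≤ b) :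
    ((latticeBox (0 : Fin d → ℤ) (T * M)).filter P).card ≤ b * M ^ d := by
  classical
  let f : (Fin d → ℤ) → (Fin d → ℤ) := fun a i => a i / T
  have hT' : (0 : ℤ) < T := by exact_mod_cast hT
  have himage : ((latticeBox (0 : Fin d → ℤ) (T * M)).filter P).image f ⊆ latticeBox 0 M := by
    intro z hz
    obtain ⟨a, ha, rfl⟩ := Finset.mem_image.1 hz
    have ha' := mem_latticeBox.1 (Finset.mem_filter.1 ha).1
    rw [mem_latticeBox]
    intro i
    have h1 := ha' i
    simp only [Pi.zero_apply, zero_add, Nat.cast_mul] at h1 ⊢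
    exact ⟨Int.ediv_nonneg h1.1 hT'.le, Int.ediv_lt_of_lt_mul hT' (by linarith [h1.2])⟩
  refine (Finset.card_le_mul_card_image (f := f) _ b fun z hz => ?_).trans
    (Nat.mul_le_mul_left _ ((Finset.card_le_card himage).trans (card_latticeBox 0 M).le))
  have hz' := mem_latticeBox.1 (himage hz)
  refine (Finset.card_le_card ?_).trans (h (fun i => T * z i) ?_)
  · intro a ha
    obtain ⟨haP, rfl⟩ := Finset.mem_filter.1 ha
    refine Finset.mem_filter.2 ⟨?_, (Finset.mem_filter.1 haP).2⟩
    rw [mem_latticeBox]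
    intro i
    have h1 := Int.mul_ediv_add_emod (a i) T
    have h2 := Int.emod_nonneg (a i) hT'.ne'
    have h3 := Int.emod_lt_of_pos (a i) hT'
    simp only [f]
    constructor <;> linarith
  · intro a ha
    rw [mem_latticeBox] at ha ⊢
    intro i
    have h1 := ha i
    have h2 := hz' i
    simp only [Pi.zero_apply, zero_add, Nat.cast_mul] at h2 ⊢
    constructor
    · nlinarith
    · nlinarith

open scoped Classical in
/-- There are covers of arbitrarily large balls that are irreducible, with fixed tolerances, near
the origin. -/
theorem exists_irreducible_cover {d : ℕ} {K : Set (Euc d)} (hK : IsCompact K)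
    (hK' : (interior K).Nonempty) {D : ℕ}
    (hD : ∀ L, IsReplica K L → ∀ p ∈ L, ∀ q ∈ L, dist p q ≤ D) :
    ∃ ε : ℕ → ℝ, (∀ k, 0 < ε k) ∧ ∀ m : ℕ, ∃ (C : Finset (Set (Euc d))) (A : Set (Euc d)),
      (∀ L ∈ C, IsReplica K L) ∧ Metric.closedBall 0 m ⊆ A ∧
      NearlyCovers 0 (C : Set (Set (Euc d))) A ∧ ∀ k < m, ¬ Reducible K k (ε k) 0 C A := by
  obtain ⟨c, hc⟩ := exists_coverNumber_enlarge_le hK'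
  choose T hT hTshell using fun k : ℕ =>
    exists_mul_shell_le (2 ^ (k + 1) * c * (2 * k + 2) ^ d) (k + D + 1) d
  choose ε hε hε1 hεT using fun k : ℕ => exists_coverNumber_le_of_nearlyCovers hK hK' (T k)
  refine ⟨ε, hε, fun m => ?_⟩
  let N := ∏ k ∈ Finset.range m, T k
  have hN : 0 < N := Finset.prod_pos fun k _ => hT k
  let A : Set (Euc d) := cube (fun i => (0 : Fin d → ℤ) i - m) (N + 2 * m)
  obtain ⟨C, hC, hcard, hcov⟩ :=
    exists_card_eq_coverNumber hK' (fun i => (0 : Fin d → ℤ) i - m) (N + 2 * m)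
  obtain ⟨x, hx, hgood⟩ := exists_notMem_of_card_le (latticeBox (0 : Fin d → ℤ) N)
    (Finset.card_pos.1 (by rw [card_latticeBox]; positivity)) m
    (fun k a => Reducible K k (ε k) (latticePoint a) C A) (by
      intro k hk
      obtain ⟨M, hM⟩ : T k ∣ N := Finset.dvd_prod_of_mem T (Finset.mem_range.2 hk)
      rw [card_latticeBox, hM]
      have h1 := card_filter_latticeBox_mul_le (d := d) (M := M) (hT k)
        (fun a => Reducible K k (ε k) (latticePoint a) C A) (fun y hy =>
          card_reducible_le hK' hD hC hcov (fun C' h h' => hcard.trans_le (coverNumber_le h h'))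
          (by
            intro p hp
            rw [← hM] at hy
            exact latticeBox_subset 0 N m (hy hp)) (hε k).le (hε1 k) (hεT k y) (hc y (T k)) k)
      refine (Nat.mul_le_mul_left _ h1).trans ?_
      rw [mul_pow, ← mul_assoc]
      refine Nat.mul_le_mul_right _ ((le_of_eq ?_).trans (hTshell k))
      ring)
  let g : Euc d ≃ᵢ Euc d := IsometryEquiv.addRight (-latticePoint x)
  have hg : g (latticePoint x) = 0 := by simp [g]
  refine ⟨C.image fun L => g '' L, g '' A, ?_, ?_, ?_, ?_⟩
  · intro L hL
    obtain ⟨L', hL', rfl⟩ := Finset.mem_image.1 hL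
    exact (hC L' hL').image g
  · intro p hp
    refine ⟨g.symm p, ?_, g.apply_symm_apply p⟩
    refine mem_cube_of_dist_le (q := latticePoint x) (n := m) ?_ le_rfl ?_
    · rw [← g.dist_eq, g.apply_symm_apply, hg]
      exact hp
    · rw [mem_cube]
      intro i
      rw [floor_latticePoint]
      exact mem_latticeBox.1 hx i
  · rw [Finset.coe_image]
    exact hcov.image g
  · intro k hk hred
    have h1 := hred.image g.symm
    rw [← hg, g.symm_apply_apply] at h1
    refine hgood k hk ?_
    convert h1 using 1
    · rw [Finset.image_image]
      ext L
      simp [Function.comp_def, image_image]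
    · simp [image_image]

open scoped Classical in
/-- A reduction of the limit family gives reductions of the approximating families. -/
theorem eventually_reducible_of_limitFamily {d : ℕ} {K : Set (Euc d)} {U : Ultrafilter ℕ} {D : ℕ}
    (hD : ∀ L, IsReplica K L → ∀ p ∈ L, ∀ q ∈ L, dist p q ≤ D)
    {C : ℕ → Finset (Set (Euc d))} (hC : ∀ i, ∀ L ∈ C i, IsReplica K L) {A : ℕ → Set (Euc d)}
    (hA : ∀ i, NearlyCovers 0 (C i : Set (Set (Euc d))) (A i)) {S L : Finset (Set (Euc d))}
    (hS : (S : Set (Set (Euc d))) ⊆ limitFamily U C) (hL : ∀ l ∈ L, IsReplica K l)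
    (hcard : L.card < S.card) {k : ℕ} (hSk : ∀ s ∈ S, s ⊆ Metric.closedBall 0 k)
    (hLk : ∀ l ∈ L, l ⊆ Metric.closedBall 0 k)
    (hcov : ∀ p, ∃ l, (l ∈ limitFamily U C ∧ l ∉ S ∨ l ∈ L) ∧ p ∈ l) {ε : ℝ} (hε : 0 < ε) :
    ∀ᶠ i in (U : Filter ℕ), Reducible K (k + 1 + D) ε 0 (C i) (A i) := by
  obtain ⟨g, hg, hgC⟩ := exists_lift_of_subset_limitFamily hS
  have hball : ∀ᶠ i in (U : Filter ℕ), ∀ s ∈ S,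
      g s i ⊆ Metric.closedBall 0 ((k + 1 + D : ℕ) : ℝ) := by
    refine (eventually_all_finset S).2 fun s hs => ?_
    obtain ⟨p, hp⟩ := (hS hs).1
    have hpk := mem_closedBall_zero_iff.1 (hSk s hs hp)
    rw [← hg s hs] at hp
    obtain ⟨u, hu, hup⟩ := hp
    filter_upwards [hu, hgC, Metric.tendsto_nhds.1 hup 1 one_pos] with i h1 h2 h3 q hq
    rw [mem_closedBall_zero_iff]
    have h4 := hD _ (hC i _ (h2.1 s hs)) q hq (u i) h1
    have h5 := dist_triangle q (u i) 0
    have h6 := dist_triangle (u i) p 0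
    simp only [dist_zero_right] at h5 h6
    push_cast
    linarith
  have hnear : ∀ᶠ i in (U : Filter ℕ), NearlyCovers ε
      ((C i \ (S.image fun s => g s i) ∪ L : Finset (Set (Euc d))) : Set (Set (Euc d))) (A i) := by
    by_contra hcon
    rw [← Ultrafilter.eventually_not] at hcon
    have : ∀ i, ∃ p : Euc d, ¬ NearlyCovers ε
        ((C i \ (S.image fun s => g s i) ∪ L : Finset (Set (Euc d))) : Set (Set (Euc d))) (A i) →
        p ∈ A i ∧ (∀ l ∈ C i, l ∉ (S.image fun s => g s i) → ∀ y ∈ l, ε < dist p y) ∧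
          ∀ l ∈ L, ∀ y ∈ l, ε < dist p y := by
      intro i
      by_cases h : NearlyCovers ε
        ((C i \ (S.image fun s => g s i) ∪ L : Finset (Set (Euc d))) : Set (Set (Euc d))) (A i)
      · exact ⟨0, fun h' => absurd h h'⟩
      · have h' := h
        unfold NearlyCovers at h'
        push Not at h'
        obtain ⟨p, hp, hp'⟩ := h'
        refine ⟨p, fun _ => ⟨hp, fun l hl hl' => hp' l ?_, fun l hl => hp' l ?_⟩⟩
        · exact Finset.mem_coe.2 (Finset.mem_union_left _ (Finset.mem_sdiff.2 ⟨hl, hl'⟩))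
        · exact Finset.mem_coe.2 (Finset.mem_union_right _ hl)
    choose u hu using this
    replace hu := hcon.mono fun i hi => hu i hi
    obtain ⟨p, hp⟩ := exists_tendsto_of_dist_le U u 0 (k + 1 + D : ℕ) (by
      filter_upwards [hu, hball] with i h1 h2
      obtain ⟨l, hl, q, hq, hd⟩ := hA i _ h1.1
      have hpq : u i = q := dist_le_zero.1 hd
      by_cases hlS : l ∈ S.image fun s => g s i
      · obtain ⟨s, hs, rfl⟩ := Finset.mem_image.1 hlS
        exact Metric.mem_closedBall.1 (h2 s hs (hpq ▸ hq))
      · have := h1.2.1 l hl hlS q hq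
        linarith)
    obtain ⟨l, ⟨⟨-, t, htC, rfl⟩, hlS⟩ | hl, hpl⟩ := hcov p
    · obtain ⟨v, hv, hvp⟩ := hpl
      have hne : ∀ᶠ i in (U : Filter ℕ), ∀ s ∈ S, g s i ≠ t i := by
        refine (eventually_all_finset S).2 fun s hs => ?_
        by_contra hcon'
        rw [← Ultrafilter.eventually_not] at hcon'
        have := ultralimit_congr (hcon'.mono fun i hi => not_not.1 hi)
        rw [hg s hs] at this
        exact hlS (this ▸ hs)
      have hdist := hp.dist hvp
      rw [dist_self] at hdist
      obtain ⟨i, h1, h2, h3, h4, h5⟩ :=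
        (hu.and (htC.and (hv.and (hne.and (hdist.eventually_lt_const hε))))).exists
      refine (h1.2.1 (t i) h2 (fun hmem => ?_) (v i) h3).not_gt h5
      obtain ⟨s, hs, heq⟩ := Finset.mem_image.1 hmem
      exact h4 s hs heq
    · obtain ⟨i, h1, h2⟩ := (hu.and (Metric.tendsto_nhds.1 hp ε hε)).exists
      exact (h1.2.2 l hl p hpl).not_gt h2
  filter_upwards [hgC, hball, hnear] with i h1 h2 h3
  refine ⟨S.image fun s => g s i, L, ?_, hL, h1.2.symm ▸ hcard, ?_, ?_, h3⟩
  · intro l hl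
    obtain ⟨s, hs, rfl⟩ := Finset.mem_image.1 hl
    exact h1.1 s hs
  · intro l hl
    obtain ⟨s, hs, rfl⟩ := Finset.mem_image.1 hl
    exact h2 s hs
  · intro l hl
    exact (hLk l hl).trans (Metric.closedBall_subset_closedBall (by push_cast; linarith))

/-- For every body `K` in `Euc d` and every `n ≥ 1` there exists an `n`-reduced covering
of `Euc d` with replicas of `K`. -/
theorem exists_n_reduced_covering (d : ℕ) (K : Set (Euc d)) (hK : IsBody K)
    (n : ℕ) (hn : 1 ≤ n) :
    ∃ C : Set (Set (Euc d)), IsCovering K C ∧ IsNReduced K C n := by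
  obtain ⟨hne, hcomp, -, hcl⟩ := hK
  have hint : (interior K).Nonempty := by
    rw [← closure_nonempty_iff, ← hcl]
    exact hne
  obtain ⟨D, hD⟩ : ∃ D : ℕ, ∀ L, IsReplica K L → ∀ p ∈ L, ∀ q ∈ L, dist p q ≤ D := by
    obtain ⟨D, hD⟩ := exists_nat_ge (Metric.diam K)
    refine ⟨D, ?_⟩
    rintro _ ⟨f, rfl⟩ _ ⟨p, hp, rfl⟩ _ ⟨q, hq, rfl⟩
    rw [f.dist_eq]
    exact (Metric.dist_le_diam_of_mem hcomp.isBounded hp hq).trans hD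
  obtain ⟨ε, hε, h⟩ := exists_irreducible_cover hcomp hint hD
  choose C A hC hA hcov hirr using h
  let U : Ultrafilter ℕ := hyperfilter ℕ
  have hU : (U : Filter ℕ) ≤ atTop := by
    rw [← Nat.cofinite_eq_atTop]
    exact hyperfilter_le_cofinite
  have hrep := limitFamily_isReplica hcomp (U := U) hC
  refine ⟨limitFamily U C, ⟨hrep, ?_⟩, ?_⟩
  · refine eq_univ_of_forall fun p => ?_
    refine exists_mem_limitFamily (ε := fun _ => 0) tendsto_const_nhds ?_
    filter_upwards [hU (eventually_ge_atTop ⌈‖p‖⌉₊)] with m hm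
    exact hcov m p (hA m (mem_closedBall_zero_iff.2 (Nat.ceil_le.1 hm)))
  · rintro ⟨S, L, hS, hSfin, hScard, hL, hSL⟩
    classical
    lift S to Finset (Set (Euc d)) using hSfin
    rw [ncard_coe_finset] at hScard
    let L' : Finset (Set (Euc d)) := Finset.univ.image L
    have hL' : ∀ l ∈ L', IsReplica K l := by
      intro l hl
      obtain ⟨j, -, rfl⟩ := Finset.mem_image.1 hl
      exact hL j
    have hcard : L'.card < S.card := by
      have : L'.card ≤ n - 1 := Finset.card_image_le.trans (by simp)
      omega
    have hbdd : Bornology.IsBounded (⋃ s ∈ S ∪ L', s) := by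
      refine (Bornology.isBounded_biUnion_finset _).2 fun s hs => ?_
      obtain ⟨f, rfl⟩ : IsReplica K s :=
        (Finset.mem_union.1 hs).elim (fun hs => hrep s (hS hs)) (hL' s)
      exact (hcomp.image f.continuous).isBounded
    obtain ⟨R, hR⟩ := hbdd.subset_closedBall 0
    obtain ⟨k, hk⟩ := exists_nat_ge R
    have hball : ∀ s ∈ S ∪ L', s ⊆ Metric.closedBall 0 k := fun s hs =>
      (subset_biUnion_of_mem (u := fun s : Set (Euc d) => s) hs).trans
        (hR.trans (Metric.closedBall_subset_closedBall hk))
    have hev := eventually_reducible_of_limitFamily hD hC hcov hS hL' hcard (k := k)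
      (fun s hs => hball s (Finset.mem_union_left _ hs))
      (fun l hl => hball l (Finset.mem_union_right _ hl)) (fun p => by
        rcases hSL.symm ▸ mem_univ p with ⟨l, ⟨hl, hlS⟩, hpl⟩ | hp
        · exact ⟨l, Or.inl ⟨hl, hlS⟩, hpl⟩
        · obtain ⟨j, hj⟩ := mem_iUnion.1 hp
          exact ⟨L j, Or.inr (Finset.mem_image_of_mem _ (Finset.mem_univ j)), hj⟩)
      (hε (k + 1 + D))
    obtain ⟨m, hm, hmk⟩ := (hev.and (hU (eventually_gt_atTop (k + 1 + D)))).exists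
    exact hirr m _ hmk hm
end
end

section
/- Every finitely generated subgroup of the general linear group GL(n, ℝ) of nonsingular n × n real matrices is residually finite. -/
theorem Int.isJacobsonRing : IsJacobsonRing ℤ := by
  rw [isJacobsonRing_iff_prime_eq]
  intro P hP
  rcases eq_or_ne P ⊥ with rfl | hne
  · refine (Submodule.eq_bot_iff _).2 fun x hx ↦ ?_
    rcases Int.isUnit_iff.1 (Ideal.mem_jacobson_bot.1 hx x) with h | h <;> nlinarith
  · have := hP.isMaximal hne
    exact Ideal.jacobson_eq_self_of_isMaximal

theorem Field.finite_of_finiteType_int (K : Type*) [Field K] [Algebra.FiniteType ℤ K] :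
    Finite K := by
  have := Int.isJacobsonRing
  have : Module.Finite ℤ K := finite_of_finite_type_of_isJacobsonRing ℤ K
  have hinj : ¬ Function.Injective (algebraMap ℤ K) := fun h ↦
    Int.not_isField (isField_of_isIntegral_of_isField h (Field.toIsField K))
  rw [injective_iff_map_eq_zero] at hinj
  push Not at hinj
  obtain ⟨m, hm, hm0⟩ := hinj
  have htors : Module.IsTorsion ℤ K := fun {x} ↦
    ⟨⟨m, mem_nonZeroDivisors_of_ne_zero hm0⟩, by
      rw [Submonoid.mk_smul, Algebra.smul_def, hm, zero_mul]⟩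
  exact Module.finite_of_fg_torsion K htors

/-- A nonzero element of a domain finitely generated over `ℤ` has nonzero image in some finite
residue field. -/
theorem exists_isMaximal_notMem_finite_quotient {A : Type*} [CommRing A] [IsDomain A]
    [Algebra.FiniteType ℤ A] {a : A} (ha : a ≠ 0) :
    ∃ m : Ideal A, m.IsMaximal ∧ a ∉ m ∧ Finite (A ⧸ m) := by
  have := Int.isJacobsonRing
  have : IsJacobsonRing A := isJacobsonRing_of_finiteType (A := ℤ)
  have hbot : (⊥ : Ideal A).jacobson = ⊥ := IsJacobsonRing.out ‹_› Ideal.isPrime_bot.isRadical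
  have hmem : a ∉ (⊥ : Ideal A).jacobson := by simpa [hbot] using ha
  rw [Ideal.jacobson, Ideal.mem_sInf] at hmem
  push Not at hmem
  obtain ⟨m, ⟨-, hm⟩, ham⟩ := hmem
  have : Algebra.FiniteType ℤ (A ⧸ m) :=
    .of_surjective (Ideal.Quotient.mkₐ ℤ m) Ideal.Quotient.mk_surjective
  exact ⟨m, hm, ham, @Field.finite_of_finiteType_int (A ⧸ m) (Ideal.Quotient.field m) this⟩

/-- The entries of a finitely generated group of matrices lie in a common finitely generated
ring. -/
theorem exists_subalgebra_finiteType_of_group_fg {G ι R : Type*} [Group G] [Group.FG G]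
    [Fintype ι] [DecidableEq ι] [CommRing R] (ρ : G →* Matrix ι ι R) :
    ∃ A : Subalgebra ℤ R, Algebra.FiniteType ℤ A ∧ ∀ g i j, ρ g i j ∈ A := by
  obtain ⟨S, hS, hfin⟩ := Group.fg_iff.1 ‹Group.FG G›
  let T : Set R := (fun p : G × ι × ι ↦ ρ p.1 p.2.1 p.2.2) '' ((S ∪ S⁻¹) ×ˢ Set.univ)
  have hT : T.Finite := ((hfin.union hfin.inv).prod Set.finite_univ).image _
  refine ⟨Algebra.adjoin ℤ T, .adjoin_of_finite hT, fun g ↦ ?_⟩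
  have hgen (s : G) (hs : s ∈ S ∪ S⁻¹) (i j : ι) : ρ s i j ∈ Algebra.adjoin ℤ T :=
    Algebra.subset_adjoin ⟨(s, i, j), ⟨hs, trivial⟩, rfl⟩
  have hg : g ∈ Submonoid.closure (S ∪ S⁻¹) := by
    rw [← Subgroup.closure_toSubmonoid, hS]
    trivial
  induction hg using Submonoid.closure_induction with
  | mem s hs => exact hgen s hs
  | one =>
    intro i j
    rw [map_one, Matrix.one_apply]
    split_ifs
    exacts [one_mem _, zero_mem _]
  | mul x y _ _ hx hy =>
    intro i j
    rw [map_mul, Matrix.mul_apply]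
    exact sum_mem fun k _ ↦ mul_mem (hx i k) (hy k j)

/-- Malcev's theorem: a finitely generated group with a faithful representation by matrices over
a domain is residually finite. -/
theorem Matrix.residuallyFinite_of_injective {G ι R : Type*} [Group G] [Group.FG G]
    [Fintype ι] [DecidableEq ι] [CommRing R] [IsDomain R] (ρ : G →* Matrix ι ι R)
    (hρ : Function.Injective ρ) : Group.ResiduallyFinite G := by
  obtain ⟨A, hA, hmem⟩ := exists_subalgebra_finiteType_of_group_fg ρ
  let σ : G →* Matrix ι ι A :=
    { toFun g := .of fun i j ↦ ⟨ρ g i j, hmem g i j⟩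
      map_one' := by
        ext i j
        simp [Matrix.one_apply, apply_ite]
      map_mul' x y := by
        ext i j
        simp [Matrix.mul_apply] }
  rw [Group.residuallyFinite_iff_exists_finiteIndex]
  intro g hg
  have hσ : σ g ≠ 1 := fun h ↦ hg <| hρ <| by
    ext i j
    simpa [σ, Matrix.one_apply, apply_ite] using congrArg (fun M ↦ (M i j : R)) h
  obtain ⟨i, j, hij⟩ : ∃ i j, σ g i j ≠ (1 : Matrix ι ι A) i j := by
    by_contra! h
    exact hσ (Matrix.ext h)
  obtain ⟨m, -, ham, _⟩ := exists_isMaximal_notMem_finite_quotient (sub_ne_zero.2 hij)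
  let τ : G →* (Matrix ι ι (A ⧸ m))ˣ :=
    ((Ideal.Quotient.mk m).mapMatrix.toMonoidHom.comp σ).toHomUnits
  have : Finite (Matrix ι ι (A ⧸ m)) := inferInstanceAs (Finite (ι → ι → A ⧸ m))
  refine ⟨τ.ker, Subgroup.finiteIndex_ker τ, fun h ↦ ham ?_⟩
  have h1 : (Ideal.Quotient.mk m).mapMatrix (σ g) = (Ideal.Quotient.mk m).mapMatrix 1 := by
    rw [map_one]
    exact congrArg Units.val (MonoidHom.mem_ker.1 h)
  exact Ideal.Quotient.eq.1 (congrFun (congrFun h1 i) j)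

/-- Every finitely generated subgroup `G` of the general linear group `GL(n, ℝ)` is
residually finite: every non-identity element of `G` avoids some normal subgroup of `G`
of finite index. -/
theorem fg_subgroup_of_GL_residually_finite (n : ℕ)
    (G : Subgroup (Matrix.GeneralLinearGroup (Fin n) ℝ)) (hfg : Group.FG G) :
    ∀ g : G, g ≠ 1 → ∃ N : Subgroup G, N.Normal ∧ N.FiniteIndex ∧ g ∉ N := by
  intro g hg
  have : Group.ResiduallyFinite G :=
    Matrix.residuallyFinite_of_injective ((Units.coeHom _).comp G.subtype)
      (Units.val_injective.comp G.subtype_injective)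
  obtain ⟨N, hN⟩ := Group.exists_finiteIndexNormalSubgroup_notMem g hg
  exact ⟨N.toSubgroup, N.isNormal', N.isFiniteIndex', hN⟩
end

section
/- Let K be a convex body in E^d and let m = N_c(K) be its Newton covering number. Then there exists D > 0 such that every covering of E^d with replicas of K whose lower density exceeds D fails to be (m+1)-reduced. Consequently l(K) ≤ N_c(K) + 1, i.e., Θ_n(K) < ∞ for all n ≥ N_c(K) + 1. -/
open Set MeasureTheory

noncomputable section

/-- The lower density of a family of sets: the `liminf`, as `r → ∞`, of the total
volume inside the ball `B(0,r)` divided by the volume of `B(0,r)`. -/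
def lowerDensity {d : ℕ} (A : Set (Set (Euc d))) : ENNReal :=
  Filter.liminf (fun r : ℝ =>
      (∑' L : A, volume ((L : Set (Euc d)) ∩ Metric.ball 0 r)) /
        volume (Metric.ball (0 : Euc d) r)) Filter.atTop

open Metric in
/-- If the `ε`-neighbourhood of `K` is covered by fewer than `n` replicas of `K`, then fewer than `n`
members of an `n`-reduced covering lie in the `ε`-neighbourhood of a given replica of `K`. -/
lemma IsNReduced.card_lt_of_subset_thickening {d m n : ℕ} {K : Set (Euc d)}
    {C : Set (Set (Euc d))} (hn : m + 1 ≤ n) {ε : ℝ} {L : Fin m → Set (Euc d)}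
    (hL : ∀ j, IsReplica K (L j)) (hKL : thickening ε K ⊆ ⋃ j, L j)
    (hC : IsCovering K C) (hred : IsNReduced K C n) (f : Euc d ≃ᵢ Euc d)
    (S : Finset (Set (Euc d))) (hSC : ∀ A ∈ S, A ∈ C)
    (hS : ∀ A ∈ S, A ⊆ thickening ε (f '' K)) : S.card < n := by
  by_contra! hcard
  obtain ⟨S', hS'S, hS'card⟩ := Finset.exists_subset_card_eq hcard
  refine hred ⟨S', fun j => f '' (if h : (j : ℕ) < m then L ⟨j, h⟩ else K),
    fun A hA => hSC A (hS'S hA), S'.finite_toSet, by simp [hS'card], fun j => ?_, ?_⟩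
  · have h : IsReplica K (if h : (j : ℕ) < m then L ⟨j, h⟩ else K) := by
      split_ifs with h
      · exact hL _
      · exact ⟨IsometryEquiv.refl _, image_id _⟩
    obtain ⟨g, hg⟩ := h
    exact ⟨g.trans f, by beta_reduce; rw [← hg, ← image_comp]; rfl⟩
  · refine eq_univ_of_forall fun x => ?_
    obtain ⟨A, hAC, hxA⟩ := mem_sUnion.1 (hC.2 ▸ mem_univ x)
    by_cases hA : A ∈ S'
    · right
      obtain ⟨y, hy, hxy⟩ := mem_thickening_iff.1 (hS A (hS'S hA) hxA)
      obtain ⟨k, hk, rfl⟩ := hy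
      have hx : f.symm x ∈ thickening ε K := by
        refine mem_thickening_iff.2 ⟨k, hk, ?_⟩
        rwa [← f.dist_eq, f.apply_symm_apply]
      obtain ⟨j, hj⟩ := mem_iUnion.1 (hKL hx)
      refine mem_iUnion.2 ⟨⟨j, by omega⟩, f.symm x, ?_, f.apply_symm_apply x⟩
      simpa using hj
    · exact Or.inl ⟨A, ⟨hAC, hA⟩, hxA⟩

open Metric Classical in
/-- The members of an `n`-reduced covering overlap at any point a uniformly bounded number of
times. -/
lemma exists_card_le_of_isNReduced {d m n : ℕ} {K : Set (Euc d)} (hK : IsCompact K)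
    (hn : m + 1 ≤ n) {L : Fin m → Set (Euc d)} (hL : ∀ j, IsReplica K (L j))
    (hKL : K ⊆ interior (⋃ j, L j)) :
    ∃ M : ℕ, ∀ C : Set (Set (Euc d)), IsCovering K C → IsNReduced K C n →
      ∀ (z : Euc d) (F : Finset (Set (Euc d))), (∀ A ∈ F, A ∈ C ∧ z ∈ A) → F.card ≤ M := by
  obtain ⟨ε, hε, hεK⟩ := hK.exists_thickening_subset_open isOpen_interior hKL
  obtain ⟨T, -, hT, hcov⟩ :=
    finite_cover_balls_of_compact (isCompact_closedBall (0 : Euc d) (diam K)) (half_pos hε)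
  lift T to Finset (Euc d) using hT
  refine ⟨T.powerset.card * (n - 1), fun C hC hred z F hF => ?_⟩
  by_contra! hlt
  let code : Set (Euc d) → Finset (Euc d) :=
    fun A => T.filter fun t => ∃ y ∈ A, dist (y - z) t < ε / 2
  obtain ⟨c, -, hc⟩ := Finset.exists_lt_card_fiber_of_mul_lt_card_of_maps_to
    (f := code) (t := T.powerset)
    (fun A _ => Finset.mem_powerset.2 (Finset.filter_subset _ _)) hlt
  obtain ⟨A₀, hA₀⟩ := Finset.card_pos.1 (Nat.zero_lt_of_lt hc)
  obtain ⟨hA₀F, hA₀c⟩ := Finset.mem_filter.1 hA₀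
  obtain ⟨f, hf⟩ := hC.1 A₀ (hF A₀ hA₀F).1
  have key := hred.card_lt_of_subset_thickening hn hL (hεK.trans interior_subset) hC f
    (F.filter fun A => code A = c) (fun A hA => (hF A (Finset.mem_filter.1 hA).1).1) ?_
  · omega
  intro A hA x hx
  obtain ⟨hAF, hAc⟩ := Finset.mem_filter.1 hA
  obtain ⟨hAC, hzA⟩ := hF A hAF
  obtain ⟨g, hg⟩ := hC.1 A hAC
  have hxz : x - z ∈ closedBall (0 : Euc d) (diam K) := by
    rw [mem_closedBall_zero_iff, ← dist_eq_norm, ← g.diam_image K, hg]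
    exact dist_le_diam_of_mem (hg ▸ (hK.image g.continuous).isBounded) hx hzA
  obtain ⟨t, ht, hxt⟩ := mem_iUnion₂.1 (hcov hxz)
  have htc : t ∈ code A := Finset.mem_filter.2 ⟨ht, x, hx, hxt⟩
  rw [hAc, ← hA₀c] at htc
  obtain ⟨-, y, hy, hyt⟩ := Finset.mem_filter.1 htc
  refine mem_thickening_iff.2 ⟨y, hf ▸ hy, ?_⟩
  have h := dist_triangle_right (x - z) (y - z) t
  rw [dist_sub_right] at h
  linarith [mem_ball.1 hxt]

open Classical in
/-- A family of measurable sets that overlaps at most `M` times has lower density at most `M`. -/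
lemma lowerDensity_le_of_card_le {d : ℕ} {C : Set (Set (Euc d))} {M : ℕ}
    (hmeas : ∀ A ∈ C, MeasurableSet A)
    (hM : ∀ (z : Euc d) (F : Finset (Set (Euc d))), (∀ A ∈ F, A ∈ C ∧ z ∈ A) → F.card ≤ M) :
    lowerDensity C ≤ M := by
  have hsum (B : Set (Euc d)) : ∑' A : C, volume ((A : Set (Euc d)) ∩ B) ≤ M * volume B := by
    refine ENNReal.summable.tsum_le_of_sum_le fun F => ?_
    calc ∑ A ∈ F, volume ((A : Set (Euc d)) ∩ B)
        = ∑ A ∈ F, ∫⁻ z in B, (A : Set (Euc d)).indicator 1 z := by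
          refine Finset.sum_congr rfl fun A _ => ?_
          rw [lintegral_indicator_one (hmeas A A.2), Measure.restrict_apply (hmeas A A.2)]
      _ = ∫⁻ z in B, ∑ A ∈ F, (A : Set (Euc d)).indicator 1 z :=
          (lintegral_finsetSum _ fun (A : C) _ => measurable_one.indicator (hmeas A A.2)).symm
      _ ≤ ∫⁻ _ in B, (M : ENNReal) := by
          refine lintegral_mono fun z => ?_
          have hcard := hM z ((F.filter fun A : C => z ∈ A.1).map
            (Function.Embedding.subtype _)) (by simp +contextual)
          rw [Finset.card_map] at hcard
          simpa [indicator_apply, Finset.sum_ite] using hcard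
      _ = M * volume B := setLIntegral_const _ _
  calc lowerDensity C ≤ Filter.liminf (fun _ : ℝ => (M : ENNReal)) Filter.atTop :=
        Filter.liminf_le_liminf (.of_forall fun r => ENNReal.div_le_of_le_mul (hsum _))
    _ = M := Filter.liminf_const _

/-- Let `K` be a convex body in `Euc d` and `m = N_c(K)` its Newton covering number
(the least number of replicas of `K` whose union contains a neighborhood of `K`).
Then there is a bound `D > 0` such that every covering with replicas of `K` of lower
density exceeding `D` fails to be `(m+1)`-reduced; consequently, for every `n ≥ m + 1`
the densities of `n`-reduced coverings with replicas of `K` are bounded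
(`l(K) ≤ N_c(K) + 1`, i.e. `Θ_n(K) < ∞` for `n ≥ N_c(K) + 1`). -/
theorem newton_covering_number_bounds_reduced_density (d m : ℕ) (K : Set (Euc d))
    (hKcpt : IsCompact K) (hKconv : Convex ℝ K) (hKint : (interior K).Nonempty)
    (hm : IsLeast {k : ℕ | ∃ L : Fin k → Set (Euc d),
        (∀ j, IsReplica K (L j)) ∧ K ⊆ interior (⋃ j, L j)} m) :
    (∃ D : ℝ, 0 < D ∧ ∀ C : Set (Set (Euc d)), IsCovering K C →
        ENNReal.ofReal D < lowerDensity C → ¬ IsNReduced K C (m + 1)) ∧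
    (∀ n : ℕ, m + 1 ≤ n → ∃ D : ℝ, 0 < D ∧ ∀ C : Set (Set (Euc d)),
        IsCovering K C → IsNReduced K C n → lowerDensity C ≤ ENNReal.ofReal D) := by
  obtain ⟨L, hL, hKL⟩ := hm.1
  have bound (n : ℕ) (hn : m + 1 ≤ n) : ∃ D : ℝ, 0 < D ∧ ∀ C : Set (Set (Euc d)),
      IsCovering K C → IsNReduced K C n → lowerDensity C ≤ ENNReal.ofReal D := by
    obtain ⟨M, hM⟩ := exists_card_le_of_isNReduced hKcpt hn hL hKL
    refine ⟨M + 1, by positivity, fun C hC hred => ?_⟩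
    have hmeas : ∀ A ∈ C, MeasurableSet A := by
      intro A hA
      obtain ⟨f, rfl⟩ := hC.1 A hA
      exact (hKcpt.image f.continuous).measurableSet
    calc lowerDensity C ≤ M := lowerDensity_le_of_card_le hmeas (hM C hC hred)
      _ = ENNReal.ofReal M := (ENNReal.ofReal_natCast M).symm
      _ ≤ ENNReal.ofReal (M + 1) := ENNReal.ofReal_le_ofReal (by linarith)
  obtain ⟨D, hD, hDC⟩ := bound (m + 1) le_rfl
  exact ⟨⟨D, hD, fun C hC hlt hred => (hDC C hC hred).not_gt hlt⟩, bound⟩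
end
end

section
/- For every d ≥ 2 there exists D > 0 such that every covering of E^d with closed unit balls whose lower density exceeds D fails to be (d+1)-reduced. In other words, l(B^d) ≤ d + 1. -/
open Set MeasureTheory

noncomputable section

/-- A covering of `Euc d` with closed unit balls. -/
def IsUnitBallCovering {d : ℕ} (C : Set (Set (Euc d))) : Prop :=
  (∀ L ∈ C, ∃ x : Euc d, L = Metric.closedBall x 1) ∧ ⋃₀ C = univ

/-- A covering with unit balls is `n`-reduced if one cannot delete `n` members and
replace them by `n - 1` closed unit balls so that the result is still a covering. -/
def IsNReducedBalls {d : ℕ} (C : Set (Set (Euc d))) (n : ℕ) : Prop :=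
  ¬ ∃ (S : Set (Set (Euc d))) (c : Fin (n - 1) → Euc d),
      S ⊆ C ∧ S.Finite ∧ S.ncard = n ∧
      (⋃₀ (C \ S)) ∪ (⋃ j, Metric.closedBall (c j) 1) = univ

/-- Every unit vector is the normalized sum of some orthonormal basis. -/
theorem exists_orthonormalBasis_sum_eq {d : ℕ} (a : Euc d) (ha : ‖a‖ = 1) :
    ∃ w : OrthonormalBasis (Fin d) ℝ (Euc d), ∑ j, w j = √d • a := by
  set b := EuclideanSpace.basisFun (Fin d) ℝ
  have hb : ‖∑ j, b j‖ = ‖√(d : ℝ) • a‖ := by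
    have h : ‖∑ j, b j‖ ^ 2 = d := by
      rw [← b.sum_sq_norm_inner_right]
      simp [inner_sum, b.inner_eq_ite]
    rw [norm_smul, ha, mul_one, Real.norm_of_nonneg (Real.sqrt_nonneg _), ← h,
      Real.sqrt_sq (norm_nonneg _)]
  refine ⟨b.map (ℝ ∙ (∑ j, b j - √(d : ℝ) • a))ᗮ.reflection, ?_⟩
  simp only [OrthonormalBasis.map_apply, ← map_sum]
  exact Submodule.reflection_sub hb

/-- If the coordinates of a vector of norm at least one have sum at least `-1/2`, then one of
them is bounded below by `1 / (4d)`. -/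
theorem exists_le_inner_of_sum {d : ℕ} (hd : 0 < d) (w : OrthonormalBasis (Fin d) ℝ (Euc d))
    (y : Euc d) (hy : 1 < ‖y‖) (hsum : -(1 / 2) ≤ ∑ j, inner ℝ (w j) y) :
    ∃ j, 1 / (4 * d : ℝ) ≤ inner ℝ (w j) y := by
  by_contra! h
  have hd' : (0 : ℝ) < d := by exact_mod_cast hd
  have hnorm : ‖y‖ ≤ ∑ j, |inner ℝ (w j) y| := by
    conv_lhs => rw [← w.sum_repr' y]
    refine (norm_sum_le _ _).trans (Finset.sum_le_sum fun j _ => ?_)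
    simp [norm_smul]
  have habs : ∑ j, |inner ℝ (w j) y| ≤ ∑ j, (2 * (1 / (4 * d : ℝ)) - inner ℝ (w j) y) := by
    refine Finset.sum_le_sum fun j _ => ?_
    have hc : 0 < 1 / (4 * d : ℝ) := by positivity
    rw [abs_le]
    constructor <;> linarith [h j]
  rw [Finset.sum_sub_distrib, Finset.sum_const, Finset.card_univ, Fintype.card_fin,
    nsmul_eq_mul] at habs
  have : (d : ℝ) * (2 * (1 / (4 * d : ℝ))) = 1 / 2 := by field_simp; norm_num
  linarith

/-- A unit ball whose centre `p` lies close to `p₀`, roughly in direction `a`, is covered by the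
unit ball around `p₀` together with `d` unit balls depending only on `p₀` and `a`. -/
theorem exists_closedBall_subset_union {d : ℕ} (hd : 0 < d) (p₀ a : Euc d) (ha : ‖a‖ = 1) :
    ∃ q : Fin d → Euc d, ∀ p : Euc d, p ≠ p₀ → ‖p - p₀‖ ≤ 1 / (48 * d ^ 2 : ℝ) →
      ‖‖p - p₀‖⁻¹ • (p - p₀) - a‖ ≤ 1 / (4 * d : ℝ) →
      Metric.closedBall p 1 ⊆ Metric.closedBall p₀ 1 ∪ ⋃ j, Metric.closedBall (q j) 1 := by
  obtain ⟨w, hw⟩ := exists_orthonormalBasis_sum_eq a ha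
  have hd' : (1 : ℝ) ≤ d := by exact_mod_cast hd
  refine ⟨fun j => p₀ + (1 / (4 * d : ℝ)) • w j, fun p hp ht hu x hx => ?_⟩
  by_cases hx0 : x ∈ Metric.closedBall p₀ 1
  · exact Or.inl hx0
  refine Or.inr (mem_iUnion.2 ?_)
  simp only [mem_closedBall_iff_norm, not_le] at hx hx0 ⊢
  set y := x - p₀ with hy
  set t := ‖p - p₀‖ with ht_def
  have ht0 : 0 < t := norm_pos_iff.2 (sub_ne_zero.2 hp)
  set u := t⁻¹ • (p - p₀) with hu_def
  have hpu : p - p₀ = t • u := by rw [hu_def, smul_inv_smul₀ ht0.ne']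
  have hu1 : ‖u‖ = 1 := by
    rw [hu_def, norm_smul, ← ht_def, norm_inv, Real.norm_of_nonneg ht0.le,
      inv_mul_cancel₀ ht0.ne']
  have hxp : x - p = y - t • u := by rw [← hpu, hy]; abel
  have ht1 : t ≤ 1 := ht.trans (by rw [div_le_one (by positivity)]; nlinarith)
  have hyt : ‖y‖ ≤ 1 + t := by
    have h1 : y = (x - p) + (p - p₀) := by rw [hy]; abel
    rw [h1]
    exact (norm_add_le _ _).trans (by linarith)
  have hyu : 0 ≤ inner ℝ y u := by
    have h1 : ‖y - t • u‖ ^ 2 ≤ 1 := by rw [← hxp]; exact pow_le_one₀ (norm_nonneg _) hx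
    rw [norm_sub_sq_real, inner_smul_right, norm_smul, hu1, Real.norm_of_nonneg ht0.le] at h1
    have h2 : 1 < ‖y‖ ^ 2 := one_lt_pow₀ hx0 two_ne_zero
    by_contra! h3
    nlinarith [mul_pos ht0 (neg_pos.2 h3), sq_nonneg t]
  have hya : -(2 * (1 / (4 * d : ℝ))) ≤ inner ℝ y a := by
    have h1 : inner ℝ y (u - a) ≤ 2 * (1 / (4 * d : ℝ)) :=
      (real_inner_le_norm _ _).trans
        (mul_le_mul (by linarith) hu (norm_nonneg _) (by norm_num))
    rw [inner_sub_right] at h1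
    linarith
  have hsum : -(1 / 2) ≤ ∑ j, inner ℝ (w j) y := by
    rw [← sum_inner, hw, real_inner_smul_left, real_inner_comm]
    have hs : √(d : ℝ) ≤ d := Real.sqrt_le_iff.2 ⟨by positivity, by nlinarith⟩
    have h1 : √(d : ℝ) * (2 * (1 / (4 * d : ℝ))) ≤ 1 / 2 := by
      calc √(d : ℝ) * (2 * (1 / (4 * d : ℝ))) ≤ d * (2 * (1 / (4 * d : ℝ))) := by gcongr
        _ = 1 / 2 := by field_simp; norm_num
    have h2 := mul_le_mul_of_nonneg_left hya (Real.sqrt_nonneg (d : ℝ))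
    linarith
  obtain ⟨j, hj⟩ := exists_le_inner_of_sum hd w y hx0 hsum
  refine ⟨j, ?_⟩
  have hq : x - (p₀ + (1 / (4 * d : ℝ)) • w j) = y - (1 / (4 * d : ℝ)) • w j := by
    rw [hy]; abel
  rw [hq, ← sq_le_one_iff₀ (norm_nonneg _), norm_sub_sq_real, inner_smul_right, norm_smul,
    w.orthonormal.1 j, real_inner_comm]
  set c := 1 / (4 * d : ℝ) with hc
  have hc0 : 0 < c := by positivity
  have hct : 1 / (48 * d ^ 2 : ℝ) = c ^ 2 / 3 := by rw [hc]; field_simp; norm_num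
  rw [hct] at ht
  rw [Real.norm_of_nonneg hc0.le]
  have h1 : ‖y‖ ^ 2 ≤ (1 + t) ^ 2 := by gcongr
  nlinarith [mul_le_mul_of_nonneg_left hj hc0.le]

/-- Pigeonhole principle on a compact set: sufficiently many points, counted with multiplicity,
accumulate near one of its points. -/
theorem IsCompact.exists_lt_card_filter_dist_le {X : Type*} [PseudoMetricSpace X] {K : Set X}
    (hK : IsCompact K) {e : ℝ} (he : 0 < e) (m : ℕ) :
    ∃ N : ℕ, ∀ {ι : Type} (s : Finset ι) (f : ι → X), (∀ i ∈ s, f i ∈ K) → N < s.card →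
      ∃ a ∈ K, ∃ s' ⊆ s, s'.card = m ∧ ∀ i ∈ s', dist (f i) a ≤ e := by
  classical
  obtain ⟨t, htK, htf, ht⟩ := hK.finite_cover_balls he
  refine ⟨htf.toFinset.card * m, fun {ι} s f hf hs => ?_⟩
  have hnear : ∀ i, ∃ x, i ∈ s → x ∈ t ∧ dist (f i) x < e := by
    intro i
    by_cases hi : i ∈ s
    · obtain ⟨x, hx, hxe⟩ := mem_iUnion₂.1 (ht (hf i hi))
      exact ⟨x, fun _ => ⟨hx, hxe⟩⟩
    · exact ⟨f i, fun h => absurd h hi⟩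
  choose g hg using hnear
  obtain ⟨a, ha, hcard⟩ := Finset.exists_lt_card_fiber_of_mul_lt_card_of_maps_to
    (fun i hi => htf.mem_toFinset.2 (hg i hi).1) hs
  obtain ⟨s', hs', hs'm⟩ := Finset.exists_subset_card_eq hcard.le
  refine ⟨a, htK (htf.mem_toFinset.1 ha), s', hs'.trans (Finset.filter_subset _ _), hs'm,
    fun i hi => ?_⟩
  obtain ⟨his, hia⟩ := Finset.mem_filter.1 (hs' hi)
  exact hia ▸ (hg i his).2.le

/-- If the lower density of a family of measurable sets exceeds `M`, then some point lies in more
than `M` members of the family. -/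
theorem exists_lt_card_of_lt_lowerDensity {d : ℕ} {A : Set (Set (Euc d))}
    (hA : ∀ L ∈ A, MeasurableSet L) {M : ℕ} (hM : (M : ENNReal) < lowerDensity A) :
    ∃ (x : Euc d) (s : Finset A), M < s.card ∧ ∀ L ∈ s, x ∈ (L : Set (Euc d)) := by
  classical
  by_contra! h
  refine hM.not_ge ?_
  have hle : ∀ r : ℝ, (∑' L : A, volume ((L : Set (Euc d)) ∩ Metric.ball 0 r)) /
      volume (Metric.ball (0 : Euc d) r) ≤ M := by
    intro r
    refine ENNReal.div_le_of_le_mul ?_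
    rw [ENNReal.tsum_eq_iSup_sum]
    refine iSup_le fun s => ?_
    calc ∑ L ∈ s, volume ((L : Set (Euc d)) ∩ Metric.ball 0 r)
        = ∑ L ∈ s, ∫⁻ x in Metric.ball 0 r, (L : Set (Euc d)).indicator 1 x := by
          refine Finset.sum_congr rfl fun L _ => ?_
          rw [lintegral_indicator_one (hA L L.2), Measure.restrict_apply (hA L L.2)]
      _ = ∫⁻ x in Metric.ball 0 r, ∑ L ∈ s, (L : Set (Euc d)).indicator 1 x :=
          (lintegral_finsetSum s fun (L : A) _ => measurable_one.indicator (hA L L.2)).symm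
      _ ≤ ∫⁻ _ in Metric.ball (0 : Euc d) r, M := by
          refine lintegral_mono fun x => ?_
          have hcard : (s.filter fun L : A => x ∈ (L : Set (Euc d))).card ≤ M := by
            by_contra! hlt
            obtain ⟨L, hL, hxL⟩ := h x _ hlt
            exact hxL (Finset.mem_filter.1 hL).2
          simp only [Set.indicator_apply, Pi.one_apply, Finset.sum_boole]
          exact_mod_cast hcard
      _ = M * volume (Metric.ball 0 r) := setLIntegral_const _ _
  exact (Filter.liminf_le_liminf (Filter.Eventually.of_forall hle)).trans
    (Filter.liminf_const _).le

/-- For every `d ≥ 2` there is a bound `D > 0` such that every covering of `Euc d` with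
closed unit balls of lower density exceeding `D` fails to be `(d+1)`-reduced;
in other words, `l(B^d) ≤ d + 1`. -/
theorem dense_ball_covering_not_d_add_one_reduced (d : ℕ) (hd : 2 ≤ d) :
    ∃ D : ℝ, 0 < D ∧ ∀ C : Set (Set (Euc d)), IsUnitBallCovering C →
      ENNReal.ofReal D < lowerDensity C → ¬ IsNReducedBalls C (d + 1) := by
  classical
  have hd' : (0 : ℝ) < d := by exact_mod_cast (by omega : 0 < d)
  obtain ⟨N, hN⟩ := (isCompact_sphere (0 : Euc d) 1).exists_lt_card_filter_dist_le
    (by positivity : 0 < 1 / (4 * d : ℝ)) (d + 1)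
  obtain ⟨M, hM⟩ := (isCompact_closedBall (0 : Euc d) 1).exists_lt_card_filter_dist_le
    (by positivity : 0 < 1 / (96 * d ^ 2 : ℝ)) (N + 2)
  refine ⟨(M + 1 : ℕ), by positivity, fun C hC hdens hred => hred ?_⟩
  rw [ENNReal.ofReal_natCast] at hdens
  choose center hcenter using fun L : C => hC.1 L L.2
  have hinj : Function.Injective center := fun L L' h =>
    Subtype.ext (by rw [hcenter L, hcenter L', h])
  obtain ⟨x, s, hs, hxs⟩ := exists_lt_card_of_lt_lowerDensity
    (fun L hL => by obtain ⟨y, rfl⟩ := hC.1 L hL; exact measurableSet_closedBall) hdens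
  obtain ⟨b, -, s₁, -, hs₁card, hs₁⟩ := hM s (fun L => center L - x)
    (fun L hL => by
      have := hxs L hL
      rw [hcenter L, mem_closedBall_iff_norm'] at this
      simpa using this) (by omega)
  have hclose : ∀ L ∈ s₁, ∀ L' ∈ s₁, ‖center L - center L'‖ ≤ 1 / (48 * d ^ 2 : ℝ) := by
    intro L hL L' hL'
    have h := (dist_triangle_right _ _ b).trans (add_le_add (hs₁ L hL) (hs₁ L' hL'))
    rw [dist_eq_norm, sub_sub_sub_cancel_right] at h
    refine h.trans (le_of_eq ?_)
    field_simp
    norm_num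
  obtain ⟨L₀, hL₀⟩ : s₁.Nonempty := Finset.card_pos.1 (by omega)
  have hne : ∀ L ∈ s₁.erase L₀, center L ≠ center L₀ := fun L hL =>
    hinj.ne (Finset.ne_of_mem_erase hL)
  obtain ⟨a, ha, s₂, hs₂, hs₂card, hs₂a⟩ := hN (s₁.erase L₀)
    (fun L => ‖center L - center L₀‖⁻¹ • (center L - center L₀))
    (fun L hL => by
      rw [mem_sphere_zero_iff_norm, norm_smul, norm_inv, norm_norm,
        inv_mul_cancel₀ (norm_ne_zero_iff.2 (sub_ne_zero.2 (hne L hL)))])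
    (by rw [Finset.card_erase_of_mem hL₀]; omega)
  obtain ⟨q, hq⟩ := exists_closedBall_subset_union (by omega) (center L₀) a
    (mem_sphere_zero_iff_norm.1 ha)
  refine ⟨(↑) '' (s₂ : Set C), q, by simp, s₂.finite_toSet.image _, ?_, ?_⟩
  · rw [ncard_image_of_injective _ Subtype.val_injective, ncard_coe_finset, hs₂card]
  · refine eq_univ_of_forall fun y => ?_
    obtain ⟨L, hL, hyL⟩ := mem_sUnion.1 (hC.2.symm ▸ mem_univ y : y ∈ ⋃₀ C)
    have hnot : ∀ L' : C, L' ∉ s₂ → (L' : Set (Euc d)) ∈ C \ ((↑) '' (s₂ : Set C)) :=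
      fun L' h => ⟨L'.2, by simpa using h⟩
    by_cases hLs : (⟨L, hL⟩ : C) ∈ s₂
    · have hmem := hs₂ hLs
      have hcov := hq _ (hne _ hmem) (hclose _ (Finset.mem_of_mem_erase hmem) _ hL₀)
        (by simpa [dist_eq_norm] using hs₂a _ hLs)
      rw [← hcenter, ← hcenter] at hcov
      refine (hcov hyL).imp (fun hy => ⟨L₀, hnot _ fun h => ?_, hy⟩) id
      exact Finset.notMem_erase _ _ (hs₂ h)
    · exact Or.inl ⟨L, hnot ⟨L, hL⟩ hLs, hyL⟩
end
end

section
/- For every d ≥ 2 there exists D > 0 such that every (d+1)-reduced arrangement of closed unit balls in E^d has upper density at most D. -/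
open Set MeasureTheory

noncomputable section

/-- An arrangement of closed unit balls in `Euc d`: a locally finite family of closed
balls of radius `1` (not necessarily a packing or a covering). -/
def IsUnitBallArrangement {d : ℕ} (A : Set (Set (Euc d))) : Prop :=
  (∀ L ∈ A, ∃ x : Euc d, L = Metric.closedBall x 1) ∧
  (∀ B : Set (Euc d), Bornology.IsBounded B → {L ∈ A | (L ∩ B).Nonempty}.Finite)

/-- An arrangement `A` of unit balls is `n`-reduced if it is not possible to delete `n`
members of `A` and replace them by `n - 1` closed unit balls without uncovering any
point covered by the original arrangement. -/
def IsNReducedArrangement {d : ℕ} (A : Set (Set (Euc d))) (n : ℕ) : Prop :=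
  ¬ ∃ (S : Set (Set (Euc d))) (c : Fin (n - 1) → Euc d),
      S ⊆ A ∧ S.Finite ∧ S.ncard = n ∧
      ⋃₀ A ⊆ (⋃₀ (A \ S)) ∪ (⋃ j, Metric.closedBall (c j) 1)

/-- The upper density of a family of sets. -/
def upperDensity {d : ℕ} (A : Set (Set (Euc d))) : ENNReal :=
  Filter.limsup (fun r : ℝ =>
      (∑' L : A, volume ((L : Set (Euc d)) ∩ Metric.ball 0 r)) /
        volume (Metric.ball (0 : Euc d) r)) Filter.atTop

/-- If the pairs of a large finite set are covered by few transitive relations, then one of the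
relations admits a long chain. -/
lemma exists_chain_of_card_lt {α κ : Type*} [Fintype κ] (r : κ → α → α → Prop)
    (htrans : ∀ k x y z, r k x y → r k y z → r k x z) (F : Finset α)
    (hr : ∀ x ∈ F, ∀ y ∈ F, x ≠ y → ∃ k, r k x y) (m : ℕ)
    (hcard : m ^ Fintype.card κ < F.card) :
    ∃ (k : κ) (g : ℕ → α), (∀ i ≤ m, g i ∈ F) ∧ ∀ i j, i < j → j ≤ m → r k (g i) (g j) := by
  classical
  by_contra hno
  let C : κ → α → ℕ → Prop := fun k x n =>
    ∃ g : ℕ → α, g n = x ∧ (∀ i ≤ n, g i ∈ F) ∧ ∀ i j, i < j → j ≤ n → r k (g i) (g j)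
  have hC0 : ∀ k, ∀ x ∈ F, C k x 0 := fun k x hx =>
    ⟨fun _ => x, rfl, fun _ _ => hx, fun i j hij hj => by omega⟩
  have hCsucc : ∀ k x y n, C k x n → y ∈ F → r k x y → C k y (n + 1) := by
    rintro k x y n ⟨g, hgn, hgF, hgr⟩ hy hxy
    refine ⟨fun i => if i ≤ n then g i else y, by simp, fun i _ => ?_, fun i j hij hj => ?_⟩
    · by_cases h : i ≤ n
      · simpa [h] using hgF i h
      · simpa [h] using hy
    · have hi : i ≤ n := by omega
      by_cases h : j ≤ n
      · simpa [h, hi] using hgr i j hij h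
      · simp only [hi, h, if_true, if_false]
        rcases hi.lt_or_eq with hi' | rfl
        · exact htrans k _ _ _ (hgr i n hi' le_rfl) (hgn ▸ hxy)
        · exact hgn ▸ hxy
  have hCm : ∀ k x, ¬ C k x m := fun k x ⟨g, _, hgF, hgr⟩ => hno ⟨k, g, hgF, hgr⟩
  let f : α → κ → ℕ := fun x k => Nat.findGreatest (C k x) m
  have hfC : ∀ k, ∀ x ∈ F, C k x (f x k) := fun k x hx =>
    Nat.findGreatest_spec (P := C k x) (Nat.zero_le m) (hC0 k x hx)
  have hflt : ∀ k, ∀ x ∈ F, f x k < m := fun k x hx =>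
    lt_of_le_of_ne (Nat.findGreatest_le m) fun h => hCm k x (h ▸ hfC k x hx)
  have hinj : Set.InjOn f F := by
    intro x hx y hy hxy
    by_contra hne
    obtain ⟨k, hk⟩ := hr x hx y hy hne
    have h1 : f x k + 1 ≤ f y k :=
      Nat.le_findGreatest (hflt k x hx) (hCsucc k x y _ (hfC k x hx) hy hk)
    rw [hxy] at h1
    omega
  have hle : F.card ≤ (Fintype.piFinset fun _ : κ => Finset.range m).card :=
    Finset.card_le_card_of_injOn f
      (fun x hx => by simpa [Fintype.mem_piFinset] using fun k => hflt k x hx) hinj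
  simp at hle
  omega

section Cone

variable {E : Type*} [NormedAddCommGroup E] [InnerProductSpace ℝ E]

/-- `y - x` is nonzero and lies in a narrow convex cone around `w`. -/
def ConeRel (δ : ℝ) (w x y : E) : Prop :=
  x ≠ y ∧ (1 - δ ^ 2 / 2) * ‖y - x‖ ≤ inner ℝ (y - x) w

lemma ConeRel.trans {δ : ℝ} (h0 : 0 ≤ δ) (h1 : δ ≤ 1) {w x y z : E} (hxy : ConeRel δ w x y)
    (hyz : ConeRel δ w y z) : ConeRel δ w x z := by
  have hpos : 0 < 1 - δ ^ 2 / 2 := by nlinarith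
  have hsum : inner ℝ (z - x) w = inner ℝ (z - y) w + inner ℝ (y - x) w := by
    rw [← inner_add_left, sub_add_sub_cancel]
  have hnorm : ‖z - x‖ ≤ ‖z - y‖ + ‖y - x‖ := by
    simpa using norm_add_le (z - y) (y - x)
  refine ⟨?_, ?_⟩
  · rintro rfl
    have hyx : 0 < ‖y - x‖ := norm_pos_iff.2 (sub_ne_zero.2 hxy.1.symm)
    have h2 := hxy.2
    have h3 := hyz.2
    rw [sub_self, inner_zero_left] at hsum
    have := mul_pos hpos hyx
    have := mul_nonneg hpos.le (norm_nonneg (x - y))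
    linarith
  · have h2 := hxy.2
    have h3 := hyz.2
    have := mul_le_mul_of_nonneg_left hnorm hpos.le
    linarith

lemma coneRel_of_norm_sub_le {δ : ℝ} {w x y : E} (hw : ‖w‖ = 1) (hne : x ≠ y)
    (h : ‖(‖y - x‖)⁻¹ • (y - x) - w‖ ≤ δ) : ConeRel δ w x y := by
  refine ⟨hne, ?_⟩
  have hpos : 0 < ‖y - x‖ := norm_pos_iff.2 (sub_ne_zero.2 hne.symm)
  have hu : ‖(‖y - x‖)⁻¹ • (y - x)‖ = 1 := by
    rw [norm_smul, norm_inv, norm_norm, inv_mul_cancel₀ hpos.ne']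
  have hsq := norm_sub_sq_real ((‖y - x‖)⁻¹ • (y - x)) w
  rw [hu, hw, real_inner_smul_left] at hsq
  have h2 : ‖(‖y - x‖)⁻¹ • (y - x) - w‖ ^ 2 ≤ δ ^ 2 := pow_le_pow_left₀ (norm_nonneg _) h 2
  have h3 : 1 - δ ^ 2 / 2 ≤ (‖y - x‖)⁻¹ * inner ℝ (y - x) w := by linarith
  calc _ ≤ ((‖y - x‖)⁻¹ * inner ℝ (y - x) w) * ‖y - x‖ :=
        mul_le_mul_of_nonneg_right h3 hpos.le
    _ = _ := by field_simp

lemma ConeRel.abs_inner_sub_le {δ : ℝ} (h0 : 0 ≤ δ) {w x y v : E} (hw : ‖w‖ = 1)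
    (h : ConeRel δ w x y) (hv : ‖v‖ ≤ 1) :
    |inner ℝ v (y - x) - ‖y - x‖ * inner ℝ v w| ≤ δ * ‖y - x‖ := by
  set u := y - x with hu
  have h1 : ‖u - ‖u‖ • w‖ ≤ δ * ‖u‖ := by
    refine (sq_le_sq₀ (norm_nonneg _) (by positivity)).1 ?_
    rw [norm_sub_sq_real, norm_smul, hw, norm_norm, real_inner_smul_right]
    have := mul_le_mul_of_nonneg_left h.2 (norm_nonneg u)
    rw [← hu] at this
    nlinarith
  have h2 : inner ℝ v u - ‖u‖ * inner ℝ v w = inner ℝ v (u - ‖u‖ • w) := by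
    rw [inner_sub_right v u, real_inner_smul_right]
  rw [h2]
  calc _ ≤ ‖v‖ * ‖u - ‖u‖ • w‖ := abs_real_inner_le_norm _ _
    _ ≤ 1 * (δ * ‖u‖) := by gcongr
    _ = _ := one_mul _

/-- A point of a unit ball centred at `c`, missed by the unit balls centred at `cf` and `cl`, lies
near the hyperplane through `c` orthogonal to `w`, if `cf`, `c`, `cl` are nearly aligned along
`w`. -/
lemma abs_inner_le_of_not_mem {δ ε : ℝ} (h0 : 0 ≤ δ) {w cf c cl p : E} (hw : ‖w‖ = 1)
    (hf : ConeRel δ w cf c) (hl : ConeRel δ w c cl) (hfε : ‖c - cf‖ ≤ 2 * ε)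
    (hlε : ‖cl - c‖ ≤ 2 * ε) (hp : ‖p - c‖ ≤ 1) (hpf : 1 < ‖p - cf‖) (hpl : 1 < ‖p - cl‖) :
    |inner ℝ (p - c) w| ≤ δ + ε := by
  have hfpos : 0 < ‖c - cf‖ := norm_pos_iff.2 (sub_ne_zero.2 hf.1.symm)
  have hlpos : 0 < ‖cl - c‖ := norm_pos_iff.2 (sub_ne_zero.2 hl.1.symm)
  have h1 := (abs_le.1 (hf.abs_inner_sub_le h0 hw hp)).2
  have h2 := (abs_le.1 (hl.abs_inner_sub_le h0 hw hp)).1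
  have h3 := norm_add_sq_real (p - c) (c - cf)
  have h4 := norm_sub_sq_real (p - c) (cl - c)
  rw [sub_add_sub_cancel] at h3
  rw [sub_sub_sub_cancel_right] at h4
  have h5 : ‖p - c‖ ^ 2 ≤ 1 := pow_le_one₀ (norm_nonneg _) hp
  have h6 : 1 < ‖p - cf‖ ^ 2 := one_lt_pow₀ hpf two_ne_zero
  have h7 : 1 < ‖p - cl‖ ^ 2 := one_lt_pow₀ hpl two_ne_zero
  rw [abs_le]
  constructor
  · have : 0 < ‖c - cf‖ * (inner ℝ (p - c) w + δ + ‖c - cf‖ / 2) := by nlinarith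
    have := pos_of_mul_pos_right this hfpos.le
    linarith
  · have : 0 < ‖cl - c‖ * (δ + ‖cl - c‖ / 2 - inner ℝ (p - c) w) := by nlinarith
    have := pos_of_mul_pos_right this hlpos.le
    linarith

/-- In dimension `d`, the `d` vertices of a simplex in the hyperplane orthogonal to `w` detect all
directions near that hyperplane. -/
lemma exists_simplex_directions {d : ℕ} (hd : 0 < d) (hE : Module.finrank ℝ E = d) {w : E}
    (hw : ‖w‖ = 1) :
    ∃ a : Fin d → E, (∀ j, ‖a j‖ ≤ d) ∧
      ∀ v : E, 1 / 2 ≤ ‖v‖ → |inner ℝ v w| ≤ 1 / 4 →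
        ∃ j, 1 / (4 * (d : ℝ) ^ 2) ≤ inner ℝ v (a j) := by
  classical
  have : FiniteDimensional ℝ E := Module.finite_of_finrank_pos (hE ▸ hd)
  let o : Fin d := ⟨0, hd⟩
  obtain ⟨b, hb⟩ := Orthonormal.exists_orthonormalBasis_extension_of_card_eq (𝕜 := ℝ)
    (ι := Fin d) (E := E) (by simpa using hE) (v := fun _ => w) (s := {o})
    ⟨fun _ => hw, fun i j hij => (hij (Subsingleton.elim i j)).elim⟩
  have hbo : b o = w := hb o rfl
  have hd1 : (1 : ℝ) ≤ d := by exact_mod_cast hd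
  refine ⟨fun j => if j = o then -∑ i ∈ Finset.univ.erase o, b i else b j, fun j => ?_,
    fun v hv hvw => ?_⟩
  · by_cases hj : j = o
    · simp only [hj, if_true, norm_neg]
      calc _ ≤ ∑ i ∈ Finset.univ.erase o, ‖b i‖ := norm_sum_le _ _
        _ ≤ ∑ i : Fin d, ‖b i‖ :=
          Finset.sum_le_sum_of_subset_of_nonneg (Finset.erase_subset _ _) (by simp)
        _ = d := by simp
    · simpa [hj] using hd1
  · by_contra! hno
    set κ : ℝ := 1 / (4 * (d : ℝ) ^ 2) with hκ
    have hκ0 : 0 < κ := by positivity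
    have hup : ∀ j, j ≠ o → inner ℝ v (b j) < κ := fun j hj => by simpa [hj] using hno j
    have hsum : -∑ i ∈ Finset.univ.erase o, inner ℝ v (b i) < κ := by
      rw [← inner_sum, ← inner_neg_right]
      simpa only [if_true] using hno o
    have habs : ∀ j, j ≠ o → |inner ℝ v (b j)| ≤ d * κ := by
      intro j hj
      rw [abs_le]
      refine ⟨?_, (hup j hj).le.trans (le_mul_of_one_le_left hκ0.le hd1)⟩
      have hmem : j ∈ Finset.univ.erase o := by simp [hj]
      rw [← Finset.add_sum_erase _ _ hmem] at hsum
      have hcard : ((Finset.univ.erase o).erase j).card + 1 + 1 = d := by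
        rw [Finset.card_erase_add_one hmem, Finset.card_erase_add_one (Finset.mem_univ o)]
        simp
      have hle : ∑ i ∈ (Finset.univ.erase o).erase j, inner ℝ v (b i) ≤
          ((Finset.univ.erase o).erase j).card • κ :=
        Finset.sum_le_card_nsmul _ _ _ fun i hi => (hup i (by simp at hi; exact hi.2)).le
      have hcard' : (((Finset.univ.erase o).erase j).card : ℝ) = d - 2 := by
        have : ((((Finset.univ.erase o).erase j).card + 1 + 1 : ℕ) : ℝ) = d := by rw [hcard]
        push_cast at this
        linarith
      rw [nsmul_eq_mul, hcard'] at hle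
      nlinarith
    have hnorm : ‖v‖ ^ 2 = ∑ i, inner ℝ v (b i) ^ 2 := (b.sum_sq_inner_left v).symm
    rw [← Finset.add_sum_erase _ _ (Finset.mem_univ o), hbo] at hnorm
    have hrest : ∑ i ∈ Finset.univ.erase o, inner ℝ v (b i) ^ 2 ≤ d * (d * κ) ^ 2 := by
      calc _ ≤ (Finset.univ.erase o).card • (d * κ) ^ 2 := by
            refine Finset.sum_le_card_nsmul _ _ _ fun i hi => ?_
            rw [← sq_abs]
            exact pow_le_pow_left₀ (abs_nonneg _) (habs i (by simpa using hi)) 2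
        _ ≤ _ := by
          rw [nsmul_eq_mul]
          gcongr
          simp
    have hdκ : (d : ℝ) * (d * κ) ^ 2 ≤ 1 / 16 := by
      have : (d : ℝ) * (d * κ) ^ 2 = 1 / (16 * d) := by rw [hκ]; field_simp; norm_num
      rw [this]
      exact one_div_le_one_div_of_le (by norm_num) (by linarith)
    have hw2 : inner ℝ v w ^ 2 ≤ (1 / 4 : ℝ) ^ 2 := by
      rw [← sq_abs]
      exact pow_le_pow_left₀ (abs_nonneg _) hvw 2
    nlinarith

end Cone

/-- Unit balls whose centres lie strictly inside a long, nearly aligned chain of nearby points can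
be covered by `d` unit balls and the two end balls of the chain. -/
lemma exists_replacement_balls {d : ℕ} (hd : 0 < d) {w : Euc d} (hw : ‖w‖ = 1) {δ ε : ℝ}
    (hδ : δ = 1 / (4 * (d : ℝ) ^ 2) / 8)
    (hε : ε * (((d : ℝ) + 2) ^ 2 + 4) = 1 / (4 * (d : ℝ) ^ 2)) (cf cl : Euc d) :
    ∃ z : Fin d → Euc d, ∀ c p : Euc d, ConeRel δ w cf c → ConeRel δ w c cl →
      ‖c - cf‖ ≤ 2 * ε → ‖cl - c‖ ≤ 2 * ε → ‖p - c‖ ≤ 1 → 1 < ‖p - cf‖ → 1 < ‖p - cl‖ →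
        ∃ j, ‖p - z j‖ ≤ 1 := by
  obtain ⟨a, ha, hav⟩ := exists_simplex_directions hd (by simp : Module.finrank ℝ (Euc d) = d) hw
  set κ : ℝ := 1 / (4 * (d : ℝ) ^ 2) with hκ
  have hd1 : (1 : ℝ) ≤ d := by exact_mod_cast hd
  have hκ0 : 0 < κ := by positivity
  have hκ4 : κ ≤ 1 / 4 := one_div_le_one_div_of_le (by norm_num) (by nlinarith)
  have hε0 : 0 < ε := pos_of_mul_pos_left (hε ▸ hκ0) (by positivity)
  have hε8 : 8 * ε ≤ κ := by nlinarith
  have hδ0 : 0 ≤ δ := by linarith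
  refine ⟨fun j => cf + ε • a j, fun c p hf hl hfε hlε hp hpf hpl => ?_⟩
  have hvw := abs_inner_le_of_not_mem hδ0 hw hf hl hfε hlε hp hpf hpl
  have hv : 1 / 2 ≤ ‖p - c‖ := by
    have := norm_add_le (p - c) (c - cf)
    rw [sub_add_sub_cancel] at this
    linarith
  obtain ⟨j, hj⟩ := hav (p - c) hv (by linarith)
  refine ⟨j, ?_⟩
  have hh := (abs_le.1 (hf.abs_inner_sub_le hδ0 hw hp)).2
  have hvh : inner ℝ (p - c) (c - cf) ≤ 2 * ε * (2 * δ + ε) := by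
    have h1 : inner ℝ (p - c) (c - cf) ≤ ‖c - cf‖ * (2 * δ + ε) := by
      have := mul_le_mul_of_nonneg_left (abs_le.1 hvw).2 (norm_nonneg (c - cf))
      linarith
    exact h1.trans (mul_le_mul_of_nonneg_right hfε (by linarith))
  have he : ‖ε • a j - (c - cf)‖ ≤ ε * (d + 2) := by
    calc _ ≤ ‖ε • a j‖ + ‖c - cf‖ := norm_sub_le _ _
      _ ≤ ε * d + 2 * ε := by
        rw [norm_smul, Real.norm_of_nonneg hε0.le]
        gcongr
        exact ha j
      _ = _ := by ring
  have he2 := pow_le_pow_left₀ (norm_nonneg _) he 2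
  have hsq := norm_sub_sq_real (p - c) (ε • a j - (c - cf))
  have hp2 : ‖p - c‖ ^ 2 ≤ 1 := pow_le_one₀ (norm_nonneg _) hp
  have heq : p - c - (ε • a j - (c - cf)) = p - (cf + ε • a j) := by abel
  rw [heq, inner_sub_right, real_inner_smul_right] at hsq
  have hmul := mul_le_mul_of_nonneg_left hj hε0.le
  have hkey : (ε * (d + 2)) ^ 2 + 2 * (2 * ε * (2 * δ + ε)) ≤ 2 * (ε * κ) := by
    have h1 : (ε * (d + 2)) ^ 2 + 4 * ε * ε = ε * κ := by rw [← hε]; ring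
    have h2 : 8 * δ = κ := by linarith
    have h3 : 8 * (ε * δ) = ε * κ := by rw [← h2]; ring
    nlinarith
  have : ‖p - (cf + ε • a j)‖ ^ 2 ≤ 1 := by linarith
  exact (sq_le_one_iff₀ (norm_nonneg _)).1 this

/-- In a `(d+1)`-reduced arrangement, boundedly many balls have their centres in a given small
ball. -/
lemma exists_card_le_of_reduced (d : ℕ) (hd : 0 < d) :
    ∃ (ε : ℝ) (N : ℕ), 0 < ε ∧ ∀ A : Set (Set (Euc d)), IsNReducedArrangement A (d + 1) →
      ∀ ctr : Set (Euc d) → Euc d, (∀ L ∈ A, L = Metric.closedBall (ctr L) 1) →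
      ∀ (x : Euc d) (F : Finset (Set (Euc d))), ↑F ⊆ A →
        (∀ L ∈ F, ctr L ∈ Metric.ball x ε) → F.card ≤ N := by
  classical
  have hd1 : (1 : ℝ) ≤ d := by exact_mod_cast hd
  obtain ⟨δ, hδ⟩ : ∃ δ : ℝ, δ = 1 / (4 * (d : ℝ) ^ 2) / 8 := ⟨_, rfl⟩
  have hδ0 : 0 < δ := by rw [hδ]; positivity
  have hδ1 : δ ≤ 1 := by
    have : 1 / (4 * (d : ℝ) ^ 2) ≤ 1 / 1 := one_div_le_one_div_of_le (by norm_num) (by nlinarith)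
    linarith
  obtain ⟨ε, hε⟩ : ∃ ε : ℝ, ε * (((d : ℝ) + 2) ^ 2 + 4) = 1 / (4 * (d : ℝ) ^ 2) :=
    ⟨_, div_mul_cancel₀ _ (by positivity)⟩
  have hε0 : 0 < ε :=
    pos_of_mul_pos_left (b := ((d : ℝ) + 2) ^ 2 + 4) (by rw [hε]; positivity) (by positivity)
  obtain ⟨W, hWs, hWfin, hW⟩ :=
    (isCompact_sphere (0 : Euc d) 1).finite_cover_balls hδ0
  have : Fintype W := hWfin.fintype
  refine ⟨ε, (d + 2) ^ Fintype.card W, hε0, fun A hA ctr hctr x F hFA hFx => ?_⟩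
  by_contra! hcard
  have hWnorm : ∀ w : W, ‖(w : Euc d)‖ = 1 := fun w => by simpa using hWs w.2
  obtain ⟨w, g, hgF, hg⟩ := exists_chain_of_card_lt
    (fun (w : W) (L M : Set (Euc d)) => ConeRel δ (w : Euc d) (ctr L) (ctr M))
    (fun w L M P => ConeRel.trans hδ0.le hδ1) F
    (fun L hL M hM hLM => by
      have hne : ctr L ≠ ctr M := fun h =>
        hLM (by rw [hctr L (hFA hL), hctr M (hFA hM), h])
      have hmem : (‖ctr M - ctr L‖)⁻¹ • (ctr M - ctr L) ∈ Metric.sphere (0 : Euc d) 1 := by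
        have hpos : 0 < ‖ctr M - ctr L‖ := norm_pos_iff.2 (sub_ne_zero.2 hne.symm)
        rw [mem_sphere_zero_iff_norm, norm_smul, norm_inv, norm_norm, inv_mul_cancel₀ hpos.ne']
      obtain ⟨w, hwW, hw⟩ := mem_iUnion₂.1 (hW hmem)
      exact ⟨⟨w, hwW⟩, coneRel_of_norm_sub_le (hWnorm ⟨w, hwW⟩) hne
        (by rw [← dist_eq_norm]; exact hw.le)⟩) (d + 2) hcard
  have hgne : ∀ i j, i < j → j ≤ d + 2 → g i ≠ g j := fun i j hij hj h =>
    (hg i j hij hj).1 (congrArg ctr h)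
  have hdist : ∀ i j, i ≤ d + 2 → j ≤ d + 2 → ‖ctr (g i) - ctr (g j)‖ ≤ 2 * ε := by
    intro i j hi hj
    rw [← dist_eq_norm]
    have h1 := Metric.mem_ball.1 (hFx _ (hgF i hi))
    have h2 := Metric.mem_ball.1 (hFx _ (hgF j hj))
    linarith [dist_triangle_right (ctr (g i)) (ctr (g j)) x]
  obtain ⟨z, hz⟩ := exists_replacement_balls hd (hWnorm w) hδ hε (ctr (g 0)) (ctr (g (d + 2)))
  have hginj : Set.InjOn g (Finset.Icc 1 (d + 1)) := by
    intro i hi j hj hij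
    simp only [Finset.coe_Icc, Set.mem_Icc] at hi hj
    rcases lt_trichotomy i j with h | h | h
    · exact (hgne i j h (by omega) hij).elim
    · exact h
    · exact (hgne j i h (by omega) hij.symm).elim
  have hgA : ∀ i ≤ d + 2, g i ∈ A := fun i hi => hFA (hgF i hi)
  let S : Finset (Set (Euc d)) := (Finset.Icc 1 (d + 1)).image g
  have hend : ∀ i, i = 0 ∨ i = d + 2 → g i ∈ A \ (S : Set (Set (Euc d))) := by
    intro i hi
    refine ⟨hgA i (by omega), fun hS => ?_⟩
    obtain ⟨j, hj, hji⟩ := Finset.mem_image.1 (Finset.mem_coe.1 hS)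
    rw [Finset.mem_Icc] at hj
    rcases hi with rfl | rfl
    · exact hgne 0 j (by omega) (by omega) hji.symm
    · exact hgne j (d + 2) (by omega) le_rfl hji
  refine hA ⟨S, z, fun L hL => ?_, S.finite_toSet, ?_, ?_⟩
  · obtain ⟨j, hj, rfl⟩ := Finset.mem_image.1 (Finset.mem_coe.1 hL)
    rw [Finset.mem_Icc] at hj
    exact hgA j (by omega)
  · rw [Set.ncard_coe_finset, Finset.card_image_of_injOn hginj]
    simp
  · rintro p ⟨L, hLA, hpL⟩
    by_contra hp
    rw [mem_union, not_or] at hp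
    have hpnot : ∀ M ∈ A \ (S : Set (Set (Euc d))), p ∉ M := fun M hM hpM => hp.1 ⟨M, hM, hpM⟩
    have hLS : L ∈ (S : Set (Set (Euc d))) := by
      by_contra h
      exact hpnot L ⟨hLA, h⟩ hpL
    obtain ⟨i, hi, rfl⟩ := Finset.mem_image.1 (Finset.mem_coe.1 hLS)
    rw [Finset.mem_Icc] at hi
    have hfar : ∀ k, k = 0 ∨ k = d + 2 → 1 < ‖p - ctr (g k)‖ := by
      intro k hk
      have h := hpnot _ (hend k hk)
      rw [hctr _ (hend k hk).1, mem_closedBall_iff_norm, not_le] at h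
      exact h
    rw [hctr _ hLA, mem_closedBall_iff_norm] at hpL
    obtain ⟨j, hj⟩ := hz (ctr (g i)) p (hg 0 i (by omega) (by omega))
      (hg i (d + 2) (by omega) le_rfl) (hdist i 0 (by omega) (by omega))
      (hdist (d + 2) i le_rfl (by omega)) hpL (hfar 0 (Or.inl rfl)) (hfar _ (Or.inr rfl))
    exact hp.2 (mem_iUnion.2 ⟨j, mem_closedBall_iff_norm.2 hj⟩)

/-- In a `(d+1)`-reduced arrangement, every point lies in boundedly many balls. -/
lemma exists_multiplicity_le_of_reduced (d : ℕ) (hd : 0 < d) :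
    ∃ N : ℕ, ∀ A : Set (Set (Euc d)), IsUnitBallArrangement A →
      IsNReducedArrangement A (d + 1) →
      ∀ (y : Euc d) (F : Finset (Set (Euc d))), ↑F ⊆ A → (∀ L ∈ F, y ∈ L) → F.card ≤ N := by
  classical
  obtain ⟨ε, N, hε, hN⟩ := exists_card_le_of_reduced d hd
  obtain ⟨t, -, htfin, ht⟩ := (isCompact_closedBall (0 : Euc d) 1).finite_cover_balls hε
  lift t to Finset (Euc d) using htfin
  refine ⟨N * t.card, fun A hA hred y F hFA hFy => ?_⟩
  choose! ctr hctr using hA.1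
  have hF : F ⊆ t.biUnion fun a => F.filter fun L => ctr L ∈ Metric.ball (y + a) ε := by
    intro L hL
    have hy := hFy L hL
    rw [hctr L (hFA hL), Metric.mem_closedBall_comm] at hy
    have hmem : ctr L - y ∈ Metric.closedBall (0 : Euc d) 1 := by
      simpa [dist_eq_norm] using hy
    obtain ⟨a, hat, ha⟩ := mem_iUnion₂.1 (ht hmem)
    refine Finset.mem_biUnion.2 ⟨a, hat, Finset.mem_filter.2 ⟨hL, ?_⟩⟩
    rw [mem_ball_iff_norm] at ha ⊢
    rwa [← sub_sub]
  calc F.card ≤ _ := Finset.card_le_card hF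
    _ ≤ t.card * N := Finset.card_biUnion_le_card_mul _ _ _ fun a _ =>
        hN A hred ctr hctr (y + a) _ (fun L hL => hFA (Finset.mem_filter.1 hL).1)
          fun L hL => (Finset.mem_filter.1 hL).2
    _ = N * t.card := mul_comm _ _

/-- For every `d ≥ 2` there exists `D > 0` such that every `(d+1)`-reduced arrangement
of closed unit balls in `Euc d` has upper density at most `D`. -/
theorem reduced_arrangement_density_bound (d : ℕ) (hd : 2 ≤ d) :
    ∃ D : ℝ, 0 < D ∧ ∀ A : Set (Set (Euc d)), IsUnitBallArrangement A →
      IsNReducedArrangement A (d + 1) → upperDensity A ≤ ENNReal.ofReal D := by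
  classical
  obtain ⟨N, hN⟩ := exists_multiplicity_le_of_reduced d (by omega)
  refine ⟨N + 1, by positivity, fun A hA hred => ?_⟩
  refine Filter.limsup_le_of_le (by isBoundedDefault) (Filter.Eventually.of_forall fun r => ?_)
  apply ENNReal.div_le_of_le_mul
  have hmeas : ∀ L ∈ A, MeasurableSet L := fun L hL => by
    obtain ⟨x, rfl⟩ := hA.1 L hL
    exact Metric.isClosed_closedBall.measurableSet
  have hcast : ENNReal.ofReal ((N : ℝ) + 1) = ((N + 1 : ℕ) : ENNReal) := by
    rw [← ENNReal.ofReal_natCast]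
    push_cast
    rfl
  rw [hcast, ENNReal.tsum_eq_iSup_sum]
  refine iSup_le fun s => ?_
  have hpt : ∀ y : Euc d, ∑ L ∈ s, L.1.indicator (1 : Euc d → ENNReal) y ≤
      ((N + 1 : ℕ) : ENNReal) := by
    intro y
    simp only [Set.indicator_apply, Pi.one_apply]
    rw [Finset.sum_boole]
    have := hN A hA hred y ((s.filter fun L : A => y ∈ L.1).map
      (Function.Embedding.subtype _)) (by
        intro L hL
        simp at hL
        exact hL.1.1) (by
        intro L hL
        simp at hL
        exact hL.2)
    rw [Finset.card_map] at this
    exact_mod_cast this.trans (Nat.le_succ N)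
  calc ∑ L ∈ s, volume (L.1 ∩ Metric.ball 0 r)
      = ∑ L ∈ s, ∫⁻ y in Metric.ball (0 : Euc d) r,
          L.1.indicator (1 : Euc d → ENNReal) y := by
        refine Finset.sum_congr rfl fun L _ => ?_
        rw [lintegral_indicator_one (hmeas L L.2), Measure.restrict_apply (hmeas L L.2)]
    _ = ∫⁻ y in Metric.ball (0 : Euc d) r,
          ∑ L ∈ s, L.1.indicator (1 : Euc d → ENNReal) y :=
        (lintegral_finsetSum _ fun (L : A) _ => measurable_one.indicator (hmeas L L.2)).symm
    _ ≤ ∫⁻ _ in Metric.ball (0 : Euc d) r, ((N + 1 : ℕ) : ENNReal) := lintegral_mono hpt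
    _ = _ := by rw [setLIntegral_const]
end
end

section
/- For every body K in E^d and every integer n ≥ 1, there exist a packing of E^d with translates of K which is n-saturated within the class of translative packings, and a covering of E^d with translates of K which is n-reduced within the class of translative coverings. -/
open Set Pointwise

noncomputable section

/-- `L` is a translate of `K`. -/
def IsTranslate {d : ℕ} (K L : Set (Euc d)) : Prop :=
  ∃ v : Euc d, L = v +ᵥ K

/-- A packing of `Euc d` with translates of `K`. -/
def IsTransPacking {d : ℕ} (K : Set (Euc d)) (P : Set (Set (Euc d))) : Prop :=
  (∀ L ∈ P, IsTranslate K L) ∧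
  P.Pairwise fun A B => Disjoint (interior A) (interior B)

/-- A covering of `Euc d` with translates of `K`. -/
def IsTransCovering {d : ℕ} (K : Set (Euc d)) (C : Set (Set (Euc d))) : Prop :=
  (∀ L ∈ C, IsTranslate K L) ∧ ⋃₀ C = univ

/-- A translative packing is `n`-saturated within the translative class if one cannot
delete `n - 1` members and replace them by `n` translates of `K` so that the result is
still a packing. -/
def IsNSaturatedTrans {d : ℕ} (K : Set (Euc d)) (P : Set (Set (Euc d))) (n : ℕ) : Prop :=
  ¬ ∃ (S : Set (Set (Euc d))) (L : Fin n → Set (Euc d)),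
      S ⊆ P ∧ S.Finite ∧ S.ncard = n - 1 ∧
      (∀ j, IsTranslate K (L j)) ∧
      (∀ i j, i ≠ j → Disjoint (interior (L i)) (interior (L j))) ∧
      (∀ j, ∀ M ∈ P \ S, Disjoint (interior (L j)) (interior M))

/-- A translative covering is `n`-reduced within the translative class if one cannot
delete `n` members and replace them by `n - 1` translates of `K` so that the result is
still a covering. -/
def IsNReducedTrans {d : ℕ} (K : Set (Euc d)) (C : Set (Set (Euc d))) (n : ℕ) : Prop :=
  ¬ ∃ (S : Set (Set (Euc d))) (L : Fin (n - 1) → Set (Euc d)),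
      S ⊆ C ∧ S.Finite ∧ S.ncard = n ∧
      (∀ j, IsTranslate K (L j)) ∧
      (⋃₀ (C \ S)) ∪ (⋃ j, L j) = univ

open scoped Classical in
/-- A finite set either splits into two nonempty parts at distance more than `R`, or its diameter
is bounded in terms of its cardinality. -/
lemma exists_separated_split_or_dist_le {E : Type*} [PseudoMetricSpace E] (T : Finset E) {R : ℝ}
    (hR : 0 ≤ R) :
    (∃ A : Set E, (∃ a ∈ T, a ∈ A) ∧ (∃ b ∈ T, b ∉ A) ∧
      ∀ x ∈ T, ∀ y ∈ T, x ∈ A → y ∉ A → R < dist x y) ∨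
    ∀ x ∈ T, ∀ y ∈ T, dist x y ≤ 2 * T.card * R := by
  rcases T.eq_empty_or_nonempty with rfl | ⟨a, ha⟩
  · right; simp
  obtain ⟨k, hkT, hk⟩ : ∃ k : ℕ, k < T.card ∧
      ∀ x ∈ T, ¬ (k * R < dist a x ∧ dist a x ≤ (k + 1) * R) := by
    by_contra! h
    have : Nonempty E := ⟨a⟩
    choose! f hfT hf using h
    have hcard : (Finset.range T.card).card ≤ (T.erase a).card := by
      refine Finset.card_le_card_of_injOn f ?_ ?_
      · intro k hk
        have hk' : k < T.card := by simpa using hk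
        refine Finset.mem_coe.2 (Finset.mem_erase.2 ⟨?_, hfT k hk'⟩)
        intro h0
        have := (hf k hk').1
        rw [h0, dist_self] at this
        have : (0 : ℝ) ≤ k * R := by positivity
        linarith
      · have key : ∀ i < T.card, ∀ j < T.card, f i = f j → j ≤ i := by
          intro i hi j hj hij
          by_contra! hlt
          have h1 := (hf i hi).2
          have h2 := (hf j hj).1
          rw [hij] at h1
          have : ((i : ℝ) + 1) ≤ j := by exact_mod_cast hlt
          nlinarith
        intro i hi j hj hij
        have hi' : i < T.card := by simpa using hi
        have hj' : j < T.card := by simpa using hj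
        exact le_antisymm (key j hj' i hi' hij.symm) (key i hi' j hj' hij)
    rw [Finset.card_range, Finset.card_erase_of_mem ha] at hcard
    have := Finset.card_pos.2 ⟨a, ha⟩
    omega
  by_cases hb : ∃ b ∈ T, k * R < dist a b
  · left
    obtain ⟨b, hbT, hb⟩ := hb
    refine ⟨{x | dist a x ≤ k * R}, ⟨a, ha, ?_⟩, ⟨b, hbT, by simpa using hb⟩, ?_⟩
    · simp only [mem_ofPred_eq, dist_self]; positivity
    · intro x _ y hy hxA hyA
      simp only [mem_ofPred_eq, not_le] at hxA hyA
      have h1 := hk y hy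
      push Not at h1
      have h2 := h1 hyA
      have h3 := dist_triangle a x y
      linarith
  · right
    push Not at hb
    intro x hx y hy
    have h1 := hb x hx
    have h2 := hb y hy
    have h3 := dist_triangle_left x y a
    have : (k : ℝ) * R ≤ T.card * R :=
      mul_le_mul_of_nonneg_right (by exact_mod_cast hkT.le) hR
    linarith

open scoped Classical in
/-- If a property of pairs of finite sets passes to far-apart parts, then a pair `(S, L)` with
`S.card < L.card` satisfying it can be replaced by such a pair of bounded diameter. -/
lemma exists_localized_pair {E : Type*} [PseudoMetricSpace E] {R : ℝ} (hR : 0 ≤ R)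
    (V : Finset E → Finset E → Prop)
    (hV : ∀ S L : Finset E, ∀ A : Set E, V S L →
      (∀ x ∈ S ∪ L, ∀ y ∈ S ∪ L, x ∈ A → y ∉ A → R < dist x y) →
      V (S.filter (· ∈ A)) (L.filter (· ∈ A)))
    (N : ℕ) (S L : Finset E) (hN : S.card + L.card ≤ N) (hSL : V S L) (hlt : S.card < L.card) :
    ∃ S' L' : Finset E, V S' L' ∧ S'.card < L'.card ∧
      ∀ x ∈ S' ∪ L', ∀ y ∈ S' ∪ L', dist x y ≤ 2 * N * R := by
  induction hm : S.card + L.card using Nat.strong_induction_on generalizing S L with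
  | _ m ih =>
  rcases exists_separated_split_or_dist_le (S ∪ L) hR with ⟨A, ⟨a, haT, haA⟩, ⟨b, hbT, hbA⟩, hA⟩ | h
  · have hS := Finset.card_filter_add_card_filter_not (s := S) (· ∈ A)
    have hL := Finset.card_filter_add_card_filter_not (s := L) (· ∈ A)
    have ha : 0 < (S.filter (· ∈ A)).card + (L.filter (· ∈ A)).card := by
      rcases Finset.mem_union.1 haT with h | h
      · exact Nat.add_pos_left (Finset.card_pos.2 ⟨a, Finset.mem_filter.2 ⟨h, haA⟩⟩) _
      · exact Nat.add_pos_right _ (Finset.card_pos.2 ⟨a, Finset.mem_filter.2 ⟨h, haA⟩⟩)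
    have hb : 0 < (S.filter (· ∉ A)).card + (L.filter (· ∉ A)).card := by
      rcases Finset.mem_union.1 hbT with h | h
      · exact Nat.add_pos_left (Finset.card_pos.2 ⟨b, Finset.mem_filter.2 ⟨h, hbA⟩⟩) _
      · exact Nat.add_pos_right _ (Finset.card_pos.2 ⟨b, Finset.mem_filter.2 ⟨h, hbA⟩⟩)
    by_cases hc : (S.filter (· ∈ A)).card < (L.filter (· ∈ A)).card
    · exact ih _ (by omega) _ _ (by omega) (hV S L A hSL hA) hc rfl
    · have hcompl := hV S L Aᶜ hSL fun x hx y hy hxA hyA => by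
        rw [dist_comm]
        exact hA y hy x hx (not_not.1 hyA) hxA
      exact ih _ (by omega) (S.filter (· ∉ A)) (L.filter (· ∉ A)) (by omega)
        (by convert hcompl) (by omega) rfl
  · refine ⟨S, L, hSL, hlt, fun x hx y hy => (h x hx y hy).trans ?_⟩
    have : ((S ∪ L).card : ℝ) ≤ N := by exact_mod_cast (Finset.card_union_le S L).trans hN
    gcongr

open scoped Classical in
/-- Given a lattice whose nonzero vectors are long, a periodic set of the largest possible number
of classes, with no nonzero difference in `D`, does not admit an improvement of bounded size. -/
lemma exists_saturated_separated_set {E : Type*} [NormedAddCommGroup E] (Λ : AddSubgroup E)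
    {B D : Set E} {ε R : ℝ} (N : ℕ) (hε : 0 < ε) (hεD : Metric.ball 0 ε ⊆ D)
    (hDR : ∀ x ∈ D, ‖x‖ ≤ R) (hD : ∀ x ∈ D, -x ∈ D)
    (hΛ : ∀ v ∈ Λ, ‖v‖ ≤ 2 * N * R + R → v = 0)
    (hB : TotallyBounded B) (hBΛ : ∀ x, ∃ v ∈ Λ, x + v ∈ B) :
    ∃ X : Set E, (∀ x ∈ X, ∀ y ∈ X, x - y ∈ D → x = y) ∧
      ∀ S L : Finset E, ↑S ⊆ X → S.card < L.card → S.card + L.card ≤ N →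
        (∀ x ∈ L, ∀ y ∈ L, x - y ∈ D → x = y) →
        ¬ ∀ l ∈ L, ∀ x ∈ X, x ∉ S → l - x ∉ D := by
  have h0D : (0 : E) ∈ D := hεD (by simpa using hε)
  have hR : 0 ≤ R := by simpa using hDR 0 h0D
  let Q : Finset E → Prop := fun Y =>
    ∀ y ∈ Y, ∀ z ∈ Y, ∀ v ∈ Λ, y - z + v ∈ D → y = z ∧ v = 0
  obtain ⟨t, htfin, ht⟩ := Metric.totallyBounded_iff.1 hB (ε / 2) (by positivity)
  have hbound : ∀ Y, Q Y → Y.card ≤ htfin.toFinset.card := by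
    intro Y hY
    have hex : ∀ y : E, ∃ c ∈ t, ∃ v ∈ Λ, dist (y + v) c < ε / 2 := by
      intro y
      obtain ⟨v, hv, hyv⟩ := hBΛ y
      obtain ⟨c, hc, hcy⟩ := mem_iUnion₂.1 (ht hyv)
      exact ⟨c, hc, v, hv, hcy⟩
    choose f hf g hg hfg using hex
    refine Finset.card_le_card_of_injOn f (fun y _ => by simpa using hf y) ?_
    intro y hy z hz hyz
    refine (hY y hy z hz (g y - g z) (Λ.sub_mem (hg y) (hg z)) (hεD ?_)).1
    rw [mem_ball_zero_iff, show y - z + (g y - g z) = (y + g y) - (z + g z) by abel, ← dist_eq_norm]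
    have h1 := hfg y
    have h2 := hfg z
    rw [← hyz] at h2
    have := dist_triangle_right (y + g y) (z + g z) (f y)
    linarith
  obtain ⟨Y, hY, hYmax⟩ : ∃ Y, Q Y ∧ ∀ Z, Q Z → Z.card ≤ Y.card := by
    have hfin : (Finset.card '' {Y | Q Y}).Finite :=
      (Set.finite_Iic htfin.toFinset.card).subset (by rintro _ ⟨Y, hY, rfl⟩; exact hbound Y hY)
    obtain ⟨_, ⟨⟨Y, hY, rfl⟩, hmax⟩⟩ :=
      hfin.exists_maximal (⟨0, ∅, by simp [Q], rfl⟩ : (Finset.card '' {Y | Q Y}).Nonempty)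
    refine ⟨Y, hY, fun Z hZ => ?_⟩
    rcases le_total Z.card Y.card with h | h
    · exact h
    · exact hmax ⟨Z, hZ, rfl⟩ h
  set X : Set E := {x | ∃ y ∈ Y, ∃ v ∈ Λ, x = y + v} with hX
  refine ⟨X, ?_, ?_⟩
  · rintro _ ⟨y, hy, v, hv, rfl⟩ _ ⟨z, hz, w, hw, rfl⟩ h
    obtain ⟨h1, h2⟩ := hY y hy z hz (v - w) (Λ.sub_mem hv hw)
      (by rwa [show y - z + (v - w) = y + v - (z + w) by abel])
    rw [h1, sub_eq_zero.1 h2]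
  intro S L hSX hlt hN hLD hLX
  obtain ⟨S, L, ⟨hSX, hLD, hLX⟩, hlt, hdist⟩ := exists_localized_pair hR
    (fun S L => ↑S ⊆ X ∧ (∀ x ∈ L, ∀ y ∈ L, x - y ∈ D → x = y) ∧
      ∀ l ∈ L, ∀ x ∈ X, x ∉ S → l - x ∉ D) (by
      rintro S L A ⟨h1, h2, h3⟩ hA
      refine ⟨fun x hx => h1 (Finset.mem_filter.1 hx).1, fun x hx y hy =>
        h2 x (Finset.mem_filter.1 hx).1 y (Finset.mem_filter.1 hy).1, fun l hl x hx hxS => ?_⟩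
      obtain ⟨hlL, hlA⟩ := Finset.mem_filter.1 hl
      by_cases hxS' : x ∈ S
      · intro hlx
        have h4 := hA l (Finset.mem_union_right _ hlL) x (Finset.mem_union_left _ hxS') hlA
          (fun hxA => hxS (Finset.mem_filter.2 ⟨hxS', hxA⟩))
        have h5 := hDR _ hlx
        rw [dist_eq_norm] at h4
        linarith
      · exact h3 l hlL x hx hxS') N S L hN ⟨hSX, hLD, hLX⟩ hlt
  choose! r hrY g hg hrg using (show ∀ s ∈ S, ∃ y ∈ Y, ∃ v ∈ Λ, s = y + v from fun s hs => hSX hs)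
  have hnew : ∀ l ∈ L, ∀ y ∈ Y \ S.image r, ∀ v ∈ Λ, l - y + v ∉ D := by
    intro l hl y hy v hv hD'
    obtain ⟨hyY, hyr⟩ := Finset.mem_sdiff.1 hy
    refine hLX l hl (y - v) ⟨y, hyY, -v, Λ.neg_mem hv, by abel⟩ (fun hS => hyr ?_)
      (by rwa [show l - (y - v) = l - y + v by abel])
    refine Finset.mem_image.2 ⟨y - v, hS, (hY y hyY _ (hrY _ hS) (-v - g (y - v))
      (Λ.sub_mem (Λ.neg_mem hv) (hg _ hS)) ?_).1.symm⟩
    have := hrg _ hS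
    rw [show y - r (y - v) + (-v - g (y - v)) = (y - v) - (r (y - v) + g (y - v)) by abel, ← this,
      sub_self]
    exact h0D
  have hQ : Q (Y \ S.image r ∪ L) := by
    intro y hy z hz v hv hD'
    rcases Finset.mem_union.1 hy with hy | hy <;> rcases Finset.mem_union.1 hz with hz | hz
    · exact hY y (Finset.mem_sdiff.1 hy).1 z (Finset.mem_sdiff.1 hz).1 v hv hD'
    · refine absurd (hD _ hD') ?_
      rw [show -(y - z + v) = z - y + -v by abel]
      exact hnew z hz y hy _ (Λ.neg_mem hv)
    · exact absurd hD' (hnew y hy z hz v hv)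
    · have hv0 : v = 0 := by
        refine hΛ v hv ?_
        have h1 := hdist y (Finset.mem_union_right _ hy) z (Finset.mem_union_right _ hz)
        have h2 := hDR _ hD'
        have h3 := norm_sub_le (y - z + v) (y - z)
        rw [add_sub_cancel_left, ← dist_eq_norm y z] at h3
        linarith
      subst hv0
      exact ⟨hLD y hy z hz (by simpa using hD'), rfl⟩
  have hdisj : Disjoint (Y \ S.image r) L := by
    rw [Finset.disjoint_left]
    intro y hy hyL
    exact hnew y hyL y hy 0 Λ.zero_mem (by simpa using h0D)
  have h1 := hYmax _ hQ
  rw [Finset.card_union_of_disjoint hdisj] at h1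
  have h2 := Finset.le_card_sdiff (S.image r) Y
  have h3 : (S.image r).card ≤ S.card := Finset.card_image_le
  omega

open scoped Classical in
/-- Given a lattice whose nonzero vectors are long, a periodic set of the smallest possible number
of classes, whose translates of `K` cover, does not admit an improvement of bounded size. -/
lemma exists_reduced_covering_set {E : Type*} [NormedAddCommGroup E] (Λ : AddSubgroup E)
    {B K : Set E} {R : ℝ} (N : ℕ) (hR : 0 ≤ R) (hK : (interior K).Nonempty)
    (hKR : ∀ x ∈ K, ∀ y ∈ K, dist x y ≤ R)
    (hΛ : ∀ v ∈ Λ, ‖v‖ ≤ 2 * N * R + R → v = 0)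
    (hB : TotallyBounded B) (hBΛ : ∀ x, ∃ v ∈ Λ, x + v ∈ B) :
    ∃ X : Set E, (∀ p, ∃ x ∈ X, p - x ∈ K) ∧
      ∀ S L : Finset E, ↑S ⊆ X → L.card < S.card → L.card + S.card ≤ N →
        ¬ ∀ p, ∃ x, (x ∈ X ∧ x ∉ S ∨ x ∈ L) ∧ p - x ∈ K := by
  let Q : Finset E → Prop := fun Y => ∀ p, ∃ y ∈ Y, ∃ v ∈ Λ, p - (y + v) ∈ K
  have hQex : ∃ Y, Q Y := by
    obtain ⟨c, hc⟩ := hK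
    obtain ⟨ε, hε, hcK⟩ := Metric.isOpen_iff.1 isOpen_interior c hc
    obtain ⟨t, htfin, ht⟩ := Metric.totallyBounded_iff.1 hB ε hε
    refine ⟨htfin.toFinset.image (· - c), fun p => ?_⟩
    obtain ⟨v, hv, hpv⟩ := hBΛ p
    obtain ⟨b, hb, hpb⟩ := mem_iUnion₂.1 (ht hpv)
    refine ⟨b - c, Finset.mem_image_of_mem _ (by simpa using hb), -v, Λ.neg_mem hv,
      interior_subset (hcK ?_)⟩
    rw [Metric.mem_ball, dist_eq_norm] at hpb ⊢
    rwa [show p - (b - c + -v) - c = p + v - b by abel]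
  obtain ⟨Y, hY, hYmin⟩ : ∃ Y, Q Y ∧ ∀ Z, Q Z → Y.card ≤ Z.card := by
    obtain ⟨Y, hY, h⟩ := exists_minimalFor_of_wellFoundedLT Q Finset.card hQex
    refine ⟨Y, hY, fun Z hZ => ?_⟩
    rcases le_total Y.card Z.card with h' | h'
    · exact h'
    · exact h hZ h'
  set X : Set E := {x | ∃ y ∈ Y, ∃ v ∈ Λ, x = y + v} with hX
  have hXcov : ∀ p, ∃ x ∈ X, p - x ∈ K := fun p => by
    obtain ⟨y, hy, v, hv, hp⟩ := hY p
    exact ⟨y + v, ⟨y, hy, v, hv, rfl⟩, hp⟩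
  have hclose : ∀ p x y : E, p - x ∈ K → p - y ∈ K → dist x y ≤ R := by
    intro p x y hx hy
    have := hKR _ hx _ hy
    rwa [dist_sub_left] at this
  refine ⟨X, hXcov, ?_⟩
  intro S L hSX hlt hN hcov
  obtain ⟨L, S, ⟨hSX, hcov⟩, hlt, hdist⟩ := exists_localized_pair hR
    (fun L S => ↑S ⊆ X ∧ ∀ p, ∃ x, (x ∈ X ∧ x ∉ S ∨ x ∈ L) ∧ p - x ∈ K) (by
      rintro L S A ⟨h1, h2⟩ hA
      refine ⟨fun x hx => h1 (Finset.mem_filter.1 hx).1, fun p => ?_⟩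
      obtain ⟨x, hx | hx, hpx⟩ := h2 p
      · exact ⟨x, .inl ⟨hx.1, fun h => hx.2 (Finset.mem_filter.1 h).1⟩, hpx⟩
      by_cases hxA : x ∈ A
      · exact ⟨x, .inr (Finset.mem_filter.2 ⟨hx, hxA⟩), hpx⟩
      obtain ⟨z, hz, hpz⟩ := hXcov p
      refine ⟨z, .inl ⟨hz, fun hzS => ?_⟩, hpz⟩
      obtain ⟨hzS, hzA⟩ := Finset.mem_filter.1 hzS
      have h3 := hA z (Finset.mem_union_right _ hzS) x (Finset.mem_union_left _ hx) hzA hxA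
      exact absurd (hclose p z x hpz hpx) (not_le.2 h3)) N L S hN ⟨hSX, hcov⟩ hlt
  choose! r hrY g hg hrg using (show ∀ s ∈ S, ∃ y ∈ Y, ∃ v ∈ Λ, s = y + v from fun s hs => hSX hs)
  have hinj : Set.InjOn r S := by
    intro s hs s' hs' h
    have hv : g s - g s' = s - s' := by
      conv_rhs => rw [hrg s hs, hrg s' hs', h]
      abel
    refine sub_eq_zero.1 (hv ▸ hΛ _ (Λ.sub_mem (hg s hs) (hg s' hs')) ?_)
    rw [hv, ← dist_eq_norm]
    have := hdist s (Finset.mem_union_right _ hs) s' (Finset.mem_union_right _ hs')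
    linarith
  have hQ : Q (Y \ S.image r ∪ L) := by
    intro p
    obtain ⟨y, hy, v, hv, hp⟩ := hY p
    by_cases hyr : y ∈ S.image r
    swap
    · exact ⟨y, Finset.mem_union_left _ (Finset.mem_sdiff.2 ⟨hy, hyr⟩), v, hv, hp⟩
    obtain ⟨s, hs, rfl⟩ := Finset.mem_image.1 hyr
    obtain ⟨x, hx, hpx⟩ := hcov (p - (v - g s))
    rcases hx with ⟨⟨z, hz, w, hw, rfl⟩, hxS⟩ | hx
    swap
    · exact ⟨x, Finset.mem_union_right _ hx, v - g s, Λ.sub_mem hv (hg s hs),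
        by rwa [show p - (x + (v - g s)) = p - (v - g s) - x by abel]⟩
    by_cases hzr : z ∈ S.image r
    swap
    · exact ⟨z, Finset.mem_union_left _ (Finset.mem_sdiff.2 ⟨hz, hzr⟩), w + (v - g s),
        Λ.add_mem hw (Λ.sub_mem hv (hg s hs)),
        by rwa [show p - (z + (w + (v - g s))) = p - (v - g s) - (z + w) by abel]⟩
    obtain ⟨s', hs', rfl⟩ := Finset.mem_image.1 hzr
    refine (hxS ?_).elim
    have hps : p - (v - g s) - s ∈ K := by
      rwa [show p - (v - g s) - s = p - (r s + v) by
        nth_rewrite 2 [hrg s hs]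
        abel]
    have h1 := hclose _ _ _ hps hpx
    have h2 := hdist s' (Finset.mem_union_right _ hs') s (Finset.mem_union_right _ hs)
    have hwg : w - g s' = 0 := by
      refine hΛ _ (Λ.sub_mem hw (hg s' hs')) ?_
      have h3 := dist_triangle s' s (r s' + w)
      rw [dist_comm s' (r s' + w), dist_eq_norm (r s' + w)] at h3
      have h4 : r s' + w - s' = w - g s' := by
        rw [sub_eq_sub_iff_add_eq_add]
        nth_rewrite 3 [hrg s' hs']
        abel
      rw [h4] at h3
      linarith
    rw [sub_eq_zero.1 hwg, ← hrg s' hs']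
    exact hs'
  have h1 := hYmin _ hQ
  have h2 := Finset.card_union_le (Y \ S.image r) L
  have h3 : (Y \ S.image r).card = Y.card - (S.image r).card :=
    Finset.card_sdiff_of_subset (Finset.image_subset_iff.2 hrY)
  have h4 : (S.image r).card ≤ Y.card := Finset.card_le_card (Finset.image_subset_iff.2 hrY)
  rw [Finset.card_image_of_injOn hinj] at h3 h4
  omega

/-- There are cocompact subgroups of Euclidean space whose nonzero vectors are arbitrarily long. -/
lemma exists_sparse_cocompact_addSubgroup (d : ℕ) (M : ℝ) :
    ∃ (Λ : AddSubgroup (Euc d)) (B : Set (Euc d)), (∀ v ∈ Λ, ‖v‖ ≤ M → v = 0) ∧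
      TotallyBounded B ∧ ∀ x, ∃ v ∈ Λ, x + v ∈ B := by
  set c : ℝ := |M| + 1 with hc
  have hc0 : 0 < c := by positivity
  refine ⟨{ carrier := {v | ∀ i, ∃ k : ℤ, v i = c * k}
            add_mem' := ?_
            zero_mem' := fun i => ⟨0, by simp⟩
            neg_mem' := ?_ },
    (WithLp.toLp 2) '' (Set.pi univ fun _ : Fin d => Icc (0 : ℝ) c), ?_, ?_, ?_⟩
  · intro v w hv hw i
    obtain ⟨k, hk⟩ := hv i
    obtain ⟨l, hl⟩ := hw i
    exact ⟨k + l, by simp [hk, hl, mul_add]⟩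
  · intro v hv i
    obtain ⟨k, hk⟩ := hv i
    exact ⟨-k, by simp [hk]⟩
  · intro v hv hvM
    ext i
    obtain ⟨k, hk⟩ := hv i
    have h1 : |v i| ≤ M := (PiLp.norm_apply_le v i).trans hvM
    rw [hk, abs_mul, abs_of_pos hc0] at h1
    have h2 : |(k : ℝ)| < 1 := by
      by_contra! h
      nlinarith [le_abs_self M]
    have h3 : k = 0 := Int.abs_lt_one_iff.1 (by exact_mod_cast h2)
    simp [hk, h3]
  · exact ((isCompact_univ_pi fun _ => isCompact_Icc).image
      (PiLp.continuous_toLp 2 _)).totallyBounded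
  · intro x
    refine ⟨WithLp.toLp 2 fun i => c * ((-⌊x i / c⌋ : ℤ) : ℝ), fun i => ⟨_, rfl⟩,
      fun i => x i + c * ((-⌊x i / c⌋ : ℤ) : ℝ), fun i _ => ?_, by ext i; simp⟩
    have h1 := Int.floor_le (x i / c)
    have h2 := Int.lt_floor_add_one (x i / c)
    rw [le_div_iff₀ hc0] at h1
    rw [div_lt_iff₀ hc0] at h2
    push_cast
    constructor <;> nlinarith

lemma disjoint_interior_vadd_iff {d : ℕ} (K : Set (Euc d)) (v w : Euc d) :
    Disjoint (interior (v +ᵥ K)) (interior (w +ᵥ K)) ↔ v - w ∉ interior K - interior K := by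
  rw [interior_vadd, interior_vadd, ← not_iff_not, not_not, Set.not_disjoint_iff]
  constructor
  · rintro ⟨_, ⟨a, ha, rfl⟩, b, hb, hab⟩
    simp only [vadd_eq_add] at hab
    exact ⟨b, hb, a, ha, by rw [sub_eq_sub_iff_add_eq_add, add_comm b, hab]⟩
  · rintro ⟨b, hb, a, ha, hab⟩
    refine ⟨v + a, ⟨a, ha, rfl⟩, b, hb, ?_⟩
    simp only [vadd_eq_add]
    have := sub_eq_sub_iff_add_eq_add.1 hab
    rw [add_comm w, this]

lemma IsBody.interior_nonempty {d : ℕ} {K : Set (Euc d)} (hK : IsBody K) :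
    (interior K).Nonempty := by
  obtain ⟨hne, -, -, hcl⟩ := hK
  rw [hcl] at hne
  exact closure_nonempty_iff.1 hne

lemma IsBody.exists_nSaturated_packing {d : ℕ} {K : Set (Euc d)} (hK : IsBody K) {n : ℕ}
    (hn : 1 ≤ n) : ∃ P : Set (Set (Euc d)), IsTransPacking K P ∧ IsNSaturatedTrans K P n := by
  classical
  obtain ⟨R, hR⟩ := Metric.isBounded_iff.1 hK.2.1.isBounded
  obtain ⟨c, hc⟩ := hK.interior_nonempty
  have h0D : (0 : Euc d) ∈ interior K - interior K := ⟨c, hc, c, hc, sub_self c⟩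
  obtain ⟨ε, hε, hεD⟩ := Metric.isOpen_iff.1
    (isOpen_interior.sub_right : IsOpen (interior K - interior K)) 0 h0D
  obtain ⟨Λ, B, hΛ, hB, hBΛ⟩ := exists_sparse_cocompact_addSubgroup d (2 * (2 * n : ℕ) * R + R)
  obtain ⟨X, hX, hsat⟩ := exists_saturated_separated_set Λ (2 * n) hε hεD
    (by
      rintro _ ⟨a, ha, b, hb, rfl⟩
      simpa [dist_eq_norm] using hR (interior_subset ha) (interior_subset hb))
    (by
      rintro _ ⟨a, ha, b, hb, rfl⟩
      exact ⟨b, hb, a, ha, by simp⟩) hΛ hB hBΛ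
  refine ⟨(fun x => x +ᵥ K) '' X, ⟨?_, ?_⟩, ?_⟩
  · rintro _ ⟨x, -, rfl⟩
    exact ⟨x, rfl⟩
  · rintro _ ⟨x, hx, rfl⟩ _ ⟨y, hy, rfl⟩ hxy
    exact (disjoint_interior_vadd_iff K x y).2 fun h => hxy (by rw [hX x hx y hy h])
  rintro ⟨S, L, hSP, hSfin, hScard, hL, hLL, hLP⟩
  choose l hl using hL
  choose! s hsX hs using (show ∀ M ∈ S, ∃ x ∈ X, x +ᵥ K = M from fun M hM => hSP hM)
  have hLL' : ∀ i j, l i - l j ∈ interior K - interior K → i = j := by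
    intro i j hij
    by_contra hne
    have := hLL i j hne
    rw [hl i, hl j, disjoint_interior_vadd_iff] at this
    exact this hij
  have hlcard : (Finset.univ.image l).card = n := by
    rw [Finset.card_image_of_injective, Finset.card_univ, Fintype.card_fin]
    intro i j hij
    exact hLL' i j (by rwa [hij, sub_self])
  have hscard : (hSfin.toFinset.image s).card ≤ n - 1 := by
    rw [← hScard, Set.ncard_eq_toFinset_card S hSfin]
    exact Finset.card_image_le
  refine hsat (hSfin.toFinset.image s) (Finset.univ.image l) ?_ (by omega) (by omega) ?_ ?_
  · intro x hx
    obtain ⟨M, hM, rfl⟩ := Finset.mem_image.1 (Finset.mem_coe.1 hx)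
    exact hsX M (hSfin.mem_toFinset.1 hM)
  · simp only [Finset.mem_image, Finset.mem_univ, true_and]
    rintro _ ⟨i, rfl⟩ _ ⟨j, rfl⟩ hij
    rw [hLL' i j hij]
  · simp only [Finset.mem_image, Finset.mem_univ, true_and]
    rintro _ ⟨i, rfl⟩ x hx hxS
    rw [← disjoint_interior_vadd_iff, ← hl i]
    refine hLP i _ ⟨⟨x, hx, rfl⟩, fun hxK => hxS ⟨x +ᵥ K, hSfin.mem_toFinset.2 hxK, ?_⟩⟩
    by_contra hne
    have h1 : s (x +ᵥ K) +ᵥ K = x +ᵥ K := hs _ hxK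
    have h2 := (disjoint_interior_vadd_iff K _ _).2
      fun h => hne (hX _ (hsX _ hxK) _ hx h)
    rw [h1, disjoint_self, interior_vadd] at h2
    exact (hK.interior_nonempty.vadd_set (a := x)).ne_empty h2

lemma IsBody.exists_nReduced_covering {d : ℕ} {K : Set (Euc d)} (hK : IsBody K) {n : ℕ}
    (hn : 1 ≤ n) : ∃ C : Set (Set (Euc d)), IsTransCovering K C ∧ IsNReducedTrans K C n := by
  classical
  obtain ⟨R, hR⟩ := Metric.isBounded_iff.1 hK.2.1.isBounded
  have hR0 : 0 ≤ R := by
    obtain ⟨x, hx⟩ := hK.1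
    simpa using hR hx hx
  obtain ⟨Λ, B, hΛ, hB, hBΛ⟩ := exists_sparse_cocompact_addSubgroup d (2 * (2 * n : ℕ) * R + R)
  obtain ⟨X, hX, hred⟩ := exists_reduced_covering_set Λ (2 * n) hR0 hK.interior_nonempty
    (fun x hx y hy => hR hx hy) hΛ hB hBΛ
  have hmem : ∀ p x : Euc d, p ∈ x +ᵥ K ↔ p - x ∈ K := fun p x => by
    rw [Set.mem_vadd_set_iff_neg_vadd_mem, vadd_eq_add, neg_add_eq_sub]
  refine ⟨(fun x => x +ᵥ K) '' X, ⟨?_, ?_⟩, ?_⟩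
  · rintro _ ⟨x, -, rfl⟩
    exact ⟨x, rfl⟩
  · refine eq_univ_of_forall fun p => ?_
    obtain ⟨x, hx, hp⟩ := hX p
    exact ⟨_, ⟨x, hx, rfl⟩, (hmem p x).2 hp⟩
  rintro ⟨S, L, hSC, hSfin, hScard, hL, hcov⟩
  choose l hl using hL
  choose! s hsX hs using (show ∀ M ∈ S, ∃ x ∈ X, x +ᵥ K = M from fun M hM => hSC hM)
  have hlcard : (Finset.univ.image l).card ≤ n - 1 :=
    Finset.card_image_le.trans (by simp)
  have hscard : (hSfin.toFinset.image s).card = n := by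
    rw [← hScard, Set.ncard_eq_toFinset_card S hSfin]
    refine Finset.card_image_of_injOn fun M hM M' hM' h => ?_
    rw [← hs M (hSfin.mem_toFinset.1 hM), ← hs M' (hSfin.mem_toFinset.1 hM'), h]
  refine hred (hSfin.toFinset.image s) (Finset.univ.image l) ?_ (by omega) (by omega) fun p => ?_
  · intro x hx
    obtain ⟨M, hM, rfl⟩ := Finset.mem_image.1 (Finset.mem_coe.1 hx)
    exact hsX M (hSfin.mem_toFinset.1 hM)
  have hp : p ∈ ⋃₀ ((fun x => x +ᵥ K) '' X \ S) ∪ ⋃ j, L j := hcov ▸ mem_univ p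
  rcases hp with ⟨_, ⟨⟨x, hx, rfl⟩, hxS⟩, hpx⟩ | hp
  · refine ⟨x, .inl ⟨hx, fun h => hxS ?_⟩, (hmem p x).1 hpx⟩
    obtain ⟨M, hM, rfl⟩ := Finset.mem_image.1 h
    have hMS := hSfin.mem_toFinset.1 hM
    simpa only [hs M hMS] using hMS
  · obtain ⟨j, hj⟩ := mem_iUnion.1 hp
    rw [hl j] at hj
    exact ⟨l j, .inr (Finset.mem_image_of_mem _ (Finset.mem_univ j)), (hmem p _).1 hj⟩

/-- Every body `K` in `Euc d` admits, for every `n ≥ 1`, an `n`-saturated packing and an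
`n`-reduced covering in the class of packings and coverings with translates of `K`. -/
theorem exists_n_saturated_translative_packing_and_n_reduced_translative_covering
    (d : ℕ) (K : Set (Euc d)) (hK : IsBody K) (n : ℕ) (hn : 1 ≤ n) :
    (∃ P : Set (Set (Euc d)), IsTransPacking K P ∧ IsNSaturatedTrans K P n) ∧
    (∃ C : Set (Set (Euc d)), IsTransCovering K C ∧ IsNReducedTrans K C n) := by
  exact ⟨hK.exists_nSaturated_packing hn, hK.exists_nReduced_covering hn⟩
end
end

section
/- Let K be a convex body in E^d and let m = H_c(K) be its Hadwiger covering number. Then there exists D > 0 such that every covering of E^d with translates of K whose lower density exceeds D fails to be (m+1)-reduced within the class of translative coverings. Consequently l_T(K) ≤ H_c(K) + 1. -/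
open Set MeasureTheory Pointwise

noncomputable section

/-- Finitely many measurable subsets of `B`, no point lying in more than `N` of them, have total
measure at most `N * μ B`. -/
lemma sum_measure_le_of_card_filter_le {α ι : Type*} [MeasurableSpace α] (μ : Measure α)
    (F : Finset ι) (A : ι → Set α) (B : Set α) (N : ℕ) (hA : ∀ i ∈ F, MeasurableSet (A i))
    (hB : MeasurableSet B) (hAB : ∀ i ∈ F, A i ⊆ B)
    (hN : ∀ x, ∃ G : Finset ι, G.card ≤ N ∧ ∀ i ∈ F, x ∈ A i → i ∈ G) :
    ∑ i ∈ F, μ (A i) ≤ N * μ B := by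
  classical
  calc ∑ i ∈ F, μ (A i) = ∑ i ∈ F, ∫⁻ x, (A i).indicator 1 x ∂μ :=
        Finset.sum_congr rfl fun i hi => (lintegral_indicator_one (hA i hi)).symm
    _ = ∫⁻ x, ∑ i ∈ F, (A i).indicator 1 x ∂μ :=
        (lintegral_finsetSum' F fun i hi => (measurable_one.indicator (hA i hi)).aemeasurable).symm
    _ ≤ ∫⁻ x, B.indicator (fun _ => (N : ENNReal)) x ∂μ := by
        refine lintegral_mono fun x => ?_
        by_cases hx : x ∈ B
        · obtain ⟨G, hG, hFG⟩ := hN x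
          have hcard : (F.filter (x ∈ A ·)).card ≤ N :=
            (Finset.card_le_card fun i hi =>
              hFG i (Finset.mem_filter.1 hi).1 (Finset.mem_filter.1 hi).2).trans hG
          simp only [indicator_apply, hx, if_true, Pi.one_apply, Finset.sum_boole]
          exact_mod_cast hcard
        · refine (Finset.sum_eq_zero fun i hi => ?_).trans_le zero_le
          exact indicator_of_notMem (fun h => hx (hAB i hi h)) _
    _ = N * μ B := lintegral_indicator_const hB _

/-- If `m` translates of `K` cover the `δ`-neighborhood of `K`, then in an `n`-reduced covering with
`n > m` fewer than `n` members have centers in any given ball of radius `δ`. -/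
lemma IsNReducedTrans.card_lt {d m n : ℕ} {K : Set (Euc d)} {C : Set (Set (Euc d))} {δ : ℝ}
    {v : Fin m → Euc d} (hδ : Metric.thickening δ K ⊆ ⋃ j, v j +ᵥ K) (hmn : m + 1 ≤ n)
    (hC : IsTransCovering K C) (hred : IsNReducedTrans K C n) {c : C → Euc d}
    (hc : ∀ L : C, (L : Set (Euc d)) = c L +ᵥ K) (x : Euc d) (G : Finset C)
    (hG : ∀ L ∈ G, x ∈ Metric.ball (c L) δ) : G.card < n := by
  classical
  by_contra! hn
  obtain ⟨T, hTG, hT⟩ := Finset.exists_subset_card_eq hn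
  refine hred ⟨Subtype.val '' (T : Set C),
    fun j => (if h : (j : ℕ) < m then x + v ⟨j, h⟩ else x) +ᵥ K, ?_, T.finite_toSet.image _, ?_,
    fun j => ⟨_, rfl⟩, ?_⟩
  · rintro _ ⟨L, -, rfl⟩
    exact L.2
  · rw [ncard_image_of_injective _ Subtype.val_injective, ncard_coe_finset, hT]
  · refine eq_univ_of_forall fun y => ?_
    obtain ⟨L, hL, hy⟩ := mem_sUnion.1 (hC.2 ▸ mem_univ y)
    by_cases hLT : L ∈ Subtype.val '' (T : Set C)
    · obtain ⟨L, hLT, rfl⟩ := hLT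
      rw [hc L] at hy
      obtain ⟨k, hk, rfl⟩ := hy
      have hmem : c L + k - x ∈ Metric.thickening δ K := by
        refine Metric.mem_thickening_iff.2 ⟨k, hk, ?_⟩
        have := hG L (hTG hLT)
        rw [Metric.mem_ball, dist_comm, dist_eq_norm] at this
        rw [dist_eq_norm]
        convert this using 2
        abel
      obtain ⟨j, k', hk', hj⟩ := mem_iUnion.1 (hδ hmem)
      refine Or.inr (mem_iUnion.2 ⟨⟨j, by omega⟩, k', hk', ?_⟩)
      simp only [vadd_eq_add, Fin.is_lt, dif_pos, Fin.eta] at hj ⊢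
      rw [add_assoc, hj]
      abel
    · exact Or.inl (mem_sUnion.2 ⟨L, ⟨hL, hLT⟩, hy⟩)

/-- A family of translates of a bounded set `K`, fewer than `n` of whose centers lie in any given ball
of radius `δ`, has bounded density. -/
lemma lowerDensity_le_of_card_lt {d n : ℕ} {K : Set (Euc d)} {C : Set (Set (Euc d))} {δ R : ℝ}
    (hδ : 0 < δ) (hR : K ⊆ Metric.ball 0 R) {c : C → Euc d}
    (hc : ∀ L : C, (L : Set (Euc d)) = c L +ᵥ K)
    (hcard : ∀ (x : Euc d) (G : Finset C), (∀ L ∈ G, x ∈ Metric.ball (c L) δ) → G.card < n) :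
    lowerDensity C ≤ volume K / volume (Metric.ball (0 : Euc d) δ) *
      (n * ENNReal.ofReal (2 ^ d)) := by
  classical
  have hev : ∀ᶠ r : ℝ in Filter.atTop,
      (∑' L : C, volume ((L : Set (Euc d)) ∩ Metric.ball 0 r)) /
        volume (Metric.ball (0 : Euc d) r) ≤
      volume K / volume (Metric.ball (0 : Euc d) δ) * (n * ENNReal.ofReal (2 ^ d)) := by
    filter_upwards [Filter.eventually_ge_atTop (R + δ)] with r hr
    refine ENNReal.div_le_of_le_mul ?_
    rw [ENNReal.tsum_eq_iSup_sum]
    refine iSup_le fun F => ?_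
    have hball : ∀ x : Euc d, volume (Metric.ball x δ) = volume (Metric.ball (0 : Euc d) δ) :=
      fun x => Measure.addHaar_ball_center volume x δ
    have hδ0 : volume (Metric.ball (0 : Euc d) δ) ≠ 0 := (Metric.measure_ball_pos _ _ hδ).ne'
    have hδt : volume (Metric.ball (0 : Euc d) δ) ≠ ⊤ := measure_ball_lt_top.ne
    set F' := F.filter fun L : C => ((L : Set (Euc d)) ∩ Metric.ball 0 r).Nonempty
    have hsub : ∀ L ∈ F', Metric.ball (c L) δ ⊆ Metric.ball 0 (2 * r) := by
      intro L hL
      obtain ⟨y, hyL, hyr⟩ := (Finset.mem_filter.1 hL).2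
      rw [hc L] at hyL
      obtain ⟨k, hk, rfl⟩ := hyL
      refine Metric.ball_subset_ball' ?_
      have hkR := hR hk
      rw [mem_ball_zero_iff] at hkR hyr
      rw [dist_zero_right]
      have := norm_sub_le (c L + k) k
      rw [add_sub_cancel_right] at this
      simp only [vadd_eq_add] at hyr
      linarith
    have hR' : ∀ x, ∃ G : Finset C, G.card ≤ n ∧ ∀ L ∈ F', x ∈ Metric.ball (c L) δ → L ∈ G :=
      fun x => ⟨F'.filter fun L => x ∈ Metric.ball (c L) δ,
        (hcard x _ fun L hL => (Finset.mem_filter.1 hL).2).le,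
        fun L hL hx => Finset.mem_filter.2 ⟨hL, hx⟩⟩
    calc ∑ L ∈ F, volume ((L : Set (Euc d)) ∩ Metric.ball 0 r)
        = ∑ L ∈ F', volume ((L : Set (Euc d)) ∩ Metric.ball 0 r) := by
          refine (Finset.sum_filter_of_ne fun L _ hne => ?_).symm
          exact nonempty_of_measure_ne_zero hne
      _ ≤ ∑ L ∈ F', volume K / volume (Metric.ball (0 : Euc d) δ) *
            volume (Metric.ball (c L) δ) := by
          refine Finset.sum_le_sum fun L _ => (measure_mono inter_subset_left).trans ?_
          rw [hball (c L), ENNReal.div_mul_cancel hδ0 hδt, hc L, measure_vadd]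
      _ = volume K / volume (Metric.ball (0 : Euc d) δ) *
            ∑ L ∈ F', volume (Metric.ball (c L) δ) := (Finset.mul_sum _ _ _).symm
      _ ≤ volume K / volume (Metric.ball (0 : Euc d) δ) *
            (n * volume (Metric.ball (0 : Euc d) (2 * r))) := by
          gcongr
          exact sum_measure_le_of_card_filter_le _ _ _ _ _ (fun _ _ => measurableSet_ball)
            measurableSet_ball hsub hR'
      _ = _ := by
          rw [Measure.addHaar_ball_mul_of_pos _ _ two_pos, finrank_euclideanSpace_fin]
          ring
  exact Filter.liminf_le_of_frequently_le' hev.frequently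

/-- If some neighborhood of `K` is covered by `m < n` translates of `K`, the lower densities of the
`n`-reduced translative coverings are bounded. -/
lemma exists_lowerDensity_le_of_isNReducedTrans {d m n : ℕ} {K : Set (Euc d)} (hK : IsCompact K)
    {v : Fin m → Euc d} (hv : K ⊆ interior (⋃ j, v j +ᵥ K)) (hmn : m + 1 ≤ n) :
    ∃ D : ℝ, 0 < D ∧ ∀ C : Set (Set (Euc d)),
      IsTransCovering K C → IsNReducedTrans K C n → lowerDensity C ≤ ENNReal.ofReal D := by
  obtain ⟨δ, hδ, hδK⟩ := hK.exists_thickening_subset_open isOpen_interior hv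
  obtain ⟨R, hR⟩ := hK.isBounded.subset_ball (0 : Euc d)
  set M : ENNReal := volume K / volume (Metric.ball (0 : Euc d) δ) *
    (n * ENNReal.ofReal (2 ^ d))
  have hMt : M ≠ ⊤ :=
    ENNReal.mul_ne_top
      (ENNReal.div_ne_top hK.measure_lt_top.ne (Metric.measure_ball_pos _ _ hδ).ne')
      (ENNReal.mul_ne_top (ENNReal.natCast_ne_top n) ENNReal.ofReal_ne_top)
  refine ⟨M.toReal + 1, by positivity, fun C hC hred => ?_⟩
  choose c hc using fun L : C => hC.1 L L.2
  refine (lowerDensity_le_of_card_lt hδ hR hc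
    (hred.card_lt (hδK.trans interior_subset) hmn hC hc)).trans ?_
  exact (ENNReal.le_ofReal_iff_toReal_le hMt (by positivity)).2 (by linarith)

/-- Let `K` be a convex body in `Euc d` and `m = H_c(K)` its Hadwiger covering number
(the least number of translates of `K` whose union contains a neighborhood of `K`).
Then there is a bound `D > 0` such that every covering with translates of `K` of lower
density exceeding `D` fails to be `(m+1)`-reduced within the translative class;
consequently `l_T(K) ≤ H_c(K) + 1`. -/
theorem hadwiger_covering_number_bounds_reduced_density (d m : ℕ) (K : Set (Euc d))
    (hKcpt : IsCompact K) (hKconv : Convex ℝ K) (hKint : (interior K).Nonempty)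
    (hm : IsLeast {k : ℕ | ∃ v : Fin k → Euc d,
        K ⊆ interior (⋃ j, v j +ᵥ K)} m) :
    (∃ D : ℝ, 0 < D ∧ ∀ C : Set (Set (Euc d)), IsTransCovering K C →
        ENNReal.ofReal D < lowerDensity C → ¬ IsNReducedTrans K C (m + 1)) ∧
    (∀ n : ℕ, m + 1 ≤ n → ∃ D : ℝ, 0 < D ∧ ∀ C : Set (Set (Euc d)),
        IsTransCovering K C → IsNReducedTrans K C n →
          lowerDensity C ≤ ENNReal.ofReal D) := by
  obtain ⟨v, hv⟩ := hm.1
  refine ⟨?_, fun n hn => exists_lowerDensity_le_of_isNReducedTrans hKcpt hv hn⟩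
  obtain ⟨D, hD, hCD⟩ := exists_lowerDensity_le_of_isNReducedTrans hKcpt hv le_rfl
  exact ⟨D, hD, fun C hC hlt hred => (hCD C hC hred).not_gt hlt⟩
end
end

section
/- Let A = (A_i)_{i∈I} be a locally finite arrangement of uniformly bounded measurable subsets of E^d and let G be a bounded measurable subset of E^d with positive Lebesgue measure. If the density of A exists and equals a, i.e., lim_{r→∞} (Σ_i vol(A_i ∩ B(0,r)))/vol(B(0,r)) = a, then the average density of A relative to translates of G also exists and equals a: lim_{r→∞} (1/vol(B(0,r))) ∫_{x ∈ B(0,r)} d(A | G + x) dx = a, where d(A | S) = (Σ_i vol(A_i ∩ S))/vol(S). -/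
open Set MeasureTheory Pointwise

noncomputable section

/-- The density of the family `A` relative to a bounded set `S` of positive measure:
the total volume of the intersections of the members of `A` with `S`, divided by the
volume of `S`. -/
def relDensity {d : ℕ} {ι : Type*} (A : ι → Set (Euc d)) (S : Set (Euc d)) : ℝ :=
  (∑' i, (volume (A i ∩ S)).toReal) / (volume S).toReal

/-- The measure counting volume with the multiplicity in which a family covers. -/
def arrangementMeasure {d : ℕ} {ι : Type*} (A : ι → Set (Euc d)) : Measure (Euc d) :=
  Measure.sum fun i => volume.restrict (A i)

instance {d : ℕ} {ι : Type*} [Countable ι] (A : ι → Set (Euc d)) :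
    SFinite (arrangementMeasure A) := by
  unfold arrangementMeasure
  infer_instance

theorem arrangementMeasure_apply {d : ℕ} {ι : Type*} (A : ι → Set (Euc d))
    {S : Set (Euc d)} (hS : MeasurableSet S) :
    arrangementMeasure A S = ∑' i, volume (A i ∩ S) := by
  simp only [arrangementMeasure, Measure.sum_apply _ hS, Measure.restrict_apply hS,
    Set.inter_comm]

theorem relDensity_eq_arrangementMeasure {d : ℕ} {ι : Type*} (A : ι → Set (Euc d))
    {S : Set (Euc d)} (hS : MeasurableSet S) (hb : Bornology.IsBounded S) :
    relDensity A S = (arrangementMeasure A S).toReal / (volume S).toReal := by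
  rw [relDensity, arrangementMeasure_apply A hS, ENNReal.tsum_toReal_eq]
  exact fun i => ((measure_mono inter_subset_right).trans_lt hb.measure_lt_top).ne

theorem arrangementMeasure_lt_top {d : ℕ} {ι : Type*} (A : ι → Set (Euc d))
    (hlf : ∀ B : Set (Euc d), Bornology.IsBounded B → {i : ι | (A i ∩ B).Nonempty}.Finite)
    {S : Set (Euc d)} (hS : MeasurableSet S) (hb : Bornology.IsBounded S) :
    arrangementMeasure A S < ⊤ := by
  rw [arrangementMeasure_apply A hS, tsum_eq_sum (s := (hlf S hb).toFinset)]
  · exact ENNReal.sum_lt_top.2 fun i _ =>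
      (measure_mono inter_subset_right).trans_lt hb.measure_lt_top
  · intro i hi
    simp only [Finite.mem_toFinset, mem_ofPred_eq, Set.not_nonempty_iff_eq_empty] at hi
    simp [hi]

theorem setOf_sub_mem_eq_vadd {E : Type*} [AddCommGroup E] (G : Set E) (x : E) :
    {y | y - x ∈ G} = x +ᵥ G := by
  ext y
  simp [Set.mem_vadd_set_iff_neg_vadd_mem, sub_eq_neg_add]

theorem measure_setOf_sub_mem {E : Type*} [NormedAddCommGroup E] [MeasurableSpace E]
    [BorelSpace E] (μ : Measure E) [μ.IsAddLeftInvariant] [μ.IsNegInvariant]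
    {G : Set E} (hG : MeasurableSet G) (y : E) : μ {x | y - x ∈ G} = μ G :=
  (Measure.measurePreserving_sub_left μ y).measure_preimage hG.nullMeasurableSet

section Translates

variable {E : Type*} [NormedAddCommGroup E] [MeasurableSpace E] [BorelSpace E]
  [SecondCountableTopology E]

theorem measurableSet_setOf_snd_sub_fst_mem {G : Set E} (hG : MeasurableSet G) :
    MeasurableSet {p : E × E | p.2 - p.1 ∈ G} :=
  (measurable_snd.sub measurable_fst) hG

theorem measurable_measure_vadd {G : Set E} (hG : MeasurableSet G) (ν : Measure E) [SFinite ν] :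
    Measurable fun x : E => ν (x +ᵥ G) := by
  have := measurable_measure_prodMk_left (ν := ν) (measurableSet_setOf_snd_sub_fst_mem hG)
  simpa only [preimage_ofPred_eq, setOf_sub_mem_eq_vadd] using this

theorem lintegral_measure_vadd {G : Set E} (hG : MeasurableSet G) (μ ν : Measure E)
    [SFinite μ] [SFinite ν] :
    ∫⁻ x, ν (x +ᵥ G) ∂μ = ∫⁻ y, μ {x | y - x ∈ G} ∂ν := by
  have h := measurableSet_setOf_snd_sub_fst_mem hG
  have h1 := Measure.prod_apply (μ := μ) (ν := ν) h
  rw [Measure.prod_apply_symm h] at h1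
  simp only [preimage_ofPred_eq, setOf_sub_mem_eq_vadd] at h1
  exact h1.symm

theorem lintegral_ball_measure_vadd_le {G : Set E} (hG : MeasurableSet G) (μ ν : Measure E)
    [SFinite μ] [SFinite ν] [μ.IsAddLeftInvariant] [μ.IsNegInvariant]
    {ρ : ℝ} (hρ : G ⊆ Metric.ball 0 ρ) (r : ℝ) :
    ∫⁻ x in Metric.ball 0 r, ν (x +ᵥ G) ∂μ ≤ μ G * ν (Metric.ball 0 (r + ρ)) := by
  rw [lintegral_measure_vadd hG, ← setLIntegral_const,
    ← lintegral_indicator Metric.isOpen_ball.measurableSet]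
  refine lintegral_mono fun y => ?_
  have hm : MeasurableSet {x | y - x ∈ G} := (measurable_const.sub measurable_id) hG
  rw [Measure.restrict_apply hm]
  by_cases hy : y ∈ Metric.ball (0 : E) (r + ρ)
  · rw [indicator_of_mem hy]
    exact (measure_mono inter_subset_left).trans (measure_setOf_sub_mem μ hG y).le
  · rw [indicator_of_notMem hy, nonpos_iff_eq_zero]
    convert measure_empty (μ := μ)
    refine eq_empty_of_forall_notMem fun x hx => hy ?_
    have h1 := hρ hx.1
    have h2 := hx.2
    simp only [mem_ball_zero_iff] at h1 h2 ⊢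
    calc ‖y‖ = ‖x + (y - x)‖ := by rw [add_sub_cancel]
      _ ≤ ‖x‖ + ‖y - x‖ := norm_add_le _ _
      _ < r + ρ := add_lt_add h2 h1

theorem le_lintegral_ball_measure_vadd {G : Set E} (hG : MeasurableSet G) (μ ν : Measure E)
    [SFinite μ] [SFinite ν] [μ.IsAddLeftInvariant] [μ.IsNegInvariant]
    {ρ : ℝ} (hρ : G ⊆ Metric.ball 0 ρ) (r : ℝ) :
    μ G * ν (Metric.ball 0 (r - ρ)) ≤ ∫⁻ x in Metric.ball 0 r, ν (x +ᵥ G) ∂μ := by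
  rw [lintegral_measure_vadd hG, ← setLIntegral_const,
    ← lintegral_indicator Metric.isOpen_ball.measurableSet]
  refine lintegral_mono (indicator_le fun y hy => ?_)
  have hm : MeasurableSet {x | y - x ∈ G} := (measurable_const.sub measurable_id) hG
  rw [Measure.restrict_apply hm, inter_eq_left.2, measure_setOf_sub_mem μ hG]
  intro x hx
  have h1 := hρ hx
  simp only [mem_ball_zero_iff] at h1 hy ⊢
  calc ‖x‖ = ‖y - (y - x)‖ := by rw [sub_sub_cancel]
    _ ≤ ‖y‖ + ‖y - x‖ := norm_sub_le _ _
    _ < r := by linarith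

end Translates

theorem toReal_volume_ball {d : ℕ} {r : ℝ} (hr : 0 < r) :
    (volume (Metric.ball (0 : Euc d) r)).toReal =
      r ^ d * (volume (Metric.ball (0 : Euc d) 1)).toReal := by
  rw [Measure.addHaar_ball_of_pos _ _ hr, ENNReal.toReal_mul,
    ENNReal.toReal_ofReal (by positivity), finrank_euclideanSpace_fin]

theorem toReal_volume_ball_pos {d : ℕ} {r : ℝ} (hr : 0 < r) :
    0 < (volume (Metric.ball (0 : Euc d) r)).toReal :=
  ENNReal.toReal_pos (Metric.measure_ball_pos _ _ hr).ne' measure_ball_lt_top.ne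

theorem tendsto_volume_ball_add_div (d : ℕ) (c : ℝ) :
    Filter.Tendsto
      (fun r : ℝ => (volume (Metric.ball (0 : Euc d) (r + c))).toReal /
        (volume (Metric.ball (0 : Euc d) r)).toReal)
      Filter.atTop (nhds 1) := by
  have h : Filter.Tendsto (fun r : ℝ => (1 + c / r) ^ d) Filter.atTop (nhds 1) := by
    simpa using (((Filter.tendsto_id (α := ℝ)).const_div_atTop c).const_add 1).pow d
  refine h.congr' ?_
  filter_upwards [Filter.eventually_gt_atTop 0, Filter.eventually_gt_atTop (-c)] with r h0 hc
  have h1 := (toReal_volume_ball_pos (d := d) one_pos).ne'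
  rw [toReal_volume_ball h0, toReal_volume_ball (by linarith : 0 < r + c),
    mul_div_mul_right _ _ h1, ← div_pow, add_div, div_self h0.ne']

/-- Changing the radius by a constant in the numerator does not affect the density. -/
theorem tendsto_arrangementMeasure_ball_add_div {d : ℕ} {ι : Type*} (A : ι → Set (Euc d))
    {a : ℝ}
    (hdens : Filter.Tendsto (fun r : ℝ => relDensity A (Metric.ball (0 : Euc d) r))
      Filter.atTop (nhds a)) (c : ℝ) :
    Filter.Tendsto
      (fun r : ℝ => (arrangementMeasure A (Metric.ball 0 (r + c))).toReal /
        (volume (Metric.ball (0 : Euc d) r)).toReal)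
      Filter.atTop (nhds a) := by
  have h := (hdens.comp (Filter.tendsto_atTop_add_const_right _ c Filter.tendsto_id)).mul
    (tendsto_volume_ball_add_div d c)
  rw [mul_one] at h
  refine h.congr' ?_
  filter_upwards [Filter.eventually_gt_atTop (-c)] with r hc
  have h1 := (toReal_volume_ball_pos (d := d) (by linarith : 0 < r + c)).ne'
  simp only [Function.comp_apply, id]
  rw [relDensity_eq_arrangementMeasure A Metric.isOpen_ball.measurableSet Metric.isBounded_ball,
    div_mul_div_cancel₀ h1]

theorem setIntegral_relDensity_vadd {d : ℕ} {ι : Type*} [Countable ι] (A : ι → Set (Euc d))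
    (hlf : ∀ B : Set (Euc d), Bornology.IsBounded B → {i : ι | (A i ∩ B).Nonempty}.Finite)
    {G : Set (Euc d)} (hGm : MeasurableSet G) (hGb : Bornology.IsBounded G) (S : Set (Euc d)) :
    ∫ x in S, relDensity A (x +ᵥ G) =
      (∫⁻ x in S, arrangementMeasure A (x +ᵥ G)).toReal / (volume G).toReal := by
  have h (x : Euc d) : relDensity A (x +ᵥ G) =
      (arrangementMeasure A (x +ᵥ G)).toReal / (volume G).toReal := by
    rw [relDensity_eq_arrangementMeasure A (hGm.const_vadd x) (hGb.vadd x),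
      measure_vadd volume]
  simp_rw [h]
  rw [integral_div, integral_toReal (measurable_measure_vadd hGm _).aemeasurable
    (Filter.Eventually.of_forall fun x =>
      arrangementMeasure_lt_top A hlf (hGm.const_vadd x) (hGb.vadd x))]

/-- For a locally finite arrangement `A` of uniformly bounded measurable sets in
`Euc d` and a bounded measurable set `G` of positive measure: if the density of `A`
exists and equals `a`, then the average density of `A` relative to translates of `G`
exists and also equals `a`. -/
theorem average_relative_density_eq_density (d : ℕ) {ι : Type*} [Countable ι]
    (A : ι → Set (Euc d)) (hmeas : ∀ i, MeasurableSet (A i))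
    (R : ℝ) (hbdd : ∀ i, Metric.diam (A i) ≤ R)
    (hbddsets : ∀ i, Bornology.IsBounded (A i))
    (hlf : ∀ B : Set (Euc d), Bornology.IsBounded B → {i : ι | (A i ∩ B).Nonempty}.Finite)
    (G : Set (Euc d)) (hGm : MeasurableSet G) (hGb : Bornology.IsBounded G)
    (hGpos : 0 < volume G)
    (a : ℝ)
    (hdens : Filter.Tendsto
      (fun r : ℝ => relDensity A (Metric.ball (0 : Euc d) r))
      Filter.atTop (nhds a)) :
    Filter.Tendsto
      (fun r : ℝ =>
        (∫ x in Metric.ball (0 : Euc d) r, relDensity A (x +ᵥ G)) /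
          (volume (Metric.ball (0 : Euc d) r)).toReal)
      Filter.atTop (nhds a) := by
  obtain ⟨ρ, hρ⟩ := hGb.subset_ball 0
  have hG : 0 < (volume G).toReal := ENNReal.toReal_pos hGpos.ne' hGb.measure_lt_top.ne
  have hball (s : ℝ) : volume G * arrangementMeasure A (Metric.ball 0 s) ≠ ⊤ :=
    ENNReal.mul_ne_top hGb.measure_lt_top.ne
      (arrangementMeasure_lt_top A hlf Metric.isOpen_ball.measurableSet Metric.isBounded_ball).ne
  refine tendsto_of_tendsto_of_tendsto_of_le_of_le
    (tendsto_arrangementMeasure_ball_add_div A hdens (-ρ))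
    (tendsto_arrangementMeasure_ball_add_div A hdens ρ) (fun r => ?_) (fun r => ?_)
  all_goals
    have hle := lintegral_ball_measure_vadd_le hGm volume (arrangementMeasure A) hρ r
    simp only [setIntegral_relDensity_vadd A hlf hGm hGb]
    refine div_le_div_of_nonneg_right ?_ ENNReal.toReal_nonneg
  · rw [le_div_iff₀' hG, ← ENNReal.toReal_mul, ← sub_eq_add_neg]
    exact ENNReal.toReal_mono (ne_top_of_le_ne_top (hball _) hle)
      (le_lintegral_ball_measure_vadd hGm volume (arrangementMeasure A) hρ r)
  · rw [div_le_iff₀' hG, ← ENNReal.toReal_mul]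
    exact ENNReal.toReal_mono (hball _) hle
end
end

section
/- Let D be a locally finite set of points in E^d whose number density exists and equals a, and let G be a bounded measurable subset of E^d with positive Lebesgue measure. Then there exists a translate G + x of G containing at least a·vol(G) points of D, and there exists a translate G + y containing at most a·vol(G) points of D. -/
open Set MeasureTheory Pointwise

noncomputable section

theorem mem_vadd_set_iff_sub_mem {d : ℕ} (G : Set (Euc d)) (p x : Euc d) :
    p ∈ x +ᵥ G ↔ p - x ∈ G := by
  rw [mem_vadd_set_iff_neg_vadd_mem, vadd_eq_add, neg_add_eq_sub]

theorem measurableSet_setOf_sub_mem {d : ℕ} {G : Set (Euc d)} (hG : MeasurableSet G)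
    (p : Euc d) : MeasurableSet {x : Euc d | p - x ∈ G} :=
  (measurable_const.sub measurable_id) hG

theorem volume_setOf_sub_mem {d : ℕ} {G : Set (Euc d)} (hG : MeasurableSet G) (p : Euc d) :
    volume {x : Euc d | p - x ∈ G} = volume G :=
  (Measure.measurePreserving_sub_left volume p).measure_preimage hG.nullMeasurableSet

theorem lintegral_sum_indicator_sub_mem {d : ℕ} {G : Set (Euc d)} (hG : MeasurableSet G)
    (F : Finset (Euc d)) :
    ∫⁻ x, ∑ p ∈ F, {x : Euc d | p - x ∈ G}.indicator 1 x = F.card * volume G := by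
  rw [lintegral_finsetSum F
    fun p _ => measurable_one.indicator (measurableSet_setOf_sub_mem hG p)]
  simp [lintegral_indicator_one (measurableSet_setOf_sub_mem hG _), volume_setOf_sub_mem hG]

theorem sum_indicator_sub_mem {d : ℕ} (G : Set (Euc d)) (F : Finset (Euc d)) (x : Euc d) :
    ∑ p ∈ F, {x : Euc d | p - x ∈ G}.indicator (1 : Euc d → ENNReal) x =
      ((F : Set (Euc d)) ∩ (x +ᵥ G)).ncard := by
  classical
  have h : (F : Set (Euc d)) ∩ (x +ᵥ G) = (F.filter fun p => p - x ∈ G : Finset (Euc d)) := by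
    ext p
    simp [mem_vadd_set_iff_sub_mem]
  rw [h, ncard_coe_finset]
  simp [Set.indicator_apply]

theorem mul_volume_ball_le {d : ℕ} {D : Set (Euc d)}
    (hlf : ∀ B : Set (Euc d), Bornology.IsBounded B → (D ∩ B).Finite)
    {G : Set (Euc d)} (hGm : MeasurableSet G) {R : ℝ} (hR : G ⊆ Metric.ball 0 R)
    {m : ℕ} (hm : ∀ x : Euc d, m ≤ (D ∩ (x +ᵥ G)).ncard) (r : ℝ) :
    m * volume (Metric.ball (0 : Euc d) r) ≤
      (D ∩ Metric.ball (0 : Euc d) (r + R)).ncard * volume G := by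
  have hfin := hlf _ (Metric.isBounded_ball (x := (0 : Euc d)) (r := r + R))
  rw [ncard_eq_toFinset_card _ hfin, ← lintegral_sum_indicator_sub_mem hGm,
    ← setLIntegral_const]
  refine (setLIntegral_mono' measurableSet_ball fun x hx => ?_).trans
    (setLIntegral_le_lintegral _ _)
  rw [sum_indicator_sub_mem, hfin.coe_toFinset, Nat.cast_le]
  refine (hm x).trans (ncard_le_ncard ?_ (hfin.inter_of_left _))
  rintro p ⟨hpD, hpG⟩
  refine ⟨⟨hpD, ?_⟩, hpG⟩
  have h := hR ((mem_vadd_set_iff_sub_mem G p x).1 hpG)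
  rw [mem_ball_zero_iff] at *
  calc ‖p‖ = ‖x + (p - x)‖ := by rw [add_sub_cancel]
    _ ≤ ‖x‖ + ‖p - x‖ := norm_add_le _ _
    _ < r + R := add_lt_add hx h

theorem ncard_ball_mul_volume_le {d : ℕ} {D : Set (Euc d)}
    (hlf : ∀ B : Set (Euc d), Bornology.IsBounded B → (D ∩ B).Finite)
    {G : Set (Euc d)} (hGm : MeasurableSet G) {R : ℝ} (hR : G ⊆ Metric.ball 0 R)
    {m : ℕ} (hm : ∀ x : Euc d, (D ∩ (x +ᵥ G)).ncard ≤ m) (r : ℝ) :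
    (D ∩ Metric.ball (0 : Euc d) r).ncard * volume G ≤
      m * volume (Metric.ball (0 : Euc d) (r + R)) := by
  have hfin := hlf _ (Metric.isBounded_ball (x := (0 : Euc d)) (r := r))
  rw [ncard_eq_toFinset_card _ hfin, ← lintegral_sum_indicator_sub_mem hGm,
    ← setLIntegral_const, ← lintegral_indicator measurableSet_ball]
  refine lintegral_mono fun x => ?_
  dsimp only
  rw [sum_indicator_sub_mem, hfin.coe_toFinset]
  by_cases hx : x ∈ Metric.ball (0 : Euc d) (r + R)
  · rw [indicator_of_mem hx, Nat.cast_le]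
    have hGb : Bornology.IsBounded (x +ᵥ G) := (Metric.isBounded_ball.subset hR).vadd x
    exact (ncard_le_ncard (inter_subset_inter_left _ inter_subset_left) (hlf _ hGb)).trans (hm x)
  · suffices h : D ∩ Metric.ball 0 r ∩ (x +ᵥ G) = ∅ by simp [h]
    refine eq_empty_of_forall_notMem fun p ⟨⟨_, hpr⟩, hpG⟩ => hx ?_
    have h := hR ((mem_vadd_set_iff_sub_mem G p x).1 hpG)
    rw [mem_ball_zero_iff] at *
    calc ‖x‖ = ‖p - (p - x)‖ := by rw [sub_sub_cancel]
      _ ≤ ‖p‖ + ‖p - x‖ := norm_sub_le _ _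
      _ < r + R := add_lt_add hpr h

theorem tendsto_volume_ball_add_div_volume_ball (d : ℕ) (R : ℝ) :
    Filter.Tendsto
      (fun r : ℝ => (volume (Metric.ball (0 : Euc d) (r + R))).toReal /
        (volume (Metric.ball (0 : Euc d) r)).toReal)
      Filter.atTop (nhds 1) := by
  have h : Filter.Tendsto (fun r : ℝ => (1 + R / r) ^ d) Filter.atTop (nhds 1) := by
    simpa using ((Filter.tendsto_id.const_div_atTop R).const_add 1).pow d
  refine h.congr' ?_
  filter_upwards [Filter.eventually_gt_atTop 0, Filter.eventually_gt_atTop (-R)] with r hr hrR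
  have hunit : (volume (Metric.ball (0 : Euc d) 1)).toReal ≠ 0 :=
    (ENNReal.toReal_pos (Metric.measure_ball_pos volume _ one_pos).ne'
      measure_ball_lt_top.ne).ne'
  have hrR' : 0 < r + R := by linarith
  rw [Measure.addHaar_ball_of_pos _ _ hr, Measure.addHaar_ball_of_pos _ _ hrR', ENNReal.toReal_mul,
    ENNReal.toReal_mul, ENNReal.toReal_ofReal (by positivity),
    ENNReal.toReal_ofReal (by positivity), mul_div_mul_right _ _ hunit,
    finrank_euclideanSpace_fin, ← div_pow, add_div, div_self hr.ne']

/-- For a locally finite point set `D` in `Euc d` whose number density exists and equals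
`a`, and a bounded measurable set `G` of positive measure, some translate of `G`
contains at least `a·vol(G)` points of `D`, and some translate contains at most
`a·vol(G)` points of `D`. -/
theorem exists_translate_many_points_and_few_points (d : ℕ) (D : Set (Euc d))
    (hlf : ∀ B : Set (Euc d), Bornology.IsBounded B → (D ∩ B).Finite)
    (a : ℝ)
    (hdens : Filter.Tendsto
      (fun r : ℝ =>
        ((D ∩ Metric.ball (0 : Euc d) r).ncard : ℝ) /
          (volume (Metric.ball (0 : Euc d) r)).toReal)
      Filter.atTop (nhds a))
    (G : Set (Euc d)) (hGm : MeasurableSet G) (hGb : Bornology.IsBounded G)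
    (hGpos : 0 < volume G) :
    (∃ x : Euc d, a * (volume G).toReal ≤ ((D ∩ (x +ᵥ G)).ncard : ℝ)) ∧
    (∃ y : Euc d, ((D ∩ (y +ᵥ G)).ncard : ℝ) ≤ a * (volume G).toReal) := by
  obtain ⟨R, hR⟩ := hGb.subset_ball 0
  have hGfin : volume G ≠ ⊤ := hGb.measure_lt_top.ne
  have hratio := tendsto_volume_ball_add_div_volume_ball d R
  have hpos : ∀ᶠ r : ℝ in Filter.atTop, 0 < (volume (Metric.ball (0 : Euc d) r)).toReal := by
    filter_upwards [Filter.eventually_gt_atTop 0] with r hr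
    exact ENNReal.toReal_pos (Metric.measure_ball_pos volume _ hr).ne' measure_ball_lt_top.ne
  have hshift : Filter.Tendsto (fun r : ℝ => r + R) Filter.atTop Filter.atTop :=
    Filter.tendsto_atTop_add_const_right _ R Filter.tendsto_id
  constructor
  · by_contra! hlt
    set m := ⌈a * (volume G).toReal⌉₊ - 1
    have hceil : 0 < ⌈a * (volume G).toReal⌉₊ := (Nat.zero_le _).trans_lt (Nat.lt_ceil.2 (hlt 0))
    have hm : ∀ x : Euc d, (D ∩ (x +ᵥ G)).ncard ≤ m := fun x =>
      Nat.le_sub_one_of_lt (Nat.lt_ceil.2 (hlt x))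
    have hmlt : (m : ℝ) < a * (volume G).toReal := Nat.lt_ceil.1 (Nat.sub_one_lt hceil.ne')
    have hlim := hratio.const_mul (m : ℝ)
    rw [mul_one] at hlim
    refine hmlt.not_ge (le_of_tendsto_of_tendsto (hdens.mul_const _) hlim ?_)
    filter_upwards [hpos] with r hr
    have h := ENNReal.toReal_mono (by finiteness) (ncard_ball_mul_volume_le hlf hGm hR hm r)
    rw [ENNReal.toReal_mul, ENNReal.toReal_mul, ENNReal.toReal_natCast,
      ENNReal.toReal_natCast] at h
    rw [div_mul_eq_mul_div, ← mul_div_assoc]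
    gcongr
  · obtain ⟨y, hy⟩ := exists_minimalFor_of_wellFoundedLT (fun _ : Euc d => True)
      (fun x => (D ∩ (x +ᵥ G)).ncard) ⟨0, trivial⟩
    have hm : ∀ x : Euc d, (D ∩ (y +ᵥ G)).ncard ≤ (D ∩ (x +ᵥ G)).ncard := fun x =>
      (le_total _ _).elim id (hy.2 trivial)
    refine ⟨y, ?_⟩
    have hlim := (hdens.comp hshift).mul_const (volume G).toReal |>.mul hratio
    rw [mul_one] at hlim
    refine ge_of_tendsto hlim ?_
    filter_upwards [hpos, hshift.eventually hpos] with r hr hrR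
    have h := ENNReal.toReal_mono (by finiteness) (mul_volume_ball_le hlf hGm hR hm r)
    rw [ENNReal.toReal_mul, ENNReal.toReal_mul, ENNReal.toReal_natCast,
      ENNReal.toReal_natCast] at h
    rw [Function.comp_apply, div_mul_eq_mul_div, div_mul_div_cancel₀ hrR.ne']
    exact (le_div_iff₀ hr).2 h
end
end
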